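/- A map Z : P_o^3 → K_o^3 is an SL(3) covariant Minkowski valuation if and only if there exist constants a₁, a₂, b₁, b₂, c₁, c₂ ≥ 0 satisfying a₁ ≤ a₂, b₁ ≤ b₂, a₂ − a₁ ≤ b₂ and b₂ − b₁ ≤ a₂ such that ZP = c₁·M⁺P + c₂·M⁻P + D_{a₁,a₂,b₁,b₂}P for every P ∈ P_o^3. -/

import Mathlib

open scoped RealInnerProductSpace BigOperators Pointwise ENNReal
open MeasureTheory Filter Matrix

noncomputable section

/-- `Euc n` is Euclidean space `ℝ^n`. -/
abbrev Euc (n : ℕ) := EuclideanSpace ℝ (Fin n)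

/-- A convex body in `ℝ^n` containing the origin: a nonempty compact convex set with `0 ∈ K`. -/
def IsConvexBody0 {n : ℕ} (K : Set (Euc n)) : Prop :=
  IsCompact K ∧ Convex ℝ K ∧ (0 : Euc n) ∈ K

/-- A convex polytope in `ℝ^n` containing the origin. -/
def IsPolytope0 {n : ℕ} (P : Set (Euc n)) : Prop :=
  (∃ S : Finset (Euc n), P = convexHull ℝ (S : Set (Euc n))) ∧ (0 : Euc n) ∈ P

/-- The support function `h_K(x) = sup { ⟪x, y⟫ : y ∈ K }`. -/
def supp {n : ℕ} (K : Set (Euc n)) (x : Euc n) : ℝ :=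
  sSup ((fun y => ⟪x, y⟫) '' K)

/-- The image of a set under the linear map induced by a matrix. -/
def matAct {n : ℕ} (A : Matrix (Fin n) (Fin n) ℝ) (K : Set (Euc n)) : Set (Euc n) :=
  (Matrix.toEuclideanLin A) '' K

/-- The vector `A x`. -/
def matVec {n : ℕ} (A : Matrix (Fin n) (Fin n) ℝ) (x : Euc n) : Euc n :=
  Matrix.toEuclideanLin A x

/-- The dimension of a set: the dimension of (the direction of) its affine hull. -/
def sdim {n : ℕ} (P : Set (Euc n)) : ℕ :=
  Module.finrank ℝ (affineSpan ℝ P).direction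

/-- Support function of the asymmetric moment body: `h_{M⁺K}(x) = ∫_K max(⟪x,y⟫,0) dy`. -/
def mPlus1 {n : ℕ} (K : Set (Euc n)) (x : Euc n) : ℝ :=
  ∫ y in K, max ⟪x, y⟫ 0

/-- Support function of the asymmetric moment body `M⁻`. -/
def mMinus1 {n : ℕ} (K : Set (Euc n)) (x : Euc n) : ℝ :=
  ∫ y in K, max (-⟪x, y⟫) 0

/-- The set of `j`-dimensional faces of `P` containing the origin (faces of a polytope
being exactly its exposed faces). -/
def facesO {n : ℕ} (j : ℕ) (P : Set (Euc n)) : Set (Set (Euc n)) :=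
  {F | IsExposed ℝ P F ∧ sdim F = j ∧ (0 : Euc n) ∈ F}

/-- `Z` is `SL(n)` covariant on polytopes containing the origin. -/
def SLCovariant {n : ℕ} (Z : Set (Euc n) → Set (Euc n)) : Prop :=
  ∀ (φ : Matrix.SpecialLinearGroup (Fin n) ℝ) (P : Set (Euc n)), IsPolytope0 P →
    Z (matAct (φ : Matrix (Fin n) (Fin n) ℝ) P) = matAct (φ : Matrix (Fin n) (Fin n) ℝ) (Z P)

/-- The support function of the generalized difference body `D_{a₁,a₂,b₁,b₂} P` for
`P ∈ P_o^3` (the cases `dim P = 3, 2, 1`; it is `0` for `P = {o}`).  Here `F_o(P)`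
(resp. `E_o(P)`) is the set of 2-faces (resp. edges) of `P` containing the origin, and
`h_{-F}(x) = h_F(-x)`. -/
def hD (a₁ a₂ b₁ b₂ : ℝ) (P : Set (Euc 3)) (x : Euc 3) : ℝ :=
  if sdim P = 3 then
    a₁ * supp P x + (a₂ - a₁) * ∑ᶠ F ∈ facesO 2 P, supp F x
      - (a₂ - a₁) * ∑ᶠ E ∈ facesO 1 P, supp E x
      + b₁ * supp P (-x) + (b₂ - b₁) * ∑ᶠ F ∈ facesO 2 P, supp F (-x)
      - (b₂ - b₁) * ∑ᶠ E ∈ facesO 1 P, supp E (-x)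
  else if sdim P = 2 then
    (2 * a₂ - a₁) * supp P x - (a₂ - a₁) * ∑ᶠ E ∈ facesO 1 P, supp E x
      + (2 * b₂ - b₁) * supp P (-x) - (b₂ - b₁) * ∑ᶠ E ∈ facesO 1 P, supp E (-x)
  else if sdim P = 1 then
    a₁ * supp P x + b₁ * supp P (-x)
  else 0

/-- `Z` is a Minkowski valuation (with ordinary Minkowski addition of sets). -/
def ValuationMink (Z : Set (Euc 3) → Set (Euc 3)) : Prop :=
  ∀ K L : Set (Euc 3), IsPolytope0 K → IsPolytope0 L → IsPolytope0 (K ∪ L) →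
    IsPolytope0 (K ∩ L) → Z (K ∪ L) + Z (K ∩ L) = Z K + Z L

/-! ### Polytopes as bounded polyhedra -/

/-- A finite intersection of closed halfspaces. -/
def IsPolyhedron {E : Type*} [NormedAddCommGroup E] [NormedSpace ℝ E] (K : Set E) : Prop :=
  ∃ L : List ((E →L[ℝ] ℝ) × ℝ), K = {x | ∀ p ∈ L, p.1 x ≤ p.2}

section Polyhedron

variable {E : Type*} [NormedAddCommGroup E] [NormedSpace ℝ E]

lemma isPolyhedron_halfspace (f : E →L[ℝ] ℝ) (c : ℝ) : IsPolyhedron {x | f x ≤ c} :=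
  ⟨[(f, c)], by simp⟩

lemma IsPolyhedron.inter {K L : Set E} (hK : IsPolyhedron K) (hL : IsPolyhedron L) :
    IsPolyhedron (K ∩ L) := by
  obtain ⟨A, rfl⟩ := hK
  obtain ⟨B, rfl⟩ := hL
  refine ⟨A ++ B, ?_⟩
  ext x
  constructor
  · rintro ⟨h1, h2⟩ p hp
    rcases List.mem_append.1 hp with h | h
    exacts [h1 p h, h2 p h]
  · intro h
    exact ⟨fun p hp => h p (List.mem_append_left _ hp),
      fun p hp => h p (List.mem_append_right _ hp)⟩

lemma isPolyhedron_forall {ι : Type*} (s : Finset ι) (f : ι → E →L[ℝ] ℝ) (c : ι → ℝ) :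
    IsPolyhedron {x | ∀ i ∈ s, f i x ≤ c i} := by
  refine ⟨s.toList.map fun i => (f i, c i), ?_⟩
  ext x
  simp

lemma IsPolyhedron.isClosed {K : Set E} (hK : IsPolyhedron K) : IsClosed K := by
  obtain ⟨L, rfl⟩ := hK
  have : {x : E | ∀ p ∈ L, p.1 x ≤ p.2} = ⋂ p ∈ L, {x | p.1 x ≤ p.2} := by
    ext x; simp
  rw [this]
  exact isClosed_biInter fun p _ => isClosed_le p.1.continuous continuous_const

lemma IsPolyhedron.convex {K : Set E} (hK : IsPolyhedron K) : Convex ℝ K := by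
  obtain ⟨L, rfl⟩ := hK
  intro x hx y hy a b ha hb hab p hp
  have h1 := mul_le_mul_of_nonneg_left (hx p hp) ha
  have h2 := mul_le_mul_of_nonneg_left (hy p hp) hb
  have : p.2 = a * p.2 + b * p.2 := by rw [← add_mul, hab, one_mul]
  simp only [map_add, map_smul, smul_eq_mul]
  linarith

lemma IsPolyhedron.finite_extremePoints {K : Set E} (hK : IsPolyhedron K) :
    (K.extremePoints ℝ).Finite := by
  classical
  obtain ⟨L, rfl⟩ := hK
  let act : E → Finset ((E →L[ℝ] ℝ) × ℝ) := fun x => L.toFinset.filter fun p => p.1 x = p.2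
  refine Set.Finite.of_finite_image (f := act) ?_ ?_
  · refine (L.toFinset.powerset : Set _).toFinite.subset ?_
    rintro _ ⟨x, -, rfl⟩
    simp only [act, Finset.coe_powerset, Set.mem_preimage, Set.mem_powerset_iff, Finset.coe_subset]
    exact Finset.filter_subset _ _
  · intro x hx y hy hxy
    by_contra hne
    have hact : ∀ p ∈ L, p.1 x = p.2 ↔ p.1 y = p.2 := by
      intro p hp
      have := congrArg (p ∈ ·) hxy
      simpa [act, hp] using this
    -- a slack constant valid for all inactive constraints
    obtain ⟨ε, hε, hε'⟩ : ∃ ε > 0, ∀ p ∈ L, p.1 x + ε * |p.1 (y - x)| ≤ p.2 := by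
      have key : ∀ p ∈ L, ∀ᶠ ε in nhdsWithin (0 : ℝ) (Set.Ioi 0),
          p.1 x + ε * |p.1 (y - x)| ≤ p.2 := by
        intro p hp
        by_cases h : p.1 x = p.2
        · have h' := (hact p hp).1 h
          refine Eventually.of_forall fun ε => ?_
          simp [h, h']
        · have hlt : p.1 x < p.2 := lt_of_le_of_ne (hx.1 p hp) h
          have hc : Tendsto (fun ε : ℝ => p.1 x + ε * |p.1 (y - x)|) (nhds 0)
              (nhds (p.1 x + 0 * |p.1 (y - x)|)) := Continuous.tendsto (by fun_prop) 0
          rw [zero_mul, add_zero] at hc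
          exact ((hc.mono_left nhdsWithin_le_nhds).eventually (gt_mem_nhds hlt)).mono
            fun _ h => le_of_lt h
      have hall : ∀ᶠ ε in nhdsWithin (0 : ℝ) (Set.Ioi 0),
          ∀ p ∈ L.toFinset, p.1 x + ε * |p.1 (y - x)| ≤ p.2 :=
        (Filter.eventually_all_finset _).2 fun p hp => key p (by simpa using hp)
      obtain ⟨ε, h1, h2⟩ := (hall.and self_mem_nhdsWithin).exists
      exact ⟨ε, h2, fun p hp => h1 p (by simpa using hp)⟩
    have hmem : ∀ σ : ℝ, |σ| = ε → x + σ • (y - x) ∈ {x : E | ∀ p ∈ L, p.1 x ≤ p.2} := by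
      intro σ hσ p hp
      have h1 := hε' p hp
      have h2 : σ * p.1 (y - x) ≤ ε * |p.1 (y - x)| := by
        rw [← hσ, ← abs_mul]; exact le_abs_self _
      rw [map_add, map_smul, smul_eq_mul]
      linarith
    have h1 := hmem ε (abs_of_pos hε)
    have h2 := hmem (-ε) (by rw [abs_neg, abs_of_pos hε])
    have hseg : x ∈ openSegment ℝ (x + ε • (y - x)) (x + (-ε) • (y - x)) := by
      refine ⟨1 / 2, 1 / 2, by norm_num, by norm_num, by norm_num, ?_⟩
      module
    have := hx.2 h1 h2 hseg
    have h3 : ε • (y - x) = 0 := by simpa using this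
    rcases smul_eq_zero.1 h3 with h | h
    · exact hε.ne' h
    · exact hne (sub_eq_zero.1 h).symm

/-- A compact polyhedron is the convex hull of a finite set. -/
lemma IsPolyhedron.exists_finset [FiniteDimensional ℝ E] {K : Set E} (hK : IsPolyhedron K)
    (hc : IsCompact K) : ∃ S : Finset E, K = convexHull ℝ (S : Set E) := by
  refine ⟨hK.finite_extremePoints.toFinset, ?_⟩
  rw [Set.Finite.coe_toFinset]
  have h := closure_convexHull_extremePoints hc hK.convex
  rw [(hK.finite_extremePoints.isClosed_convexHull ℝ).closure_eq] at h
  exact h.symm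

end Polyhedron

lemma le_of_mem_convexHull {E : Type*} [AddCommGroup E] [Module ℝ E] {S : Set E}
    (f : E →ₗ[ℝ] ℝ) {c : ℝ} (h : ∀ s ∈ S, f s ≤ c) {x : E} (hx : x ∈ convexHull ℝ S) :
    f x ≤ c :=
  convexHull_min (t := {x | f x ≤ c}) h (convex_halfSpace_le f.isLinear c) hx

/-- The convex hull of a finite set containing the origin in its hull is a polyhedron. -/
lemma isPolyhedron_convexHull {n : ℕ} (S : Finset (Euc n))
    (h0 : (0 : Euc n) ∈ convexHull ℝ (S : Set (Euc n))) :
    IsPolyhedron (convexHull ℝ (S : Set (Euc n))) := by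
  classical
  set P := convexHull ℝ (S : Set (Euc n)) with hP
  have hPc : IsClosed P := S.finite_toSet.isClosed_convexHull ℝ
  obtain ⟨M, hM0, hM⟩ : ∃ M : ℝ, 0 ≤ M ∧ ∀ s ∈ S, ∑ i, |s i| ≤ M :=
    ⟨∑ s ∈ S, ∑ i, |s i|, by positivity, fun s hs =>
      Finset.single_le_sum (f := fun s : Euc n => ∑ i, |s i|) (fun _ _ => by positivity) hs⟩
  let coord : Fin n → (Euc n × ℝ) →L[ℝ] ℝ := fun i =>
    (EuclideanSpace.proj i).comp (ContinuousLinearMap.fst ℝ (Euc n) ℝ)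
  let N : Set (Euc n × ℝ) :=
    ({q | ∀ s ∈ S, ((innerSL ℝ s).comp (ContinuousLinearMap.fst ℝ (Euc n) ℝ)
        - ContinuousLinearMap.snd ℝ (Euc n) ℝ) q ≤ 0} ∩
      ({q | ∀ i ∈ (Finset.univ : Finset (Fin n)), coord i q ≤ 1} ∩
        {q | ∀ i ∈ (Finset.univ : Finset (Fin n)), (-coord i) q ≤ 1})) ∩
      ({q | ContinuousLinearMap.snd ℝ (Euc n) ℝ q ≤ M} ∩
        {q | (-ContinuousLinearMap.snd ℝ (Euc n) ℝ) q ≤ 0})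
  have hNmem : ∀ q : Euc n × ℝ, q ∈ N ↔
      (∀ s ∈ S, ⟪s, q.1⟫ ≤ q.2) ∧ (∀ i, |q.1 i| ≤ 1) ∧ 0 ≤ q.2 ∧ q.2 ≤ M := by
    intro q
    simp only [N, coord, Set.mem_inter_iff, Set.mem_ofPred_eq, abs_le]
    simp
    constructor
    · rintro ⟨⟨h1, h2, h3⟩, h4, h5⟩
      exact ⟨h1, fun i => ⟨by linarith [h3 i], h2 i⟩, h5, h4⟩
    · rintro ⟨h1, h2, h3, h4⟩
      exact ⟨⟨h1, fun i => (h2 i).2, fun i => by linarith [(h2 i).1]⟩, h4, h3⟩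
  have hNp : IsPolyhedron N :=
    ((isPolyhedron_forall S _ (fun _ => 0)).inter ((isPolyhedron_forall _ _ (fun _ => 1)).inter
      (isPolyhedron_forall _ _ (fun _ => 1)))).inter
      ((isPolyhedron_halfspace _ _).inter (isPolyhedron_halfspace _ _))
  have hNb : Bornology.IsBounded N := by
    refine (Metric.isBounded_closedBall (x := (0 : Euc n × ℝ)) (r := n + M)).subset ?_
    intro q hq
    obtain ⟨-, h2, h3, h4⟩ := (hNmem q).1 hq
    rw [mem_closedBall_zero_iff, Prod.norm_def]
    refine max_le ?_ ?_
    · have : ‖q.1‖ ≤ ∑ i : Fin n, |q.1 i| := by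
        rw [EuclideanSpace.norm_eq]
        refine Real.sqrt_le_iff.2 ⟨by positivity, ?_⟩
        simp only [Real.norm_eq_abs]
        exact Finset.sum_sq_le_sq_sum_of_nonneg fun i _ => abs_nonneg _
      have h5 : ∑ i : Fin n, |q.1 i| ≤ ∑ i : Fin n, (1 : ℝ) := Finset.sum_le_sum fun i _ => h2 i
      simp at h5
      linarith
    · rw [Real.norm_eq_abs, abs_of_nonneg h3]
      have : (0 : ℝ) ≤ n := Nat.cast_nonneg n
      linarith
  obtain ⟨U, hU⟩ := hNp.exists_finset (Metric.isCompact_of_isClosed_isBounded hNp.isClosed hNb)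
  have hPeq : P = {x | ∀ q ∈ U, innerSL ℝ q.1 x ≤ q.2} := by
    ext x
    constructor
    · intro hx q hq
      have hqN : q ∈ N := by rw [hU]; exact subset_convexHull ℝ _ hq
      refine le_of_mem_convexHull (innerSL ℝ q.1).toLinearMap (fun s hs => ?_) hx
      have := ((hNmem q).1 hqN).1 s hs
      rw [real_inner_comm] at this
      simpa using this
    · intro hx
      by_contra hxP
      obtain ⟨f, c, hf, hfx⟩ := geometric_hahn_banach_closed_point (convex_convexHull ℝ _) hPc hxP
      obtain ⟨u, rfl⟩ := (InnerProductSpace.toDual ℝ (Euc n)).surjective f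
      simp only [InnerProductSpace.toDual_apply_apply] at hf hfx
      have hc : 0 < c := by simpa using hf 0 h0
      -- rescale the separating functional into the unit cube
      set r : ℝ := 1 + ∑ i, |u i| with hr
      have hrpos : 0 < r := by positivity
      set w : Euc n := r⁻¹ • u with hw
      have hwi : ∀ i, |w i| ≤ 1 := by
        intro i
        have : |u i| ≤ ∑ j, |u j| :=
          Finset.single_le_sum (f := fun j => |u j|) (fun _ _ => abs_nonneg _) (Finset.mem_univ i)
        simp only [hw, PiLp.smul_apply, smul_eq_mul, abs_mul, abs_inv, abs_of_pos hrpos]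
        rw [inv_mul_le_iff₀ hrpos]
        linarith
      have hwS : ∀ s ∈ S, ⟪s, w⟫ ≤ M := by
        intro s hs
        calc ⟪s, w⟫ ≤ ∑ i, |s i| := by
              rw [PiLp.inner_apply]
              refine Finset.sum_le_sum fun i _ => ?_
              simp only [RCLike.inner_apply, conj_trivial]
              calc w i * s i ≤ |w i * s i| := le_abs_self _
                _ = |w i| * |s i| := abs_mul _ _
                _ ≤ 1 * |s i| := mul_le_mul_of_nonneg_right (hwi i) (abs_nonneg _)
                _ = |s i| := one_mul _
          _ ≤ M := hM s hs
      have hwc : ∀ s ∈ S, ⟪s, w⟫ ≤ r⁻¹ * c := by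
        intro s hs
        rw [hw, inner_smul_right, real_inner_comm]
        exact mul_le_mul_of_nonneg_left (hf s (subset_convexHull ℝ _ hs)).le (by positivity)
      have hN : (w, min M (r⁻¹ * c)) ∈ N := by
        refine (hNmem _).2 ⟨fun s hs => le_min (hwS s hs) (hwc s hs), hwi, ?_, min_le_left _ _⟩
        exact le_min hM0 (by positivity)
      rw [hU] at hN
      have := le_of_mem_convexHull (S := (U : Set (Euc n × ℝ)))
        (((innerSL ℝ x).comp (ContinuousLinearMap.fst ℝ (Euc n) ℝ)
          - ContinuousLinearMap.snd ℝ (Euc n) ℝ).toLinearMap) (c := 0)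
        (fun q hq => by
          have := hx q hq
          simp only [innerSL_apply_apply] at this
          rw [real_inner_comm] at this
          simpa using this) hN
      simp only [ContinuousLinearMap.coe_coe, _root_.sub_apply,
        ContinuousLinearMap.comp_apply, ContinuousLinearMap.coe_fst', innerSL_apply_apply,
        ContinuousLinearMap.coe_snd'] at this
      have h1 : ⟪x, w⟫ = r⁻¹ * ⟪u, x⟫ := by rw [hw, inner_smul_right, real_inner_comm]
      have h2 : r⁻¹ * c < r⁻¹ * ⟪u, x⟫ := mul_lt_mul_of_pos_left hfx (by positivity)
      have h3 : min M (r⁻¹ * c) ≤ r⁻¹ * c := min_le_right _ _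
      linarith
  rw [hPeq]
  exact isPolyhedron_forall U (fun q => innerSL ℝ q.1) fun q => q.2

namespace IsPolytope0

variable {n : ℕ} {P Q : Set (Euc n)}

lemma isPolyhedron (hP : IsPolytope0 P) : IsPolyhedron P := by
  obtain ⟨⟨S, rfl⟩, h0⟩ := hP
  exact isPolyhedron_convexHull S h0

lemma isCompact (hP : IsPolytope0 P) : IsCompact P := by
  obtain ⟨⟨S, rfl⟩, -⟩ := hP
  exact S.finite_toSet.isCompact_convexHull ℝ

lemma convex (hP : IsPolytope0 P) : Convex ℝ P := by
  obtain ⟨⟨S, rfl⟩, -⟩ := hP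
  exact convex_convexHull ℝ _

lemma inter_isPolyhedron (hP : IsPolytope0 P) (hQ : IsPolyhedron Q) (h0 : (0 : Euc n) ∈ Q) :
    IsPolytope0 (P ∩ Q) :=
  ⟨(hP.isPolyhedron.inter hQ).exists_finset (hP.isCompact.inter_right hQ.isClosed), hP.2, h0⟩

lemma inter (hP : IsPolytope0 P) (hQ : IsPolytope0 Q) : IsPolytope0 (P ∩ Q) :=
  hP.inter_isPolyhedron hQ.isPolyhedron hQ.2

end IsPolytope0

/-! ### Simplices with a vertex at the origin -/

/-- The convex hull of the origin and the points `v i`, `i ∈ I`. -/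
def spx {ι : Type*} {n : ℕ} (I : Finset ι) (v : ι → Euc n) : Set (Euc n) :=
  convexHull ℝ (insert 0 (v '' I))

section Spx

variable {ι : Type*} {n : ℕ} {I : Finset ι} {v : ι → Euc n}

lemma isPolytope0_spx (I : Finset ι) (v : ι → Euc n) : IsPolytope0 (spx I v) := by
  classical
  refine ⟨⟨insert 0 (I.image v), ?_⟩, subset_convexHull ℝ _ (Set.mem_insert _ _)⟩
  simp [spx]

lemma convex_spx (I : Finset ι) (v : ι → Euc n) : Convex ℝ (spx I v) := convex_convexHull ℝ _

lemma zero_mem_spx (I : Finset ι) (v : ι → Euc n) : (0 : Euc n) ∈ spx I v :=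
  subset_convexHull ℝ _ (Set.mem_insert _ _)

lemma mem_spx_self {i : ι} (hi : i ∈ I) : v i ∈ spx I v :=
  subset_convexHull ℝ _ (Set.mem_insert_of_mem _ ⟨i, hi, rfl⟩)

lemma mem_spx {x : Euc n} : x ∈ spx I v ↔
    ∃ t : ι → ℝ, (∀ i ∈ I, 0 ≤ t i) ∧ ∑ i ∈ I, t i ≤ 1 ∧ ∑ i ∈ I, t i • v i = x := by
  constructor
  · intro hx
    let A : Set (Euc n) := {x | ∃ t : ι → ℝ, (∀ i ∈ I, 0 ≤ t i) ∧ ∑ i ∈ I, t i ≤ 1 ∧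
      ∑ i ∈ I, t i • v i = x}
    have hA : Convex ℝ A := by
      rintro x ⟨t, ht0, ht1, rfl⟩ y ⟨s, hs0, hs1, rfl⟩ a b ha hb hab
      refine ⟨fun i => a * t i + b * s i, fun i hi => ?_, ?_, ?_⟩
      · have := ht0 i hi
        have := hs0 i hi
        positivity
      · rw [Finset.sum_add_distrib, ← Finset.mul_sum, ← Finset.mul_sum]
        nlinarith
      · simp only [add_smul, Finset.sum_add_distrib, mul_smul, Finset.smul_sum]
    refine convexHull_min (t := A) ?_ hA hx
    classical
    rintro y (rfl | ⟨i, hi, rfl⟩)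
    · exact ⟨0, by simp, by simp, by simp⟩
    · have hi' : i ∈ I := hi
      refine ⟨Pi.single i 1, fun j _ => ?_, ?_, ?_⟩
      · by_cases h : j = i
        · subst h; simp
        · simp [h]
      · simp [hi']
      · rw [Finset.sum_eq_single_of_mem i hi' (fun j _ hj => by simp [hj])]
        simp
  · rintro ⟨t, ht0, ht1, rfl⟩
    rcases (Finset.sum_nonneg ht0).eq_or_lt with h | h
    · have : ∀ i ∈ I, t i = 0 := (Finset.sum_eq_zero_iff_of_nonneg ht0).1 h.symm
      rw [Finset.sum_eq_zero fun i hi => by rw [this i hi, zero_smul]]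
      exact zero_mem_spx I v
    · have hc : I.centerMass t v ∈ spx I v :=
        I.centerMass_mem_convexHull ht0 h fun i hi => Set.mem_insert_of_mem _ ⟨i, hi, rfl⟩
      have := (convex_spx I v).smul_mem_of_zero_mem (zero_mem_spx I v) hc ⟨h.le, ht1⟩
      rwa [Finset.centerMass, smul_inv_smul₀ h.ne'] at this

lemma spx_congr {w : ι → Euc n} (h : ∀ i ∈ I, v i = w i) : spx I v = spx I w := by
  have : v '' I = w '' I := Set.image_congr h
  rw [spx, spx, this]

lemma spx_subset {K : Set (Euc n)} (hK : Convex ℝ K) (h0 : (0 : Euc n) ∈ K)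
    (h : ∀ i ∈ I, v i ∈ K) : spx I v ⊆ K := by
  refine convexHull_min ?_ hK
  rintro y (rfl | ⟨i, hi, rfl⟩)
  exacts [h0, h i hi]

lemma eqOn_of_sum_smul_eq (hv : LinearIndepOn ℝ v (I : Set ι)) {s t : ι → ℝ}
    (h : ∑ k ∈ I, s k • v k = ∑ k ∈ I, t k • v k) : ∀ k ∈ I, s k = t k := by
  intro k hk
  have := (linearIndepOn_finset_iff.1 hv) (fun k => s k - t k) (by
    simp only [sub_smul, Finset.sum_sub_distrib, h, sub_self]) k hk
  exact sub_eq_zero.1 this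

variable [DecidableEq ι]

/-- The data of cutting the edge between `v i` and `v j` at `l • v i + (1 - l) • v j`: a point of
the simplex lies in the part containing `v j`. -/
lemma mem_spx_update {i j : ι} (hi : i ∈ I) (hj : j ∈ I) (hij : i ≠ j) {l : ℝ}
    (hl0 : 0 < l) {t : ι → ℝ} (ht0 : ∀ k ∈ I, 0 ≤ t k) (ht1 : ∑ k ∈ I, t k ≤ 1)
    (h : (1 - l) * t i ≤ l * t j) :
    ∑ k ∈ I, t k • v k ∈ spx I (Function.update v i (l • v i + (1 - l) • v j)) := by
  have hj' : j ∈ I.erase i := Finset.mem_erase.2 ⟨hij.symm, hj⟩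
  set J := (I.erase i).erase j with hJ
  have hsplit : ∀ {M : Type} [AddCommMonoid M] (f : ι → M),
      ∑ k ∈ I, f k = f i + (f j + ∑ k ∈ J, f k) := by
    intro M _ f
    rw [hJ, Finset.add_sum_erase _ _ hj', Finset.add_sum_erase _ _ hi]
  have hJi : ∀ k ∈ J, k ≠ i := fun k hk => (Finset.mem_erase.1 (Finset.mem_erase.1 hk).2).1
  have hJj : ∀ k ∈ J, k ≠ j := fun k hk => (Finset.mem_erase.1 hk).1
  rw [mem_spx]
  refine ⟨Function.update (Function.update t i (t i / l)) j (t j - t i / l * (1 - l)), ?_, ?_, ?_⟩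
  · intro k hk
    rcases eq_or_ne k j with rfl | hkj
    · rw [Function.update_self]
      have : t i / l * (1 - l) ≤ t k := by
        rw [div_mul_eq_mul_div, div_le_iff₀ hl0]; linarith
      linarith
    · rw [Function.update_of_ne hkj]
      rcases eq_or_ne k i with rfl | hki
      · rw [Function.update_self]
        exact div_nonneg (ht0 _ hk) hl0.le
      · rw [Function.update_of_ne hki]
        exact ht0 k hk
  · rw [hsplit] at ht1 ⊢
    rw [Finset.sum_congr rfl fun k hk => show _ = t k by
      rw [Function.update_of_ne (hJj k hk), Function.update_of_ne (hJi k hk)]]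
    rw [Function.update_self, Function.update_of_ne hij, Function.update_self]
    have : t i / l * l = t i := div_mul_cancel₀ _ hl0.ne'
    linarith
  · rw [hsplit, hsplit]
    rw [Finset.sum_congr rfl fun k hk => show _ = t k • v k by
      rw [Function.update_of_ne (hJj k hk), Function.update_of_ne (hJi k hk),
        Function.update_of_ne (hJi k hk)]]
    simp only [Function.update_self, Function.update_of_ne hij, Function.update_of_ne hij.symm]
    have : t i = t i / l * l := (div_mul_cancel₀ _ hl0.ne').symm
    rw [← add_assoc, ← add_assoc]
    congr 1
    conv_rhs => rw [this]
    module

/-- The inequality characterizing the part of a cut simplex. -/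
lemma exists_coord_of_mem_spx_update {i j : ι} (hi : i ∈ I) (hj : j ∈ I) (hij : i ≠ j) {l : ℝ}
    (hl0 : 0 < l) (hl1 : l < 1) {x : Euc n}
    (hx : x ∈ spx I (Function.update v i (l • v i + (1 - l) • v j))) :
    ∃ t : ι → ℝ, (∀ k ∈ I, 0 ≤ t k) ∧ ∑ k ∈ I, t k ≤ 1 ∧ ∑ k ∈ I, t k • v k = x ∧
      (1 - l) * t i ≤ l * t j := by
  have hj' : j ∈ I.erase i := Finset.mem_erase.2 ⟨hij.symm, hj⟩
  set J := (I.erase i).erase j with hJ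
  have hsplit : ∀ {M : Type} [AddCommMonoid M] (f : ι → M),
      ∑ k ∈ I, f k = f i + (f j + ∑ k ∈ J, f k) := by
    intro M _ f
    rw [hJ, Finset.add_sum_erase _ _ hj', Finset.add_sum_erase _ _ hi]
  have hJi : ∀ k ∈ J, k ≠ i := fun k hk => (Finset.mem_erase.1 (Finset.mem_erase.1 hk).2).1
  have hJj : ∀ k ∈ J, k ≠ j := fun k hk => (Finset.mem_erase.1 hk).1
  obtain ⟨t, ht0, ht1, rfl⟩ := mem_spx.1 hx
  have hti := ht0 i hi
  have htj := ht0 j hj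
  have hl1' : 0 < 1 - l := by linarith
  refine ⟨Function.update (Function.update t i (l * t i)) j (t j + (1 - l) * t i), ?_, ?_, ?_, ?_⟩
  · intro k hk
    rcases eq_or_ne k j with rfl | hkj
    · rw [Function.update_self]
      positivity
    · rw [Function.update_of_ne hkj]
      rcases eq_or_ne k i with rfl | hki
      · rw [Function.update_self]
        positivity
      · rw [Function.update_of_ne hki]
        exact ht0 k hk
  · rw [hsplit] at ht1 ⊢
    rw [Finset.sum_congr rfl fun k hk => show _ = t k by
      rw [Function.update_of_ne (hJj k hk), Function.update_of_ne (hJi k hk)]]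
    rw [Function.update_self, Function.update_of_ne hij, Function.update_self]
    linarith
  · rw [hsplit, hsplit]
    rw [Finset.sum_congr rfl fun k hk => show _ = t k • v k by
      rw [Function.update_of_ne (hJj k hk), Function.update_of_ne (hJi k hk)]]
    rw [Finset.sum_congr rfl fun k hk => show
      t k • Function.update v i (l • v i + (1 - l) • v j) k = t k • v k by
      rw [Function.update_of_ne (hJi k hk)]]
    simp only [Function.update_self, Function.update_of_ne hij, Function.update_of_ne hij.symm]
    module
  · rw [Function.update_self, Function.update_of_ne hij, Function.update_self]
    nlinarith [mul_nonneg hl0.le htj]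

lemma spx_update_subset {i j : ι} (hi : i ∈ I) (hj : j ∈ I) {l : ℝ}
    (hl0 : 0 ≤ l) (hl1 : l ≤ 1) :
    spx I (Function.update v i (l • v i + (1 - l) • v j)) ⊆ spx I v := by
  refine spx_subset (convex_spx I v) (zero_mem_spx I v) fun k hk => ?_
  rcases eq_or_ne k i with rfl | hki
  · rw [Function.update_self]
    exact convex_spx I v (mem_spx_self hi) (mem_spx_self hj) hl0 (by linarith) (by ring)
  · rw [Function.update_of_ne hki]
    exact mem_spx_self hk

lemma spx_eq_union {i j : ι} (hi : i ∈ I) (hj : j ∈ I) (hij : i ≠ j) {l : ℝ}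
    (hl0 : 0 < l) (hl1 : l < 1) :
    spx I v = spx I (Function.update v i (l • v i + (1 - l) • v j)) ∪
      spx I (Function.update v j (l • v i + (1 - l) • v j)) := by
  have hw : l • v i + (1 - l) • v j = (1 - l) • v j + (1 - (1 - l)) • v i := by module
  refine Set.Subset.antisymm ?_ (Set.union_subset (spx_update_subset hi hj hl0.le hl1.le) ?_)
  · intro x hx
    obtain ⟨t, ht0, ht1, rfl⟩ := mem_spx.1 hx
    rcases le_total ((1 - l) * t i) (l * t j) with h | h
    · exact Or.inl (mem_spx_update hi hj hij hl0 ht0 ht1 h)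
    · refine Or.inr ?_
      rw [hw]
      exact mem_spx_update hj hi hij.symm (by linarith) ht0 ht1 (by linarith)
  · rw [hw]
    exact spx_update_subset hj hi (by linarith) (by linarith)

lemma spx_inter {i j : ι} (hi : i ∈ I) (hj : j ∈ I) (hij : i ≠ j) {l : ℝ}
    (hl0 : 0 < l) (hl1 : l < 1) (hv : LinearIndepOn ℝ v (I : Set ι)) :
    spx I (Function.update v i (l • v i + (1 - l) • v j)) ∩
      spx I (Function.update v j (l • v i + (1 - l) • v j)) =
    spx (I.erase j) (Function.update v i (l • v i + (1 - l) • v j)) := by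
  have hw : l • v i + (1 - l) • v j = (1 - l) • v j + (1 - (1 - l)) • v i := by module
  refine Set.Subset.antisymm ?_ ?_
  · rintro x ⟨h1, h2⟩
    rw [hw] at h2
    obtain ⟨s, hs0, hs1, hs, hsl⟩ := exists_coord_of_mem_spx_update hi hj hij hl0 hl1 h1
    obtain ⟨t, ht0, ht1, ht, htl⟩ :=
      exists_coord_of_mem_spx_update hj hi hij.symm (by linarith) (by linarith) h2
    have hst := eqOn_of_sum_smul_eq hv (hs.trans ht.symm)
    rw [← hst i hi, ← hst j hj] at htl
    have heq : (1 - l) * s i = l * s j := by linarith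
    have hi' : i ∈ I.erase j := Finset.mem_erase.2 ⟨hij, hi⟩
    have hsplit : ∀ {M : Type} [AddCommMonoid M] (f : ι → M),
        ∑ k ∈ I, f k = f j + (f i + ∑ k ∈ (I.erase j).erase i, f k) := by
      intro M _ f
      rw [Finset.add_sum_erase _ _ hi', Finset.add_sum_erase _ _ hj]
    have hJi : ∀ k ∈ (I.erase j).erase i, k ≠ i := fun k hk => (Finset.mem_erase.1 hk).1
    refine mem_spx.2 ⟨Function.update s i (s i + s j), fun k hk => ?_, ?_, ?_⟩
    · have hkI := (Finset.mem_erase.1 hk).2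
      rcases eq_or_ne k i with rfl | hki
      · rw [Function.update_self]
        exact add_nonneg (hs0 _ hi) (hs0 _ hj)
      · rw [Function.update_of_ne hki]
        exact hs0 k hkI
    · rw [← Finset.add_sum_erase _ _ hi', Function.update_self, Finset.sum_congr rfl fun k hk =>
        show _ = s k by rw [Function.update_of_ne (hJi k hk)]]
      rw [hsplit] at hs1
      linarith
    · rw [← hs, hsplit, ← Finset.add_sum_erase _ _ hi', Finset.sum_congr rfl fun k hk =>
        show _ = s k • v k by
          rw [Function.update_of_ne (hJi k hk), Function.update_of_ne (hJi k hk)]]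
      simp only [Function.update_self]
      have h1 : (s i + s j) * l = s i := by linarith
      have h2 : (s i + s j) * (1 - l) = s j := by linarith
      rw [smul_add, smul_smul, smul_smul, h1, h2]
      abel
  · refine spx_subset ((convex_spx _ _).inter (convex_spx _ _))
      ⟨zero_mem_spx _ _, zero_mem_spx _ _⟩ fun k hk => ?_
    obtain ⟨hkj, hkI⟩ := Finset.mem_erase.1 hk
    refine ⟨mem_spx_self hkI, ?_⟩
    rcases eq_or_ne k i with rfl | hki
    · rw [Function.update_self]
      have := mem_spx_self (v := Function.update v j (l • v k + (1 - l) • v j)) hj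
      rwa [Function.update_self] at this
    · rw [Function.update_of_ne hki]
      have := mem_spx_self (v := Function.update v j (l • v i + (1 - l) • v j)) hkI
      rwa [Function.update_of_ne hkj] at this

lemma linearIndepOn_update {i j : ι} (hi : i ∈ I) (hj : j ∈ I) (hij : i ≠ j) {l : ℝ}
    (hl0 : l ≠ 0) (hv : LinearIndepOn ℝ v (I : Set ι)) :
    LinearIndepOn ℝ (Function.update v i (l • v i + (1 - l) • v j)) (I : Set ι) := by
  rw [linearIndepOn_finset_iff]
  intro g hg
  have hj' : j ∈ I.erase i := Finset.mem_erase.2 ⟨hij.symm, hj⟩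
  have hsplit : ∀ {M : Type} [AddCommMonoid M] (f : ι → M),
      ∑ k ∈ I, f k = f i + (f j + ∑ k ∈ (I.erase i).erase j, f k) := by
    intro M _ f
    rw [Finset.add_sum_erase _ _ hj', Finset.add_sum_erase _ _ hi]
  have hJi : ∀ k ∈ (I.erase i).erase j, k ≠ i :=
    fun k hk => (Finset.mem_erase.1 (Finset.mem_erase.1 hk).2).1
  have hJj : ∀ k ∈ (I.erase i).erase j, k ≠ j := fun k hk => (Finset.mem_erase.1 hk).1
  have key := (linearIndepOn_finset_iff.1 hv)
    (Function.update (Function.update g i (g i * l)) j (g i * (1 - l) + g j)) (by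
      rw [← hg, hsplit, hsplit, Finset.sum_congr rfl fun k hk => show _ = g k • v k by
        rw [Function.update_of_ne (hJj k hk), Function.update_of_ne (hJi k hk)]]
      rw [Finset.sum_congr rfl fun k hk => show
        g k • Function.update v i (l • v i + (1 - l) • v j) k = g k • v k by
        rw [Function.update_of_ne (hJi k hk)]]
      simp only [Function.update_self, Function.update_of_ne hij, Function.update_of_ne hij.symm]
      module)
  have hgi : g i = 0 := by
    have := key i hi
    rw [Function.update_of_ne hij, Function.update_self] at this
    exact (mul_eq_zero.1 this).resolve_right hl0
  intro k hk
  rcases eq_or_ne k i with rfl | hki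
  · exact hgi
  rcases eq_or_ne k j with rfl | hkj
  · have := key k hk
    rw [Function.update_self, hgi] at this
    simpa using this
  · have := key k hk
    rwa [Function.update_of_ne hkj, Function.update_of_ne hki] at this

end Spx

/-! ### Valuations determined by their values on simplices -/

/-- A real valued valuation on polytopes containing the origin. -/
def IsVal {n : ℕ} (y : Set (Euc n) → ℝ) : Prop :=
  ∀ K L : Set (Euc n), IsPolytope0 K → IsPolytope0 L → IsPolytope0 (K ∪ L) →
    IsPolytope0 (K ∩ L) → y (K ∪ L) + y (K ∩ L) = y K + y L

lemma IsVal.spx_cut {n : ℕ} {ι : Type*} [DecidableEq ι] {y : Set (Euc n) → ℝ} (hy : IsVal y)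
    {I : Finset ι} {v : ι → Euc n} {i j : ι} (hi : i ∈ I) (hj : j ∈ I) (hij : i ≠ j) {l : ℝ}
    (hl0 : 0 < l) (hl1 : l < 1) (hv : LinearIndepOn ℝ v (I : Set ι)) :
    y (spx I v) + y (spx (I.erase j) (Function.update v i (l • v i + (1 - l) • v j))) =
      y (spx I (Function.update v i (l • v i + (1 - l) • v j))) +
        y (spx I (Function.update v j (l • v i + (1 - l) • v j))) := by
  have h1 := spx_eq_union (v := v) hi hj hij hl0 hl1
  have h2 := spx_inter hi hj hij hl0 hl1 hv
  have := hy _ _ (isPolytope0_spx I (Function.update v i (l • v i + (1 - l) • v j)))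
    (isPolytope0_spx I (Function.update v j (l • v i + (1 - l) • v j)))
    (by rw [← h1]; exact isPolytope0_spx _ _) (by rw [h2]; exact isPolytope0_spx _ _)
  rwa [← h1, h2] at this

lemma spx_inter_halfspace_of_pos {n : ℕ} {ι : Type*} {I : Finset ι} {v : ι → Euc n}
    (h : Euc n →L[ℝ] ℝ) {c : ℝ} (hc : 0 < c) (hI : ∀ i ∈ I, c ≤ h (v i)) :
    spx I v ∩ {x | h x ≤ c} = spx I fun i => (c / h (v i)) • v i := by
  have hpos : ∀ i ∈ I, 0 < h (v i) := fun i hi => hc.trans_le (hI i hi)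
  refine Set.Subset.antisymm ?_ (Set.subset_inter ?_ ?_)
  · rintro x ⟨hx, hxc⟩
    obtain ⟨t, ht0, ht1, rfl⟩ := mem_spx.1 hx
    refine mem_spx.2 ⟨fun i => t i * h (v i) / c, fun i hi => ?_, ?_, ?_⟩
    · have := ht0 i hi
      have := hpos i hi
      positivity
    · rw [← Finset.sum_div, div_le_one hc]
      simpa using hxc
    · refine Finset.sum_congr rfl fun i hi => ?_
      have := (hpos i hi).ne'
      rw [smul_smul]
      congr 1
      field_simp
  · refine spx_subset (convex_spx I v) (zero_mem_spx I v) fun i hi => ?_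
    exact (convex_spx I v).smul_mem_of_zero_mem (zero_mem_spx I v) (mem_spx_self hi)
      ⟨(div_pos hc (hpos i hi)).le, (div_le_one (hpos i hi)).2 (hI i hi)⟩
  · refine spx_subset (convex_halfSpace_le h.toLinearMap.isLinear c) (by simpa using hc.le)
      fun i hi => ?_
    have := (hpos i hi).ne'
    simp [div_mul_cancel₀ _ this]

lemma spx_inter_halfspace_of_nonneg {n : ℕ} {ι : Type*} {I : Finset ι} {v : ι → Euc n}
    (h : Euc n →L[ℝ] ℝ) (hI : ∀ i ∈ I, 0 ≤ h (v i)) :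
    spx I v ∩ {x | h x ≤ 0} = spx (I.filter fun i => h (v i) = 0) v := by
  refine Set.Subset.antisymm ?_ (Set.subset_inter ?_ ?_)
  · rintro x ⟨hx, hxc⟩
    obtain ⟨t, ht0, ht1, rfl⟩ := mem_spx.1 hx
    have hsum : ∑ i ∈ I, t i * h (v i) ≤ 0 := by simpa using hxc
    have hnn : ∀ i ∈ I, 0 ≤ t i * h (v i) := fun i hi => mul_nonneg (ht0 i hi) (hI i hi)
    have hz := (Finset.sum_eq_zero_iff_of_nonneg hnn).1
      (le_antisymm hsum (Finset.sum_nonneg hnn))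
    refine mem_spx.2 ⟨t, fun i hi => ht0 i (Finset.mem_filter.1 hi).1, ?_, ?_⟩
    · exact (Finset.sum_le_sum_of_subset_of_nonneg (Finset.filter_subset _ _)
        fun i hi _ => ht0 i hi).trans ht1
    · refine Finset.sum_filter_of_ne fun i hi hne => ?_
      rcases mul_eq_zero.1 (hz i hi) with h0 | h0
      · simp [h0] at hne
      · exact h0
  · exact spx_subset (convex_spx I v) (zero_mem_spx I v) fun i hi =>
      mem_spx_self (Finset.mem_filter.1 hi).1
  · refine spx_subset (convex_halfSpace_le h.toLinearMap.isLinear 0) (by simp) fun i hi => ?_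
    exact (Finset.mem_filter.1 hi).2.le

lemma IsVal.eq_zero_of_spx_inter {n : ℕ} {ι : Type*} {y : Set (Euc n) → ℝ} (hy : IsVal y)
    (H : ∀ (I : Finset ι) (v : ι → Euc n), LinearIndepOn ℝ v (I : Set ι) → y (spx I v) = 0)
    (L : List ((Euc n →L[ℝ] ℝ) × ℝ)) (hL : ∀ p ∈ L, 0 ≤ p.2) :
    ∀ (I : Finset ι) (v : ι → Euc n), LinearIndepOn ℝ v (I : Set ι) →
      y (spx I v ∩ {x | ∀ p ∈ L, p.1 x ≤ p.2}) = 0 := by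
  classical
  induction L with
  | nil => intro I v hv; simpa using H I v hv
  | cons p L ih =>
    obtain ⟨h, c⟩ := p
    have hc : 0 ≤ c := hL (h, c) (by simp)
    have ih' := ih fun p hp => hL p (List.mem_cons_of_mem _ hp)
    set D : Set (Euc n) := {x | ∀ p ∈ L, p.1 x ≤ p.2} with hD
    have hC : {x : Euc n | ∀ p ∈ (h, c) :: L, p.1 x ≤ p.2} = {x | h x ≤ c} ∩ D := by
      ext x; simp [hD]
    have hCp : IsPolyhedron ({x : Euc n | h x ≤ c} ∩ D) := hC ▸ ⟨_, rfl⟩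
    have hC0 : (0 : Euc n) ∈ {x : Euc n | h x ≤ c} ∩ D := by
      refine ⟨by simpa using hc, fun p hp => ?_⟩
      simpa using hL p (List.mem_cons_of_mem _ hp)
    rw [hC]
    intro I v hv
    induction hN : (I.filter fun i => h (v i) ≠ c).card using Nat.strong_induction_on
      generalizing I v with
    | _ N ihN =>
    by_cases hle : ∀ i ∈ I, h (v i) ≤ c
    · have : spx I v ∩ ({x | h x ≤ c} ∩ D) = spx I v ∩ D := by
        have hs : spx I v ⊆ {x | h x ≤ c} :=
          spx_subset (convex_halfSpace_le h.toLinearMap.isLinear c) (by simpa using hc) hle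
        rw [← Set.inter_assoc, Set.inter_eq_left.2 hs]
      rw [this]
      exact ih' I v hv
    by_cases hge : ∀ i ∈ I, c ≤ h (v i)
    · rw [← Set.inter_assoc]
      rcases hc.eq_or_lt with rfl | hc'
      · rw [spx_inter_halfspace_of_nonneg h hge]
        exact ih' _ v (hv.mono (Finset.coe_subset.2 (Finset.filter_subset _ _)))
      · rw [spx_inter_halfspace_of_pos h hc' hge]
        refine ih' I _ (linearIndepOn_finset_iff.2 fun g hg i hi => ?_)
        have := (linearIndepOn_finset_iff.1 hv) (fun i => g i * (c / h (v i)))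
          (by simpa only [smul_smul] using hg) i hi
        have hpos : 0 < h (v i) := hc'.trans_le (hge i hi)
        exact (mul_eq_zero.1 this).resolve_right (div_pos hc' hpos).ne'
    push Not at hle hge
    obtain ⟨i, hi, hic⟩ := hle
    obtain ⟨j, hj, hjc⟩ := hge
    have hij : i ≠ j := by rintro rfl; exact lt_asymm hic hjc
    have hd : 0 < h (v i) - h (v j) := by linarith
    set l : ℝ := (c - h (v j)) / (h (v i) - h (v j)) with hl
    have hl0 : 0 < l := div_pos (by linarith) hd
    have hl1 : l < 1 := (div_lt_one hd).2 (by linarith)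
    set w := l • v i + (1 - l) • v j with hw
    have hw' : w = (1 - l) • v j + (1 - (1 - l)) • v i := by rw [hw]; module
    have hhw : h w = c := by
      have : l * (h (v i) - h (v j)) = c - h (v j) := div_mul_cancel₀ _ hd.ne'
      simp only [hw, map_add, map_smul, smul_eq_mul]
      linarith
    have hv1 : LinearIndepOn ℝ (Function.update v i w) (I : Set ι) :=
      linearIndepOn_update hi hj hij hl0.ne' hv
    have hv2 : LinearIndepOn ℝ (Function.update v j w) (I : Set ι) := by
      rw [hw']
      exact linearIndepOn_update hj hi hij.symm (by linarith) hv
    have hcard : ∀ (k : ι) (J : Finset ι), k ∈ I → h (v k) ≠ c → J ⊆ I →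
        (J.filter fun a => h (Function.update v k w a) ≠ c).card < N := by
      intro k J hk hkc hJ
      rw [← hN]
      refine Finset.card_lt_card ⟨fun a ha => ?_, fun hsub => ?_⟩
      · obtain ⟨haJ, ha⟩ := Finset.mem_filter.1 ha
        have hak : a ≠ k := by rintro rfl; rw [Function.update_self] at ha; exact ha hhw
        rw [Function.update_of_ne hak] at ha
        exact Finset.mem_filter.2 ⟨hJ haJ, ha⟩
      · have := (Finset.mem_filter.1 (hsub (Finset.mem_filter.2 ⟨hk, hkc⟩))).2
        rw [Function.update_self] at this
        exact this hhw
    have e1 := ihN _ (hcard i I hi hic.ne' subset_rfl) I _ hv1 rfl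
    have e2 := ihN _ (hcard j I hj hjc.ne subset_rfl) I _ hv2 rfl
    have e3 := ihN _ (hcard i (I.erase j) hi hic.ne' (Finset.erase_subset _ _)) (I.erase j) _
      (hv1.mono (by simp)) rfl
    have hU := spx_eq_union (v := v) hi hj hij hl0 hl1
    have hI := spx_inter hi hj hij hl0 hl1 hv
    rw [← hw] at hU hI
    have hpoly : ∀ (J : Finset ι) (u : ι → Euc n), IsPolytope0 (spx J u ∩ ({x | h x ≤ c} ∩ D)) :=
      fun J u => (isPolytope0_spx J u).inter_isPolyhedron hCp hC0
    have key := hy (spx I (Function.update v i w) ∩ ({x | h x ≤ c} ∩ D))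
      (spx I (Function.update v j w) ∩ ({x | h x ≤ c} ∩ D)) (hpoly _ _) (hpoly _ _)
      (by rw [← Set.union_inter_distrib_right, ← hU]; exact hpoly _ _)
      ((hpoly _ _).inter (hpoly _ _))
    rw [← Set.union_inter_distrib_right, ← hU, ← Set.inter_inter_distrib_right, hI, e1, e2,
      e3] at key
    linarith

lemma IsVal.split {n : ℕ} {y : Set (Euc n) → ℝ} (hy : IsVal y) {P : Set (Euc n)}
    (hP : IsPolytope0 P) (f : Euc n →L[ℝ] ℝ) :
    y P + y (P ∩ {x | f x ≤ 0} ∩ {x | (-f) x ≤ 0}) =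
      y (P ∩ {x | f x ≤ 0}) + y (P ∩ {x | (-f) x ≤ 0}) := by
  have h1 : IsPolytope0 (P ∩ {x | f x ≤ 0}) :=
    hP.inter_isPolyhedron (isPolyhedron_halfspace f 0) (by simp)
  have h2 : IsPolytope0 (P ∩ {x | (-f) x ≤ 0}) :=
    hP.inter_isPolyhedron (isPolyhedron_halfspace (-f) 0) (by simp)
  have hU : P ∩ {x | f x ≤ 0} ∪ P ∩ {x | (-f) x ≤ 0} = P := by
    rw [← Set.inter_union_distrib_left, Set.inter_eq_left]
    intro x _
    rcases le_total (f x) 0 with h | h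
    · exact Or.inl h
    · exact Or.inr (by simpa using h)
  have hI : P ∩ {x | f x ≤ 0} ∩ (P ∩ {x | (-f) x ≤ 0}) =
      P ∩ {x | f x ≤ 0} ∩ {x | (-f) x ≤ 0} := by
    ext x; simp only [Set.mem_inter_iff]; tauto
  have := hy _ _ h1 h2 (by rwa [hU]) (h1.inter h2)
  rwa [hU, hI] at this

/-- A valuation on polytopes containing the origin that vanishes on all simplices with a vertex
at the origin vanishes. -/
theorem IsVal.eq_zero {n : ℕ} {y : Set (Euc n) → ℝ} (hy : IsVal y)
    (H : ∀ (I : Finset (Fin n)) (v : Fin n → Euc n), LinearIndepOn ℝ v (I : Set (Fin n)) →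
      y (spx I v) = 0) {P : Set (Euc n)} (hP : IsPolytope0 P) : y P = 0 := by
  classical
  -- polytopes contained in a simplex
  have hsub : ∀ (v : Fin n → Euc n), LinearIndependent ℝ v → ∀ Q : Set (Euc n), IsPolytope0 Q →
      Q ⊆ spx Finset.univ v → y Q = 0 := by
    intro v hv Q hQ hQs
    obtain ⟨L, hL⟩ := hQ.isPolyhedron
    have h0 := hQ.2
    have := hy.eq_zero_of_spx_inter H L (fun p hp => by
      rw [hL] at h0; simpa using h0 p hp) Finset.univ v (by simpa using hv)
    rwa [← hL, Set.inter_eq_right.2 hQs] at this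
  -- polytopes contained in an orthant
  have horth : ∀ σ : Fin n → ℝ, (∀ i, σ i = 1 ∨ σ i = -1) → ∀ Q : Set (Euc n), IsPolytope0 Q →
      (∀ x ∈ Q, ∀ i, 0 ≤ σ i * x i) → y Q = 0 := by
    intro σ hσ Q hQ hx
    obtain ⟨R, hR0, hR⟩ := hQ.isCompact.isBounded.exists_pos_norm_le
    set M : ℝ := (n + 1) * R with hM
    have hMpos : 0 < M := by positivity
    have hσ2 : ∀ i, σ i * σ i = 1 := fun i => by rcases hσ i with h | h <;> simp [h]
    have hexp : ∀ t : Fin n → ℝ, ∑ i, t i • (M * σ i) • EuclideanSpace.single i (1 : ℝ) =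
        WithLp.toLp 2 fun i => t i * (M * σ i) := by
      intro t
      ext j
      simp [Finset.sum_apply, Pi.single_apply]
    refine hsub (fun i => (M * σ i) • EuclideanSpace.single i (1 : ℝ)) ?_ Q hQ ?_
    · rw [Fintype.linearIndependent_iff]
      intro g hg i
      rw [hexp] at hg
      have := congrArg (fun x : Euc n => x i) hg
      simp only [PiLp.zero_apply] at this
      have h2 : σ i ≠ 0 := fun h => by simpa [h] using hσ2 i
      exact (mul_eq_zero.1 this).resolve_right (mul_ne_zero hMpos.ne' h2)
    · intro x hxQ
      refine mem_spx.2 ⟨fun i => σ i * x i / M, fun i _ => ?_, ?_, ?_⟩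
      · exact div_nonneg (hx x hxQ i) hMpos.le
      · rw [← Finset.sum_div, div_le_one hMpos]
        calc ∑ i, σ i * x i ≤ ∑ i : Fin n, R := by
              refine Finset.sum_le_sum fun i _ => ?_
              have h1 : |x i| ≤ ‖x‖ := by simpa using PiLp.norm_apply_le x i
              have h2 : |σ i * x i| = |x i| := by
                rw [abs_mul]; rcases hσ i with h | h <;> simp [h]
              exact (le_abs_self _).trans (h2.le.trans (h1.trans (hR x hxQ)))
          _ = n * R := by simp
          _ ≤ M := by rw [hM]; nlinarith
      · rw [hexp]
        ext i
        have := hσ2 i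
        have hM' := hMpos.ne'
        simp only
        field_simp
        linear_combination (x i) * this
  -- induction on the number of coordinates without prescribed sign
  have hind : ∀ (J : Finset (Fin n)) (σ : Fin n → ℝ), (∀ i, σ i = 1 ∨ σ i = -1) →
      ∀ Q : Set (Euc n), IsPolytope0 Q → (∀ x ∈ Q, ∀ i ∉ J, 0 ≤ σ i * x i) → y Q = 0 := by
    intro J
    induction J using Finset.induction_on with
    | empty => intro σ hσ Q hQ hx; exact horth σ hσ Q hQ fun x hxQ i => hx x hxQ i (by simp)
    | insert j J hj ih =>
      intro σ hσ Q hQ hx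
      set f : Euc n →L[ℝ] ℝ := EuclideanSpace.proj j with hf
      have hA : ∀ (ε : ℝ), (ε = 1 ∨ ε = -1) → ∀ Q' : Set (Euc n), IsPolytope0 Q' → Q' ⊆ Q →
          (∀ x ∈ Q', 0 ≤ ε * x j) → y Q' = 0 := by
        intro ε hε Q' hQ' hs hx'
        refine ih (Function.update σ j ε) (fun i => ?_) Q' hQ' fun x hxQ i hi => ?_
        · rcases eq_or_ne i j with rfl | h
          · simpa using hε
          · simpa [h] using hσ i
        · rcases eq_or_ne i j with rfl | h
          · simpa using hx' x hxQ
          · simpa [h] using hx x (hs hxQ) i (by simp [h, hi])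
      have h1 : IsPolytope0 (Q ∩ {x | f x ≤ 0}) :=
        hQ.inter_isPolyhedron (isPolyhedron_halfspace f 0) (by simp)
      have h2 : IsPolytope0 (Q ∩ {x | (-f) x ≤ 0}) :=
        hQ.inter_isPolyhedron (isPolyhedron_halfspace (-f) 0) (by simp)
      have h3 : IsPolytope0 (Q ∩ {x | f x ≤ 0} ∩ {x | (-f) x ≤ 0}) :=
        h1.inter_isPolyhedron (isPolyhedron_halfspace (-f) 0) (by simp)
      have e1 := hA (-1) (Or.inr rfl) _ h1 Set.inter_subset_left fun x hx => by
        have := hx.2; simp [hf] at this; linarith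
      have e2 := hA 1 (Or.inl rfl) _ h2 Set.inter_subset_left fun x hx => by
        have := hx.2; simp [hf] at this; linarith
      have e3 := hA 1 (Or.inl rfl) _ h3
        (Set.inter_subset_left.trans Set.inter_subset_left) fun x hx => by
        have := hx.2; simp [hf] at this; linarith
      have := hy.split hQ f
      rw [e1, e2, e3] at this
      linarith
  exact hind Finset.univ (fun _ => 1) (fun _ => Or.inl rfl) P hP fun x _ i hi => by simp at hi

section Supp

variable {n : ℕ} {K L : Set (Euc n)} {x y : Euc n}

lemma bddAbove_inner_image (hK : IsCompact K) (x : Euc n) :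
    BddAbove ((fun y => ⟪x, y⟫) '' K) :=
  (hK.image (by fun_prop)).bddAbove

lemma inner_le_supp (hK : IsCompact K) (hy : y ∈ K) (x : Euc n) : ⟪x, y⟫ ≤ supp K x :=
  le_csSup (bddAbove_inner_image hK x) ⟨y, hy, rfl⟩

lemma supp_le {c : ℝ} (hK : K.Nonempty) (h : ∀ y ∈ K, ⟪x, y⟫ ≤ c) : supp K x ≤ c := by
  refine csSup_le (hK.image _) ?_
  rintro _ ⟨y, hy, rfl⟩
  exact h y hy

lemma exists_inner_eq_supp (hK : IsCompact K) (hne : K.Nonempty) (x : Euc n) :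
    ∃ y ∈ K, ⟪x, y⟫ = supp K x := by
  obtain ⟨y, hy, h⟩ := hK.exists_sSup_image_eq (f := fun y => ⟪x, y⟫) hne (by fun_prop)
  exact ⟨y, hy, h.symm⟩

lemma supp_nonneg (hK : IsCompact K) (h0 : (0 : Euc n) ∈ K) (x : Euc n) : 0 ≤ supp K x := by
  simpa using inner_le_supp hK h0 x

lemma supp_mono (hL : IsCompact L) (hne : K.Nonempty) (h : K ⊆ L) (x : Euc n) :
    supp K x ≤ supp L x :=
  supp_le hne fun _ hy => inner_le_supp hL (h hy) x

lemma supp_eq_zero_of_forall_inner (hK : K.Nonempty) (h : ∀ y ∈ K, ⟪x, y⟫ = 0) :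
    supp K x = 0 := by
  have : (fun y => ⟪x, y⟫) '' K = {0} := by
    ext r
    constructor
    · rintro ⟨y, hy, rfl⟩
      exact h y hy
    · rintro rfl
      obtain ⟨y, hy⟩ := hK
      exact ⟨y, hy, h y hy⟩
  rw [supp, this, csSup_singleton]

lemma supp_singleton_zero (x : Euc n) : supp {0} x = 0 :=
  supp_eq_zero_of_forall_inner (Set.singleton_nonempty _) (by simp)

lemma exists_mem_segment_inter (hK : IsClosed K) (hL : IsClosed L) (hKL : Convex ℝ (K ∪ L))
    (hx : x ∈ K) (hy : y ∈ L) : ∃ z ∈ segment ℝ x y, z ∈ K ∩ L := by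
  have h := isPreconnected_closed_iff.1 (convex_segment (𝕜 := ℝ) x y).isPreconnected K L hK hL
    (hKL.segment_subset (.inl hx) (.inr hy)) ⟨x, left_mem_segment ℝ x y, hx⟩
    ⟨y, right_mem_segment ℝ x y, hy⟩
  exact h

lemma min_le_inner_of_mem_segment {z : Euc n} (hz : z ∈ segment ℝ x y) (w : Euc n) :
    min ⟪w, x⟫ ⟪w, y⟫ ≤ ⟪w, z⟫ := by
  obtain ⟨a, b, ha, hb, hab, rfl⟩ := hz
  rw [inner_add_right, inner_smul_right, inner_smul_right]
  have h1 := mul_le_mul_of_nonneg_left (min_le_left ⟪w, x⟫ ⟪w, y⟫) ha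
  have h2 := mul_le_mul_of_nonneg_left (min_le_right ⟪w, x⟫ ⟪w, y⟫) hb
  have : min ⟪w, x⟫ ⟪w, y⟫ = a * min ⟪w, x⟫ ⟪w, y⟫ + b * min ⟪w, x⟫ ⟪w, y⟫ := by
    rw [← add_mul, hab, one_mul]
  linarith

lemma supp_union_add_inter (hK : IsCompact K) (hL : IsCompact L) (hKL : Convex ℝ (K ∪ L))
    (hne : (K ∩ L).Nonempty) (x : Euc n) :
    supp (K ∪ L) x + supp (K ∩ L) x = supp K x + supp L x := by
  have hK0 : K.Nonempty := hne.mono Set.inter_subset_left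
  have hL0 : L.Nonempty := hne.mono Set.inter_subset_right
  have hU : supp (K ∪ L) x = max (supp K x) (supp L x) := by
    refine le_antisymm (supp_le (hK0.mono Set.subset_union_left) ?_) (max_le
      (supp_mono (hK.union hL) hK0 Set.subset_union_left x)
      (supp_mono (hK.union hL) hL0 Set.subset_union_right x))
    rintro y (hy | hy)
    · exact (inner_le_supp hK hy x).trans (le_max_left _ _)
    · exact (inner_le_supp hL hy x).trans (le_max_right _ _)
  have hI : supp (K ∩ L) x = min (supp K x) (supp L x) := by
    refine le_antisymm (le_min (supp_mono hK hne Set.inter_subset_left x)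
      (supp_mono hL hne Set.inter_subset_right x)) ?_
    obtain ⟨k, hk, hk'⟩ := exists_inner_eq_supp hK hK0 x
    obtain ⟨l, hl, hl'⟩ := exists_inner_eq_supp hL hL0 x
    obtain ⟨z, hz, hz'⟩ := exists_mem_segment_inter hK.isClosed hL.isClosed hKL hk hl
    rw [← hk', ← hl']
    exact (min_le_inner_of_mem_segment hz x).trans
      (inner_le_supp (hK.inter hL) hz' x)
  rw [hU, hI, max_add_min]

lemma isVal_supp (x : Euc n) : IsVal fun P => supp P x := fun _ _ hK hL hU hI =>
  supp_union_add_inter hK.isCompact hL.isCompact hU.convex ⟨0, hI.2⟩ x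

end Supp

section IsVal

variable {n : ℕ} {ξ η : Set (Euc n) → ℝ}

lemma IsVal.add (h : IsVal ξ) (h' : IsVal η) : IsVal fun P => ξ P + η P := by
  intro K L hK hL hU hI
  have := h K L hK hL hU hI
  have := h' K L hK hL hU hI
  dsimp only
  linarith

lemma IsVal.const_mul (h : IsVal ξ) (c : ℝ) : IsVal fun P => c * ξ P := by
  intro K L hK hL hU hI
  have := congrArg (c * ·) (h K L hK hL hU hI)
  simpa only [mul_add] using this

lemma IsVal.sub (h : IsVal ξ) (h' : IsVal η) : IsVal fun P => ξ P - η P := by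
  simpa only [neg_one_mul, ← sub_eq_add_neg] using h.add (h'.const_mul (-1))

lemma IsVal.congr (h : IsVal ξ) (h' : ∀ P, IsPolytope0 P → ξ P = η P) : IsVal η := by
  intro K L hK hL hU hI
  rw [← h' _ hK, ← h' _ hL, ← h' _ hU, ← h' _ hI]
  exact h K L hK hL hU hI

lemma isVal_finsum_mem {ι : Type*} {s : Set ι} {f : ι → Set (Euc n) → ℝ}
    (h : ∀ i ∈ s, IsVal (f i))
    (hf : ∀ P, IsPolytope0 P → (s ∩ Function.support fun i => f i P).Finite) :
    IsVal fun P => ∑ᶠ i ∈ s, f i P := by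
  intro K L hK hL hU hI
  dsimp only
  rw [← finsum_mem_add_distrib' (hf _ hU) (hf _ hI),
    ← finsum_mem_add_distrib' (hf _ hK) (hf _ hL)]
  exact finsum_mem_congr rfl fun i hi => h i hi K L hK hL hU hI

end IsVal

/-- The section of `P` by the hyperplane through the origin orthogonal to `u`. -/
def sec {n : ℕ} (u : Euc n) (P : Set (Euc n)) : Set (Euc n) := {p ∈ P | ⟪u, p⟫ = 0}

/-- `u` lies in the normal cone of `P` at the origin. -/
def IsNormal0 {n : ℕ} (P : Set (Euc n)) (u : Euc n) : Prop := ∀ p ∈ P, ⟪u, p⟫ ≤ 0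

open Classical in
/-- The value of `ξ` on the face of `P` through the origin with outer normal `u`, if there is
one, and `0` otherwise. -/
def faceVal {n : ℕ} (u : Euc n) (ξ : Set (Euc n) → ℝ) (P : Set (Euc n)) : ℝ :=
  if IsNormal0 P u then ξ (sec u P) else 0

section Sec

variable {n : ℕ} {u : Euc n} {P : Set (Euc n)}

lemma sec_subset (u : Euc n) (P : Set (Euc n)) : sec u P ⊆ P := fun _ h => h.1

lemma IsPolytope0.sec (hP : IsPolytope0 P) (u : Euc n) : IsPolytope0 (sec u P) := by
  have h := (hP.inter_isPolyhedron (isPolyhedron_halfspace (innerSL ℝ u) 0)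
    (by simp)).inter_isPolyhedron (isPolyhedron_halfspace (innerSL ℝ (-u)) 0) (by simp)
  convert h using 1
  ext p
  simp only [_root_.sec, Set.mem_inter_iff, Set.mem_ofPred_eq, innerSL_apply_apply,
    inner_neg_left, neg_nonpos, and_assoc, le_antisymm_iff]

lemma IsVal.sec {ξ : Set (Euc n) → ℝ} (h : IsVal ξ) (u : Euc n) :
    IsVal fun P => ξ (sec u P) := by
  intro K L hK hL hU hI
  have h1 : _root_.sec u (K ∪ L) = _root_.sec u K ∪ _root_.sec u L := by
    ext; simp [_root_.sec, or_and_right]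
  have h2 : _root_.sec u (K ∩ L) = _root_.sec u K ∩ _root_.sec u L := by
    ext; simp [_root_.sec]
  have := h _ _ (hK.sec u) (hL.sec u) (h1 ▸ hU.sec u) (h2 ▸ hI.sec u)
  simpa only [h1, h2] using this

lemma sec_subset_of_not_isNormal0 {K L : Set (Euc n)} (hK : IsNormal0 K u) (hL : ¬ IsNormal0 L u)
    (hLc : IsClosed L) (hKL : Convex ℝ (K ∪ L)) : sec u K ⊆ L := by
  rintro p ⟨hp, hup⟩
  rw [IsNormal0] at hL
  push Not at hL
  obtain ⟨l, hl, hul⟩ := hL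
  have hmem : ∀ t ∈ Set.Ioc (0 : ℝ) 1, (1 - t) • p + t • l ∈ L := by
    intro t ht
    rcases hKL (.inl hp) (.inr hl) (by linarith [ht.2] : 0 ≤ 1 - t) ht.1.le (by ring) with h | h
    · have := hK _ h
      rw [inner_add_right, inner_smul_right, inner_smul_right, hup] at this
      nlinarith [mul_pos ht.1 hul]
    · exact h
  have hcont : Tendsto (fun t : ℝ => (1 - t) • p + t • l) (nhdsWithin 0 (Set.Ioi 0)) (nhds p) := by
    have : Continuous fun t : ℝ => (1 - t) • p + t • l := by fun_prop
    simpa using (this.tendsto 0).mono_left nhdsWithin_le_nhds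
  refine hLc.mem_of_tendsto hcont ?_
  filter_upwards [Ioc_mem_nhdsGT (zero_lt_one (α := ℝ))] with t ht using hmem t ht

lemma IsVal.faceVal {ξ : Set (Euc n) → ℝ} (h : IsVal fun P => ξ (_root_.sec u P)) :
    IsVal (faceVal u ξ) := by
  have key : ∀ K L : Set (Euc n), IsPolytope0 K → IsPolytope0 L → IsPolytope0 (K ∪ L) →
      IsNormal0 K u → ¬ IsNormal0 L u →
      _root_.faceVal u ξ (K ∪ L) + _root_.faceVal u ξ (K ∩ L) =
        _root_.faceVal u ξ K + _root_.faceVal u ξ L := by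
    intro K L hK hL hU h1 h2
    have hs := sec_subset_of_not_isNormal0 h1 h2 hL.isCompact.isClosed hU.convex
    have h3 : ¬ IsNormal0 (K ∪ L) u := fun h => h2 fun p hp => h p (.inr hp)
    have h4 : IsNormal0 (K ∩ L) u := fun p hp => h1 p hp.1
    have h5 : _root_.sec u (K ∩ L) = _root_.sec u K :=
      Set.Subset.antisymm (fun p hp => ⟨hp.1.1, hp.2⟩) fun p hp => ⟨⟨hp.1, hs hp⟩, hp.2⟩
    simp only [_root_.faceVal, h1, h2, h3, h4, h5, if_true, if_false]
    ring
  intro K L hK hL hU hI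
  by_cases h1 : IsNormal0 K u <;> by_cases h2 : IsNormal0 L u
  · have h3 : IsNormal0 (K ∪ L) u := by rintro p (hp | hp); exacts [h1 p hp, h2 p hp]
    have h4 : IsNormal0 (K ∩ L) u := fun p hp => h1 p hp.1
    simpa only [_root_.faceVal, h1, h2, h3, h4, if_true] using h K L hK hL hU hI
  · exact key K L hK hL hU h1 h2
  · have := key L K hL hK (Set.union_comm K L ▸ hU) h2 h1
    rwa [Set.union_comm L K, Set.inter_comm L K, add_comm (_root_.faceVal u ξ L)] at this
  · have h3 : ¬ IsNormal0 (K ∪ L) u := fun h => h1 fun p hp => h p (.inl hp)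
    have h4 : ¬ IsNormal0 (K ∩ L) u := by
      rw [IsNormal0] at h1 h2
      push Not at h1 h2
      obtain ⟨k, hk, hk'⟩ := h1
      obtain ⟨l, hl, hl'⟩ := h2
      obtain ⟨z, hz, hz'⟩ := exists_mem_segment_inter hK.isCompact.isClosed hL.isCompact.isClosed
        hU.convex hk hl
      intro h
      exact absurd (h z hz') (not_le.2 ((lt_min hk' hl').trans_le
        (min_le_inner_of_mem_segment hz u)))
    simp only [_root_.faceVal, h1, h2, h3, h4, if_false]

end Sec

section Faces

variable {n : ℕ} {P A F : Set (Euc n)} {u v : Euc n}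

lemma sdim_eq_finrank_span (h0 : (0 : Euc n) ∈ P) :
    sdim P = Module.finrank ℝ (Submodule.span ℝ P) := by
  have h : (fun x : Euc n => x -ᵥ (0 : Euc n)) '' P = P := by
    simp
  rw [sdim, direction_affineSpan, vectorSpan_eq_span_vsub_set_right ℝ h0, h]

lemma zero_mem_sec (h0 : (0 : Euc n) ∈ P) (u : Euc n) : (0 : Euc n) ∈ sec u P := by
  simp [sec, h0]

lemma isExposed_sec (hu : IsNormal0 P u) (h0 : (0 : Euc n) ∈ P) : IsExposed ℝ P (sec u P) := by
  intro _
  refine ⟨innerSL ℝ u, ?_⟩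
  ext p
  simp only [sec, Set.mem_ofPred_eq, innerSL_apply_apply]
  refine and_congr_right fun hp => ⟨fun h y hy => h ▸ hu y hy, fun h => ?_⟩
  have := h 0 h0
  rw [inner_zero_right] at this
  exact le_antisymm (hu p hp) this

lemma mem_facesO {j : ℕ} (h0 : (0 : Euc n) ∈ P) :
    F ∈ facesO j P ↔ ∃ u, IsNormal0 P u ∧ F = sec u P ∧ sdim F = j := by
  constructor
  · rintro ⟨hF, hj, hF0⟩
    obtain ⟨l, hl⟩ := hF ⟨0, hF0⟩
    have hlu : ∀ p, ⟪(InnerProductSpace.toDual ℝ (Euc n)).symm l, p⟫ = l p := fun p =>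
      InnerProductSpace.toDual_symm_apply
    have hmax : ∀ p ∈ P, l p ≤ 0 := by
      rw [hl] at hF0
      simpa using hF0.2
    refine ⟨(InnerProductSpace.toDual ℝ (Euc n)).symm l, ?_, ?_, hj⟩
    · intro p hp
      rw [hlu]
      exact hmax p hp
    · rw [hl]
      ext p
      simp only [sec, Set.mem_ofPred_eq, hlu]
      refine and_congr_right fun hp => ⟨fun h => ?_, fun h y hy => h ▸ hmax y hy⟩
      have := h 0 h0
      rw [map_zero] at this
      exact le_antisymm (hmax p hp) this
  · rintro ⟨u, hu, rfl, hj⟩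
    exact ⟨isExposed_sec hu h0, hj, zero_mem_sec h0 u⟩

lemma IsPolytope0.of_mem_facesO {j : ℕ} (hP : IsPolytope0 P) (hF : F ∈ facesO j P) :
    IsPolytope0 F := by
  obtain ⟨u, -, rfl, -⟩ := (mem_facesO hP.2).1 hF
  exact hP.sec u

lemma IsPolytope0.finite_facesO (hP : IsPolytope0 P) (j : ℕ) : (facesO j P).Finite := by
  obtain ⟨⟨S, hS⟩, h0⟩ := id hP
  refine Set.Finite.of_finite_image (f := fun F => F.extremePoints ℝ) ?_ ?_
  · refine S.finite_toSet.powerset.subset ?_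
    rintro _ ⟨F, hF, rfl⟩
    have h1 := hF.1.isExtreme.extremePoints_subset_extremePoints
    rw [hS] at h1
    exact h1.trans extremePoints_convexHull_subset
  · intro F hF G hG hFG
    have h1 := closure_convexHull_extremePoints (hP.of_mem_facesO hF).isCompact
      (hP.of_mem_facesO hF).convex
    have h2 := closure_convexHull_extremePoints (hP.of_mem_facesO hG).isCompact
      (hP.of_mem_facesO hG).convex
    dsimp only at hFG
    rw [← h1, ← h2, hFG]

lemma exists_linearIndependent_pair (h0 : (0 : Euc n) ∈ P) (h : 2 ≤ sdim P) :
    ∃ a ∈ P, ∃ b ∈ P, LinearIndependent ℝ ![a, b] := by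
  by_contra! H
  rw [sdim_eq_finrank_span h0] at h
  have hne : ∃ a ∈ P, a ≠ 0 := by
    by_contra! h'
    have : Submodule.span ℝ P = ⊥ := Submodule.span_eq_bot.2 h'
    rw [this, finrank_bot] at h
    omega
  obtain ⟨a, ha, ha0⟩ := hne
  have hle : Submodule.span ℝ P ≤ Submodule.span ℝ {a} := by
    rw [Submodule.span_le]
    intro b hb
    have := H a ha b hb
    rw [LinearIndependent.pair_iff' ha0] at this
    push Not at this
    exact Submodule.mem_span_singleton.2 this
  have h1 := Submodule.finrank_mono hle
  rw [finrank_span_singleton ha0] at h1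
  omega

lemma two_le_sdim (h0 : (0 : Euc n) ∈ P) {a b : Euc n} (ha : a ∈ P) (hb : b ∈ P)
    (h : LinearIndependent ℝ ![a, b]) : 2 ≤ sdim P := by
  rw [sdim_eq_finrank_span h0]
  have h1 : _ = 2 := finrank_span_eq_card h
  rw [← h1]
  refine Submodule.finrank_mono (Submodule.span_mono ?_)
  rintro _ ⟨i, rfl⟩
  fin_cases i
  exacts [ha, hb]

lemma exists_smul_eq_of_sdim_le_one (h0 : (0 : Euc n) ∈ P) (h : sdim P ≤ 1) {a b : Euc n}
    (ha : a ∈ P) (ha0 : a ≠ 0) (hb : b ∈ P) : ∃ c : ℝ, c • a = b := by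
  by_contra! H
  have := two_le_sdim h0 ha hb ((LinearIndependent.pair_iff' ha0).2 H)
  omega

lemma exists_ne_zero_of_sdim_pos (h0 : (0 : Euc n) ∈ P) (h : 1 ≤ sdim P) : ∃ a ∈ P, a ≠ 0 := by
  by_contra! h'
  rw [sdim_eq_finrank_span h0, Submodule.span_eq_bot.2 h', finrank_bot] at h
  omega

lemma one_le_sdim (h0 : (0 : Euc n) ∈ P) {a : Euc n} (ha : a ∈ P) (ha0 : a ≠ 0) :
    1 ≤ sdim P := by
  by_contra! h'
  rw [sdim_eq_finrank_span h0, Nat.lt_one_iff, Submodule.finrank_eq_zero,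
    Submodule.span_eq_bot] at h'
  exact ha0 (h' a ha)

lemma sdim_mono {Q : Set (Euc n)} (h0 : (0 : Euc n) ∈ P) (h : P ⊆ Q) : sdim P ≤ sdim Q := by
  rw [sdim_eq_finrank_span h0, sdim_eq_finrank_span (h h0)]
  exact Submodule.finrank_mono (Submodule.span_mono h)

lemma sdim_le (P : Set (Euc n)) : sdim P ≤ n := by
  simpa [sdim] using Submodule.finrank_le (affineSpan ℝ P).direction

lemma sdim_lt_of_forall_inner (h0 : (0 : Euc n) ∈ P) (hu : u ≠ 0) (h : ∀ p ∈ P, ⟪u, p⟫ = 0) :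
    sdim P < n := by
  rw [sdim_eq_finrank_span h0]
  have hlt : Submodule.span ℝ P < ⊤ := by
    rw [lt_top_iff_ne_top]
    intro htop
    have : u ∈ Submodule.span ℝ P := htop ▸ Submodule.mem_top
    have hle : Submodule.span ℝ P ≤ (innerSL ℝ u).ker := Submodule.span_le.2 fun p hp => by
      simpa using h p hp
    have := hle this
    rw [LinearMap.mem_ker] at this
    exact hu (by simpa using this)
  simpa using Submodule.finrank_lt hlt.ne

lemma LinearIndependent.exists_unit_orthogonal {a b : Euc 3} (h : LinearIndependent ℝ ![a, b]) :
    ∃ m : Euc 3, ‖m‖ = 1 ∧ ⟪m, a⟫ = 0 ∧ ⟪m, b⟫ = 0 ∧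
      ∀ w : Euc 3, ⟪w, a⟫ = 0 → ⟪w, b⟫ = 0 → ∃ c : ℝ, w = c • m := by
  set W := Submodule.span ℝ (Set.range ![a, b]) with hW
  have hmem : ∀ w : Euc 3, w ∈ Wᗮ ↔ ⟪w, a⟫ = 0 ∧ ⟪w, b⟫ = 0 := by
    intro w
    rw [Submodule.mem_orthogonal']
    constructor
    · intro h
      exact ⟨h a (Submodule.subset_span ⟨0, rfl⟩), h b (Submodule.subset_span ⟨1, rfl⟩)⟩
    · rintro ⟨h1, h2⟩ p hp
      have hle : W ≤ (innerSL ℝ w).ker := Submodule.span_le.2 <| by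
        rintro _ ⟨i, rfl⟩
        fin_cases i
        · simpa using h1
        · simpa using h2
      simpa using hle hp
  have h2 : Module.finrank ℝ W = 2 := by rw [hW, finrank_span_eq_card h, Fintype.card_fin]
  have h1 : Module.finrank ℝ Wᗮ = 1 := by
    have := Submodule.finrank_add_finrank_orthogonal W
    rw [h2, finrank_euclideanSpace_fin] at this
    omega
  obtain ⟨⟨m, hm⟩, hm0, hspan⟩ := finrank_eq_one_iff'.1 h1
  have hm0' : m ≠ 0 := fun h => hm0 (Subtype.ext h)
  refine ⟨‖m‖⁻¹ • m, norm_smul_inv_norm (𝕜 := ℝ) hm0', ?_, ?_, ?_⟩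
  · rw [inner_smul_left, ((hmem m).1 hm).1, mul_zero]
  · rw [inner_smul_left, ((hmem m).1 hm).2, mul_zero]
  · intro w hwa hwb
    obtain ⟨c, hc⟩ := hspan ⟨w, (hmem w).2 ⟨hwa, hwb⟩⟩
    refine ⟨c * ‖m‖, ?_⟩
    rw [smul_smul, mul_assoc, mul_inv_cancel₀ (norm_ne_zero_iff.2 hm0'), mul_one]
    exact (congrArg Subtype.val hc).symm

lemma linearIndependent_pair_of_inner_eq_zero {a b : Euc n} (ha : a ≠ 0) (hb : b ≠ 0)
    (h : ⟪a, b⟫ = 0) : LinearIndependent ℝ ![a, b] := by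
  refine (LinearIndependent.pair_iff' ha).2 fun c hc => hb ?_
  rw [← hc, inner_smul_right, mul_eq_zero] at h
  rcases h with rfl | h
  · rw [← hc, zero_smul]
  · exact absurd (inner_self_eq_zero.1 h) ha

lemma ne_zero_of_norm_one (hu : ‖u‖ = 1) : u ≠ 0 := by
  rintro rfl
  simp at hu

lemma eq_or_eq_neg_of_norm_one {c : ℝ} (hu : ‖u‖ = 1) (hv : ‖v‖ = 1) (h : v = c • u) :
    v = u ∨ v = -u := by
  rw [h, norm_smul, hu, mul_one, Real.norm_eq_abs] at hv
  rcases eq_or_eq_neg_of_abs_eq hv with rfl | rfl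
  · left; simpa using h
  · right; simpa using h

end Faces

/-- The unit vectors orthogonal to `u`. -/
def orthUnit {n : ℕ} (u : Euc n) : Set (Euc n) := {v | ‖v‖ = 1 ∧ ⟪u, v⟫ = 0}

/-- Twice the support function of a set `A` in the plane `uᗮ`, minus the contributions of the
edges of `A` through the origin, counted by their normals in `uᗮ`. -/
def flagVal {n : ℕ} (x u : Euc n) (A : Set (Euc n)) : ℝ :=
  2 * supp A x - ∑ᶠ v ∈ orthUnit u, faceVal v (fun E => supp E x) A

/-- The sum of `flagVal` over the outer unit normals of the faces of `P` at the origin. -/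
def flagSum {n : ℕ} (x : Euc n) (P : Set (Euc n)) : ℝ :=
  ∑ᶠ u ∈ {u : Euc n | ‖u‖ = 1}, faceVal u (flagVal x u) P

section Flags

variable {n : ℕ} {P A : Set (Euc n)} {u v x : Euc n}

lemma sec_smul {c : ℝ} (hc : c ≠ 0) (u : Euc n) (P : Set (Euc n)) : sec (c • u) P = sec u P := by
  ext p
  simp [sec, inner_smul_left, hc]

lemma IsNormal0.smul {c : ℝ} (hc : 0 ≤ c) (h : IsNormal0 P u) : IsNormal0 P (c • u) := by
  intro p hp
  rw [inner_smul_left]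
  exact mul_nonpos_of_nonneg_of_nonpos hc (h p hp)

lemma sec_eq_self (h : ∀ p ∈ P, ⟪u, p⟫ = 0) : sec u P = P :=
  Set.Subset.antisymm (sec_subset u P) fun p hp => ⟨hp, h p hp⟩

lemma faceVal_of_forall_inner {ξ : Set (Euc n) → ℝ} (h : ∀ p ∈ P, ⟪u, p⟫ = 0) :
    faceVal u ξ P = ξ P := by
  have hn : IsNormal0 P u := fun p hp => (h p hp).le
  rw [faceVal, if_pos hn, sec_eq_self h]

lemma ne_neg_of_norm_one (hu : ‖u‖ = 1) : u ≠ -u := by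
  intro h
  have h2 : (2 : ℝ) • u = 0 := by
    rw [two_smul]
    nth_rewrite 2 [h]
    exact add_neg_cancel u
  exact ne_zero_of_norm_one hu ((smul_eq_zero.1 h2).resolve_left two_ne_zero)

lemma eq_or_eq_neg_of_smul {m : Euc n} {c d : ℝ} (hu : ‖u‖ = 1) (hv : ‖v‖ = 1) (hm : ‖m‖ = 1)
    (h : u = c • m) (h' : v = d • m) : v = u ∨ v = -u := by
  rcases eq_or_eq_neg_of_norm_one hm hu h with rfl | rfl
  · exact eq_or_eq_neg_of_norm_one hm hv h'
  · rw [neg_neg]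
    exact (eq_or_eq_neg_of_norm_one hm hv h').symm

lemma exists_ne_zero_of_faceVal_ne_zero (h0 : (0 : Euc n) ∈ A)
    (h : faceVal v (fun E => supp E x) A ≠ 0) :
    IsNormal0 A v ∧ ∃ b ∈ sec v A, b ≠ 0 := by
  rw [faceVal] at h
  split_ifs at h with hv
  · refine ⟨hv, ?_⟩
    by_contra! h'
    exact h (supp_eq_zero_of_forall_inner ⟨0, zero_mem_sec h0 v⟩ fun y hy => by
      rw [h' y hy, inner_zero_right])
  · exact absurd rfl h

end Flags

section Flags3

variable {P A : Set (Euc 3)} {u x : Euc 3}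

lemma eq_or_eq_neg_of_orthogonal_pair {a b u v : Euc 3} (h : LinearIndependent ℝ ![a, b])
    (hu : ‖u‖ = 1) (hv : ‖v‖ = 1) (hua : ⟪u, a⟫ = 0) (hub : ⟪u, b⟫ = 0) (hva : ⟪v, a⟫ = 0)
    (hvb : ⟪v, b⟫ = 0) : v = u ∨ v = -u := by
  obtain ⟨m, hm, -, -, hspan⟩ := h.exists_unit_orthogonal
  obtain ⟨c, hc⟩ := hspan u hua hub
  obtain ⟨d, hd⟩ := hspan v hva hvb
  exact eq_or_eq_neg_of_smul hu hv hm hc hd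

lemma flagVal_aux_line (hu : ‖u‖ = 1) (hA : ∀ p ∈ A, ⟪u, p⟫ = 0) (h0 : (0 : Euc 3) ∈ A)
    (h1 : sdim A ≤ 1) (x : Euc 3) :
    (orthUnit u ∩ Function.support fun v => faceVal v (fun E => supp E x) A).Finite ∧
      flagVal x u A = 0 := by
  by_cases hz : ∀ a ∈ A, a = 0
  · have hf : ∀ v, faceVal v (fun E => supp E x) A = 0 := by
      intro v
      by_contra h
      obtain ⟨-, b, hb, hb0⟩ := exists_ne_zero_of_faceVal_ne_zero h0 h
      exact hb0 (hz b hb.1)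
    have hs : supp A x = 0 := supp_eq_zero_of_forall_inner ⟨0, h0⟩ fun y hy => by
      rw [hz y hy, inner_zero_right]
    constructor
    · simp [hf]
    · simp [flagVal, hf, hs]
  push Not at hz
  obtain ⟨a, ha, ha0⟩ := hz
  have hua := linearIndependent_pair_of_inner_eq_zero (ne_zero_of_norm_one hu) ha0 (hA a ha)
  obtain ⟨m, hm, hmu, hma, hspan⟩ := hua.exists_unit_orthogonal
  have hmA : ∀ p ∈ A, ⟪m, p⟫ = 0 := by
    intro p hp
    obtain ⟨c, rfl⟩ := exists_smul_eq_of_sdim_le_one h0 h1 ha ha0 hp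
    rw [inner_smul_right, hma, mul_zero]
  have hmA' : ∀ p ∈ A, ⟪-m, p⟫ = 0 := fun p hp => by rw [inner_neg_left, hmA p hp, neg_zero]
  have hsupp : ∀ v ∈ Function.support (fun v => faceVal v (fun E => supp E x) A),
      v ∈ orthUnit u ↔ v ∈ ({m, -m} : Set (Euc 3)) := by
    intro v hv
    obtain ⟨-, b, hb, hb0⟩ := exists_ne_zero_of_faceVal_ne_zero h0 hv
    constructor
    · rintro ⟨hv1, huv⟩
      refine eq_or_eq_neg_of_orthogonal_pair hua hm hv1 hmu hma ?_ ?_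
      · rw [real_inner_comm, huv]
      · obtain ⟨c, rfl⟩ := exists_smul_eq_of_sdim_le_one h0 h1 hb.1 hb0 ha
        rw [inner_smul_right, hb.2, mul_zero]
    · rintro (rfl | rfl)
      · exact ⟨hm, by rw [real_inner_comm, hmu]⟩
      · exact ⟨by rw [norm_neg, hm], by rw [inner_neg_right, real_inner_comm, hmu, neg_zero]⟩
  constructor
  · exact (Set.toFinite ({m, -m} : Set (Euc 3))).subset fun v hv => (hsupp v hv.2).1 hv.1
  · rw [flagVal, finsum_mem_inter_support_eq' _ _ _ hsupp, finsum_mem_pair,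
      faceVal_of_forall_inner hmA, faceVal_of_forall_inner hmA']
    · ring
    · exact ne_neg_of_norm_one hm

lemma sdim_sec_le_one {v : Euc 3} (hu : ‖u‖ = 1) (hv : v ∈ orthUnit u) (hA : ∀ p ∈ A, ⟪u, p⟫ = 0)
    (h0 : (0 : Euc 3) ∈ A) : sdim (sec v A) ≤ 1 := by
  by_contra! h
  obtain ⟨a, ha, b, hb, hab⟩ := exists_linearIndependent_pair (zero_mem_sec h0 v) h
  have huv := hv.2
  rcases eq_or_eq_neg_of_orthogonal_pair hab hu hv.1 (hA a ha.1) (hA b hb.1) ha.2 hb.2 with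
    rfl | rfl
  · rw [inner_self_eq_zero] at huv
    exact ne_zero_of_norm_one hu huv
  · rw [inner_neg_right, neg_eq_zero, inner_self_eq_zero] at huv
    exact ne_zero_of_norm_one hu huv

lemma bijOn_sec_facesO_one (hu : ‖u‖ = 1) (hA : ∀ p ∈ A, ⟪u, p⟫ = 0) (h0 : (0 : Euc 3) ∈ A)
    (h2 : sdim A = 2) :
    Set.BijOn (fun v => sec v A) {v ∈ orthUnit u | IsNormal0 A v ∧ sdim (sec v A) = 1}
      (facesO 1 A) := by
  refine ⟨?_, ?_, ?_⟩
  · rintro v ⟨-, hv, hv1⟩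
    exact (mem_facesO h0).2 ⟨v, hv, rfl, hv1⟩
  · rintro v ⟨hv, hvn, hv1⟩ w ⟨hw, hwn, -⟩ hvw
    dsimp only at hvw
    obtain ⟨a, ha, ha0⟩ := exists_ne_zero_of_sdim_pos (zero_mem_sec h0 v) hv1.ge
    have hua := linearIndependent_pair_of_inner_eq_zero (ne_zero_of_norm_one hu) ha0 (hA a ha.1)
    have ha' : a ∈ sec w A := hvw ▸ ha
    rcases eq_or_eq_neg_of_orthogonal_pair hua hv.1 hw.1 (by rw [real_inner_comm, hv.2]) ha.2
      (by rw [real_inner_comm, hw.2]) ha'.2 with rfl | rfl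
    · rfl
    · exfalso
      rw [sec_eq_self fun p hp => le_antisymm (hvn p hp) (by simpa using hwn p hp), h2] at hv1
      omega
  · intro E hE
    obtain ⟨w, hw, rfl, hw1⟩ := (mem_facesO h0).1 hE
    set w' := w - ⟪u, w⟫ • u with hw'
    have hin : ∀ p ∈ A, ⟪w', p⟫ = ⟪w, p⟫ := by
      intro p hp
      rw [hw', inner_sub_left, inner_smul_left, hA p hp, mul_zero, sub_zero]
    have hsec : sec w' A = sec w A := by
      ext p
      simp only [sec, Set.mem_ofPred_eq]
      exact and_congr_right fun hp => by rw [hin p hp]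
    have hw0 : w' ≠ 0 := by
      intro h
      rw [← hsec, h, sec_eq_self (by simp)] at hw1
      omega
    have hsec' : sec (‖w'‖⁻¹ • w') A = sec w A := by
      rw [sec_smul (inv_ne_zero (norm_ne_zero_iff.2 hw0)), hsec]
    refine ⟨‖w'‖⁻¹ • w', ⟨⟨norm_smul_inv_norm (𝕜 := ℝ) hw0, ?_⟩, ?_, ?_⟩, hsec'⟩
    · rw [inner_smul_right, hw', inner_sub_right, inner_smul_right, real_inner_self_eq_norm_sq, hu]
      ring
    · exact IsNormal0.smul (by positivity) fun p hp => (hin p hp).trans_le (hw p hp)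
    · rw [hsec', hw1]

lemma flagVal_aux_plane (hu : ‖u‖ = 1) (hA : ∀ p ∈ A, ⟪u, p⟫ = 0) (hP : IsPolytope0 A)
    (h2 : sdim A = 2) (x : Euc 3) :
    (orthUnit u ∩ Function.support fun v => faceVal v (fun E => supp E x) A).Finite ∧
      flagVal x u A = 2 * supp A x - ∑ᶠ E ∈ facesO 1 A, supp E x := by
  have h0 := hP.2
  have hbij := bijOn_sec_facesO_one hu hA h0 h2
  have hsupp : ∀ v ∈ Function.support (fun v => faceVal v (fun E => supp E x) A),
      v ∈ orthUnit u ↔ v ∈ {v ∈ orthUnit u | IsNormal0 A v ∧ sdim (sec v A) = 1} := by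
    intro v hv
    obtain ⟨hv1, b, hb, hb0⟩ := exists_ne_zero_of_faceVal_ne_zero h0 hv
    exact ⟨fun h => ⟨h, hv1, le_antisymm (sdim_sec_le_one hu h hA h0)
      (one_le_sdim (zero_mem_sec h0 v) hb hb0)⟩, fun h => h.1⟩
  constructor
  · exact ((hbij.finite_iff_finite).2 (hP.finite_facesO 1)).subset
      fun v hv => (hsupp v hv.2).1 hv.1
  · rw [flagVal, finsum_mem_inter_support_eq' _ _ _ hsupp]
    congr 1
    refine finsum_mem_eq_of_bijOn _ hbij fun v hv => ?_
    rw [faceVal, if_pos hv.2.1]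

lemma sdim_le_two (hu : ‖u‖ = 1) (hA : ∀ p ∈ A, ⟪u, p⟫ = 0) (h0 : (0 : Euc 3) ∈ A) :
    sdim A ≤ 2 := Nat.lt_succ_iff.1 (sdim_lt_of_forall_inner h0 (ne_zero_of_norm_one hu) hA)

lemma finite_support_faceVal (hu : ‖u‖ = 1) (hA : ∀ p ∈ A, ⟪u, p⟫ = 0) (hP : IsPolytope0 A)
    (x : Euc 3) :
    (orthUnit u ∩ Function.support fun v => faceVal v (fun E => supp E x) A).Finite := by
  have := sdim_le_two hu hA hP.2
  rcases Nat.lt_or_ge (sdim A) 2 with h | h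
  · exact (flagVal_aux_line hu hA hP.2 (by omega) x).1
  · exact (flagVal_aux_plane hu hA hP (by omega) x).1

lemma isVal_faceVal_flagVal (hu : ‖u‖ = 1) (x : Euc 3) : IsVal (faceVal u (flagVal x u)) := by
  refine IsVal.faceVal ?_
  refine IsVal.sub (((isVal_supp x).sec u).const_mul 2) ?_
  refine isVal_finsum_mem (fun v _ => (((isVal_supp x).sec v).faceVal).sec u) fun P hP => ?_
  exact finite_support_faceVal hu (fun p hp => hp.2) (hP.sec u) x

end Flags3

section FlagSum

variable {P : Set (Euc 3)} {u x : Euc 3}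

lemma flagSum_of_sdim_le_one (h0 : (0 : Euc 3) ∈ P) (h1 : sdim P ≤ 1) (x : Euc 3) :
    ({u : Euc 3 | ‖u‖ = 1} ∩ Function.support fun u => faceVal u (flagVal x u) P).Finite ∧
      flagSum x P = 0 := by
  have hz : ∀ u ∈ {u : Euc 3 | ‖u‖ = 1}, faceVal u (flagVal x u) P = 0 := by
    intro u hu
    rw [faceVal]
    split_ifs with h
    · exact (flagVal_aux_line hu (fun p hp => hp.2) (zero_mem_sec h0 u)
        ((sdim_mono (zero_mem_sec h0 u) (sec_subset u P)).trans h1) x).2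
    · rfl
  constructor
  · convert Set.finite_empty
    ext u
    simp only [Set.mem_inter_iff, Function.mem_support, Set.mem_empty_iff_false, iff_false, not_and,
      not_not]
    exact hz u
  · exact finsum_mem_eq_zero_of_forall_eq_zero hz

lemma exists_unit_normal (h0 : (0 : Euc 3) ∈ P) (h2 : sdim P = 2) :
    ∃ m : Euc 3, ‖m‖ = 1 ∧ ∀ p ∈ P, ⟪m, p⟫ = 0 := by
  obtain ⟨a, ha, b, hb, hab⟩ := exists_linearIndependent_pair h0 h2.ge
  obtain ⟨m, hm, hma, hmb, -⟩ := hab.exists_unit_orthogonal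
  refine ⟨m, hm, fun p hp => ?_⟩
  have hle : Submodule.span ℝ (Set.range ![a, b]) ≤ Submodule.span ℝ P := by
    refine Submodule.span_mono ?_
    rintro _ ⟨i, rfl⟩
    fin_cases i
    exacts [ha, hb]
  have hr : Module.finrank ℝ (Submodule.span ℝ P) ≤
      Module.finrank ℝ (Submodule.span ℝ (Set.range ![a, b])) := by
    rw [← sdim_eq_finrank_span h0, h2, finrank_span_eq_card hab, Fintype.card_fin]
  have hp' : p ∈ Submodule.span ℝ (Set.range ![a, b]) :=
    Submodule.eq_of_le_of_finrank_le hle hr ▸ Submodule.subset_span hp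
  have hle' : Submodule.span ℝ (Set.range ![a, b]) ≤ (innerSL ℝ m).ker := Submodule.span_le.2 <| by
    rintro _ ⟨i, rfl⟩
    fin_cases i
    · simpa using hma
    · simpa using hmb
  simpa using hle' hp'

lemma flagSum_of_sdim_eq_two (hP : IsPolytope0 P) (h2 : sdim P = 2) (x : Euc 3) :
    ({u : Euc 3 | ‖u‖ = 1} ∩ Function.support fun u => faceVal u (flagVal x u) P).Finite ∧
      flagSum x P = 2 * (2 * supp P x - ∑ᶠ E ∈ facesO 1 P, supp E x) := by
  obtain ⟨m, hm, hmP⟩ := exists_unit_normal hP.2 h2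
  have hmP' : ∀ p ∈ P, ⟪-m, p⟫ = 0 := fun p hp => by rw [inner_neg_left, hmP p hp, neg_zero]
  have hm' : ‖-m‖ = 1 := by rw [norm_neg, hm]
  have hsupp : ∀ u ∈ Function.support (fun u => faceVal u (flagVal x u) P),
      u ∈ {u : Euc 3 | ‖u‖ = 1} ↔ u ∈ ({m, -m} : Set (Euc 3)) := by
    intro u hu
    constructor
    · intro hu1
      by_contra hne
      refine hu ?_
      dsimp only
      rw [faceVal]
      split_ifs with h
      · refine (flagVal_aux_line hu1 (fun p hp => hp.2) (zero_mem_sec hP.2 u) ?_ x).2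
        by_contra! hd
        obtain ⟨a, ha, b, hb, hab⟩ := exists_linearIndependent_pair (zero_mem_sec hP.2 u) hd
        exact hne (eq_or_eq_neg_of_orthogonal_pair hab hm hu1 (hmP a ha.1) (hmP b hb.1) ha.2 hb.2)
      · rfl
    · rintro (rfl | rfl)
      exacts [hm, hm']
  constructor
  · exact (Set.toFinite ({m, -m} : Set (Euc 3))).subset fun v hv => (hsupp v hv.2).1 hv.1
  · rw [flagSum, finsum_mem_inter_support_eq' _ _ _ hsupp,
      finsum_mem_pair (ne_neg_of_norm_one hm), faceVal_of_forall_inner hmP,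
      faceVal_of_forall_inner hmP', (flagVal_aux_plane hm hmP hP h2 x).2,
      (flagVal_aux_plane hm' hmP' hP h2 x).2]
    ring

lemma bijOn_sec_facesO_two (h0 : (0 : Euc 3) ∈ P) (h3 : sdim P = 3) :
    Set.BijOn (fun u => sec u P) {u : Euc 3 | ‖u‖ = 1 ∧ IsNormal0 P u ∧ sdim (sec u P) = 2}
      (facesO 2 P) := by
  refine ⟨?_, ?_, ?_⟩
  · rintro u ⟨-, hu, hu2⟩
    exact (mem_facesO h0).2 ⟨u, hu, rfl, hu2⟩
  · rintro u ⟨hu1, hu, hu2⟩ v ⟨hv1, hv, -⟩ huv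
    dsimp only at huv
    obtain ⟨a, ha, b, hb, hab⟩ := exists_linearIndependent_pair (zero_mem_sec h0 u) hu2.ge
    rcases eq_or_eq_neg_of_orthogonal_pair hab hu1 hv1 ha.2 hb.2 (huv ▸ ha).2 (huv ▸ hb).2
      with rfl | rfl
    · rfl
    · exfalso
      rw [sec_eq_self fun p hp => le_antisymm (hu p hp) (by simpa using hv p hp), h3] at hu2
      omega
  · intro F hF
    obtain ⟨w, hw, rfl, hw2⟩ := (mem_facesO h0).1 hF
    have hw0 : w ≠ 0 := by
      rintro rfl
      rw [sec_eq_self (by simp), h3] at hw2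
      omega
    have hsec : sec (‖w‖⁻¹ • w) P = sec w P := sec_smul (inv_ne_zero (norm_ne_zero_iff.2 hw0)) _ _
    exact ⟨‖w‖⁻¹ • w, ⟨norm_smul_inv_norm (𝕜 := ℝ) hw0, hw.smul (by positivity), hsec ▸ hw2⟩, hsec⟩

/-- A face of a face through the origin is a face. -/
lemma facesO_trans {n i j : ℕ} {P F E : Set (Euc n)} (hP : IsPolytope0 P) (hF : F ∈ facesO i P)
    (hE : E ∈ facesO j F) : E ∈ facesO j P := by
  obtain ⟨u, hu, rfl, -⟩ := (mem_facesO hP.2).1 hF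
  obtain ⟨v, hv, rfl, hj⟩ := (mem_facesO (zero_mem_sec hP.2 u)).1 hE
  obtain ⟨⟨S, hS⟩, h0⟩ := id hP
  have hSP : ∀ s ∈ S, s ∈ P := fun s hs => hS ▸ subset_convexHull ℝ _ hs
  have hN : ∃ N : ℝ, ∀ M, N ≤ M → ∀ s ∈ S, M * ⟪u, s⟫ + ⟪v, s⟫ ≤ 0 := by
    have : ∀ s ∈ S, ∀ᶠ M : ℝ in atTop, M * ⟪u, s⟫ + ⟪v, s⟫ ≤ 0 := by
      intro s hs
      rcases (hu s (hSP s hs)).lt_or_eq with h | h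
      · have ht : Tendsto (fun M : ℝ => M * ⟪u, s⟫ + ⟪v, s⟫) atTop atBot :=
          tendsto_atBot_add_const_right _ _ (tendsto_id.atTop_mul_const_of_neg h)
        exact ht.eventually_le_atBot 0
      · refine Eventually.of_forall fun M => ?_
        rw [h, mul_zero, zero_add]
        exact hv s ⟨hSP s hs, h⟩
    have h' := (Filter.eventually_all_finset S).2 this
    obtain ⟨N, hN⟩ := eventually_atTop.1 h'
    exact ⟨N, hN⟩
  obtain ⟨N, hN⟩ := hN
  have key : ∀ M, N ≤ M → IsNormal0 P (M • u + v) := by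
    intro M hM p hp
    rw [hS] at hp
    refine le_of_mem_convexHull (innerSL ℝ (M • u + v)).toLinearMap (fun s hs => ?_) hp
    simpa [inner_add_left, inner_smul_left] using hN M hM s hs
  refine (mem_facesO h0).2 ⟨(N + 1) • u + v, key _ (by linarith), ?_, hj⟩
  ext p
  constructor
  · rintro ⟨⟨hp, h1⟩, h2⟩
    exact ⟨hp, by rw [inner_add_left, inner_smul_left, h1, h2]; simp⟩
  · rintro ⟨hp, h1⟩
    have h2 := key N le_rfl p hp
    have h3 := hu p hp
    simp only [inner_add_left, inner_smul_left, conj_trivial] at h1 h2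
    have h4 : ⟪u, p⟫ = 0 := by linarith
    exact ⟨⟨hp, h4⟩, by rw [h4] at h1; linarith⟩

end FlagSum

section Diamond

variable {P : Set (Euc 3)} {w e m : Euc 3}

lemma inner_eq_zero_of_mem_edge (h0 : (0 : Euc 3) ∈ P) (hw1 : sdim (sec w P) = 1)
    (he : e ∈ sec w P) (he0 : e ≠ 0) (hme : ⟪m, e⟫ = 0) {p : Euc 3} (hp : p ∈ P)
    (hwp : ⟪w, p⟫ = 0) : ⟪m, p⟫ = 0 := by
  obtain ⟨c, rfl⟩ := exists_smul_eq_of_sdim_le_one (zero_mem_sec h0 w) hw1.le he he0 ⟨hp, hwp⟩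
  rw [inner_smul_right, hme, mul_zero]

/-- On each side of an edge through the origin there is a facet containing it. -/
lemma exists_facet_of_edge (hP : IsPolytope0 P) (h3 : sdim P = 3) (hw : IsNormal0 P w)
    (hw0 : w ≠ 0) (hw1 : sdim (sec w P) = 1) (he : e ∈ sec w P) (he0 : e ≠ 0)
    (hme : ⟪m, e⟫ = 0) :
    ∃ c : ℝ, IsNormal0 P (c • w + m) ∧ (∃ s ∈ sec (c • w + m) P, ⟪w, s⟫ < 0) ∧
      2 ≤ sdim (sec (c • w + m) P) := by
  classical
  obtain ⟨⟨S, hS⟩, h0⟩ := id hP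
  have hSP : ∀ s ∈ S, s ∈ P := fun s hs => hS ▸ subset_convexHull ℝ _ hs
  set T := S.filter fun s => ⟪w, s⟫ < 0 with hT
  have hTne : T.Nonempty := by
    by_contra! hTe
    have : ∀ p ∈ P, ⟪w, p⟫ = 0 := by
      intro p hp
      refine le_antisymm (hw p hp) ?_
      have hp' := hp
      rw [hS] at hp'
      have := le_of_mem_convexHull (c := 0) (innerSL ℝ (-w)).toLinearMap (fun s hs => ?_) hp'
      · simpa using this
      · have : s ∉ T := by simp [hTe]
        rw [hT, Finset.mem_filter] at this
        push Not at this
        simpa using this hs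
    have := sdim_lt_of_forall_inner h0 hw0 this
    omega
  obtain ⟨s, hs, hmax⟩ := T.exists_max_image (fun s => ⟪m, s⟫ / -⟪w, s⟫) hTne
  obtain ⟨hsS, hsw⟩ := Finset.mem_filter.1 hs
  set c := ⟪m, s⟫ / -⟪w, s⟫ with hc
  have hcs : c * ⟪w, s⟫ + ⟪m, s⟫ = 0 := by
    have : c * -⟪w, s⟫ = ⟪m, s⟫ := div_mul_cancel₀ _ (by linarith)
    linarith
  have hsF : s ∈ sec (c • w + m) P :=
    ⟨hSP s hsS, by rw [inner_add_left, inner_smul_left]; simpa using hcs⟩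
  refine ⟨c, ?_, ⟨s, hsF, hsw⟩, ?_⟩
  · intro p hp
    rw [hS] at hp
    refine le_of_mem_convexHull (innerSL ℝ (c • w + m)).toLinearMap (fun t ht => ?_) hp
    have : c * ⟪w, t⟫ + ⟪m, t⟫ ≤ 0 := by
      rcases (hw t (hSP t ht)).lt_or_eq with h | h
      · have h1 := hmax t (Finset.mem_filter.2 ⟨ht, h⟩)
        rw [div_le_iff₀ (by linarith)] at h1
        linarith
      · rw [h, inner_eq_zero_of_mem_edge h0 hw1 he he0 hme (hSP t ht) h]
        simp
    simpa [inner_add_left, inner_smul_left] using this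
  · refine two_le_sdim (zero_mem_sec h0 _) (a := e) (b := s) ?_ hsF
      ((LinearIndependent.pair_iff' he0).2 fun d hd => ?_)
    · exact ⟨he.1, by rw [inner_add_left, inner_smul_left, he.2, hme]; simp⟩
    · rw [← hd, inner_smul_right, he.2, mul_zero] at hsw
      exact lt_irrefl _ hsw

lemma facet_of_edge_unique (h0 : (0 : Euc 3) ∈ P) (hw : IsNormal0 P w)
    (hw1 : sdim (sec w P) = 1) {c d : ℝ} (hc : IsNormal0 P (c • w + m))
    (hd2 : 2 ≤ sdim (sec (d • w + m) P)) : d ≤ c := by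
  by_contra! hcd
  have hsub : sec (d • w + m) P ⊆ sec w P := by
    rintro p ⟨hp, hdp⟩
    refine ⟨hp, ?_⟩
    have h1 := hc p hp
    have h2 := hw p hp
    simp only [inner_add_left, inner_smul_left, conj_trivial] at h1 hdp
    nlinarith
  have := sdim_mono (zero_mem_sec h0 _) hsub
  omega

/-- An edge of a 3-polytope through the origin lies in exactly two facets. -/
lemma exists_two_facets_of_edge {E : Set (Euc 3)} (hP : IsPolytope0 P) (h3 : sdim P = 3)
    (hE : E ∈ facesO 1 P) :
    ∃ F₁ F₂, F₁ ≠ F₂ ∧ {F ∈ facesO 2 P | E ∈ facesO 1 F} = {F₁, F₂} := by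
  have h0 := hP.2
  obtain ⟨w, hw, rfl, hw1⟩ := (mem_facesO h0).1 hE
  obtain ⟨e, he, he0⟩ := exists_ne_zero_of_sdim_pos (zero_mem_sec h0 w) hw1.ge
  have hw0 : w ≠ 0 := by
    rintro rfl
    rw [sec_eq_self (by simp), h3] at hw1
    omega
  obtain ⟨m, hm, hmw, hme, hspan⟩ :=
    (linearIndependent_pair_of_inner_eq_zero hw0 he0 he.2).exists_unit_orthogonal
  have hme' : ⟪-m, e⟫ = 0 := by rw [inner_neg_left, hme, neg_zero]
  obtain ⟨c₁, hn₁, ⟨s, hs, hsw⟩, hd₁⟩ := exists_facet_of_edge hP h3 hw hw0 hw1 he he0 hme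
  obtain ⟨c₂, hn₂, -, hd₂⟩ := exists_facet_of_edge hP h3 hw hw0 hw1 he he0 hme'
  have hmem : ∀ m' : Euc 3, ‖m'‖ = 1 → ⟪m', w⟫ = 0 → ⟪m', e⟫ = 0 → ∀ c : ℝ,
      IsNormal0 P (c • w + m') → 2 ≤ sdim (sec (c • w + m') P) →
      sec (c • w + m') P ∈ {F ∈ facesO 2 P | sec w P ∈ facesO 1 F} := by
    intro m' hm' hmw' hme' c hn hd
    have hu0 : c • w + m' ≠ 0 := by
      intro h
      have : ⟪m', c • w + m'⟫ = 1 := by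
        rw [inner_add_right, inner_smul_right, hmw', real_inner_self_eq_norm_sq, hm']
        ring
      rw [h, inner_zero_right] at this
      exact zero_ne_one this
    have hlt := sdim_lt_of_forall_inner (zero_mem_sec h0 _) hu0 fun p (hp : p ∈ sec _ P) => hp.2
    refine ⟨(mem_facesO h0).2 ⟨_, hn, rfl, by omega⟩, (mem_facesO (zero_mem_sec h0 _)).2
      ⟨w, fun p hp => hw p hp.1, ?_, hw1⟩⟩
    ext p
    constructor
    · rintro ⟨hp, hwp⟩
      refine ⟨⟨hp, ?_⟩, hwp⟩
      rw [inner_add_left, inner_smul_left, hwp,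
        inner_eq_zero_of_mem_edge h0 hw1 he he0 hme' hp hwp]
      simp
    · rintro ⟨⟨hp, -⟩, hwp⟩
      exact ⟨hp, hwp⟩
  have hm₁ := hmem m hm hmw hme c₁ hn₁ hd₁
  have hm₂ := hmem (-m) (by rw [norm_neg, hm]) (by rw [inner_neg_left, hmw, neg_zero]) hme'
    c₂ hn₂ hd₂
  have hu1 : c₁ • w + m ≠ 0 := by
    intro h
    have h2 := (mem_facesO h0).1 hm₁.1
    rw [h, sec_eq_self (by simp)] at h2
    obtain ⟨-, -, -, h2⟩ := h2
    omega
  refine ⟨_, _, ?_, Set.Subset.antisymm ?_ (Set.insert_subset_iff.2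
    ⟨hm₁, Set.singleton_subset_iff.2 hm₂⟩)⟩
  · intro heq
    have hs' : s ∈ sec (c₂ • w + -m) P := heq ▸ hs
    have h1 := hs.2
    have h2 := hs'.2
    simp only [inner_add_left, inner_smul_left, conj_trivial, inner_neg_left] at h1 h2
    have hc : c₂ = -c₁ := by
      have : (c₂ + c₁) * ⟪w, s⟫ = 0 := by linarith
      linarith [(mul_eq_zero.1 this).resolve_right hsw.ne]
    have : ∀ p ∈ P, ⟪c₁ • w + m, p⟫ = 0 := by
      intro p hp
      refine le_antisymm (hn₁ p hp) ?_
      have := hn₂ p hp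
      rw [hc] at this
      simp only [inner_add_left, inner_smul_left, conj_trivial, inner_neg_left] at this ⊢
      linarith
    have := sdim_lt_of_forall_inner h0 hu1 this
    omega
  · rintro F ⟨hF, hEF⟩
    obtain ⟨u, hu, rfl, hu2⟩ := (mem_facesO h0).1 hF
    have hue : ⟪u, e⟫ = 0 := (hEF.1.subset he).2
    obtain ⟨d, hd⟩ := hspan (u - (⟪w, u⟫ / ⟪w, w⟫) • w)
      (by
        have : ⟪w, w⟫ ≠ 0 := inner_self_ne_zero.2 hw0
        rw [inner_sub_left, inner_smul_left, conj_trivial, div_mul_cancel₀ _ this, real_inner_comm,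
          sub_self])
      (by rw [inner_sub_left, inner_smul_left, hue, he.2]; simp)
    set c := ⟪w, u⟫ / ⟪w, w⟫
    have hud : u = c • w + d • m := by rw [← hd]; abel
    rcases lt_trichotomy d 0 with hd0 | rfl | hd0
    · right
      have h1 : (-d)⁻¹ • u = (c / -d) • w + -m := by
        have h2 : (-d)⁻¹ * d = -1 := by
          rw [inv_neg, neg_mul, inv_mul_cancel₀ hd0.ne]
        rw [hud, smul_add, smul_smul, smul_smul, div_eq_inv_mul, h2, neg_one_smul]
      have hn := hu.smul (inv_nonneg.2 (neg_pos.2 hd0).le)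
      have hsec := sec_smul (inv_ne_zero (neg_pos.2 hd0).ne') u P
      rw [h1] at hn hsec
      have hc : c / -d = c₂ := le_antisymm
        (facet_of_edge_unique h0 hw hw1 hn₂ (hsec ▸ hu2.ge))
        (facet_of_edge_unique h0 hw hw1 hn hd₂)
      rw [Set.mem_singleton_iff, ← hsec, hc]
    · exfalso
      rw [zero_smul, add_zero] at hud
      rcases eq_or_ne c 0 with hc | hc
      · rw [hud, hc, zero_smul, sec_eq_self (by simp)] at hu2
        omega
      · rw [hud, sec_smul hc] at hu2
        omega
    · left
      have h1 : d⁻¹ • u = (c / d) • w + m := by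
        rw [hud, smul_add, smul_smul, smul_smul, div_eq_inv_mul, inv_mul_cancel₀ hd0.ne', one_smul]
      have hn := hu.smul (inv_nonneg.2 hd0.le)
      have hsec := sec_smul (inv_ne_zero hd0.ne') u P
      rw [h1] at hn hsec
      have hc : c / d = c₁ := le_antisymm
        (facet_of_edge_unique h0 hw hw1 hn₁ (hsec ▸ hu2.ge))
        (facet_of_edge_unique h0 hw hw1 hn hd₁)
      rw [← hsec, hc]

lemma sum_facets_edges (hP : IsPolytope0 P) (h3 : sdim P = 3) (f : Set (Euc 3) → ℝ) :
    ∑ᶠ F ∈ facesO 2 P, ∑ᶠ E ∈ facesO 1 F, f E = 2 * ∑ᶠ E ∈ facesO 1 P, f E := by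
  classical
  have h1 : ∀ F ∈ facesO 2 P, ∑ᶠ E ∈ facesO 1 F, f E =
      ∑ᶠ E ∈ facesO 1 P, if E ∈ facesO 1 F then f E else 0 := by
    intro F hF
    rw [← finsum_mem_inter_support_eq' (fun E => if E ∈ facesO 1 F then f E else 0) (facesO 1 F)]
    · exact finsum_mem_congr rfl fun E hE => (if_pos hE).symm
    · intro E hE
      have hEF : E ∈ facesO 1 F := by
        by_contra h
        exact hE (if_neg h)
      exact ⟨fun _ => facesO_trans hP hF hEF, fun _ => hEF⟩
  rw [finsum_mem_congr rfl h1, finsum_mem_comm _ (hP.finite_facesO 2) (hP.finite_facesO 1),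
    mul_finsum_mem]
  refine finsum_mem_congr rfl fun E hE => ?_
  obtain ⟨F₁, F₂, hne, hF⟩ := exists_two_facets_of_edge hP h3 hE
  rw [finsum_mem_inter_support_eq' _ (facesO 2 P) {F ∈ facesO 2 P | E ∈ facesO 1 F}, hF,
    finsum_mem_pair hne]
  · have hm₁ : F₁ ∈ {F ∈ facesO 2 P | E ∈ facesO 1 F} := hF ▸ Set.mem_insert _ _
    have hm₂ : F₂ ∈ {F ∈ facesO 2 P | E ∈ facesO 1 F} := hF ▸ Set.mem_insert_of_mem _ rfl
    rw [if_pos hm₁.2, if_pos hm₂.2]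
    ring
  · intro F hF
    have hEF : E ∈ facesO 1 F := by
      by_contra h
      exact hF (if_neg h)
    exact ⟨fun h => ⟨h, hEF⟩, fun h => h.1⟩

lemma flagSum_of_sdim_eq_three (hP : IsPolytope0 P) (h3 : sdim P = 3) (x : Euc 3) :
    ({u : Euc 3 | ‖u‖ = 1} ∩ Function.support fun u => faceVal u (flagVal x u) P).Finite ∧
      flagSum x P = 2 * (∑ᶠ F ∈ facesO 2 P, supp F x - ∑ᶠ E ∈ facesO 1 P, supp E x) := by
  have h0 := hP.2
  have hbij := bijOn_sec_facesO_two h0 h3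
  have hsupp : ∀ u ∈ Function.support (fun u => faceVal u (flagVal x u) P),
      u ∈ {u : Euc 3 | ‖u‖ = 1} ↔
        u ∈ {u : Euc 3 | ‖u‖ = 1 ∧ IsNormal0 P u ∧ sdim (sec u P) = 2} := by
    intro u hu
    refine ⟨fun hu1 => ?_, fun h => h.1⟩
    have hu' : faceVal u (flagVal x u) P ≠ 0 := hu
    rw [faceVal] at hu'
    split_ifs at hu' with hn
    · refine ⟨hu1, hn, le_antisymm (sdim_le_two hu1 (fun p hp => hp.2) (zero_mem_sec h0 u)) ?_⟩
      by_contra! h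
      exact hu' (flagVal_aux_line hu1 (fun p hp => hp.2) (zero_mem_sec h0 u) (by omega) x).2
    · exact absurd rfl hu'
  constructor
  · exact ((hbij.finite_iff_finite).2 (hP.finite_facesO 2)).subset
      fun v hv => (hsupp v hv.2).1 hv.1
  · rw [flagSum, finsum_mem_inter_support_eq' _ _ _ hsupp,
      finsum_mem_eq_of_bijOn (g := fun F => 2 * supp F x - ∑ᶠ E ∈ facesO 1 F, supp E x) _ hbij,
      finsum_mem_sub_distrib _ _ (hP.finite_facesO 2), sum_facets_edges hP h3 fun E => supp E x,
      ← mul_finsum_mem]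
    · ring
    · intro u hu
      rw [faceVal, if_pos hu.2.1,
        (flagVal_aux_plane hu.1 (fun p hp => hp.2) (hP.sec u) hu.2.2 x).2]

lemma isVal_flagSum (x : Euc 3) : IsVal (flagSum x) := by
  refine isVal_finsum_mem (fun u hu => isVal_faceVal_flagVal hu x) fun P hP => ?_
  have h := sdim_le P
  rcases Nat.lt_or_ge (sdim P) 2 with h1 | h1
  · exact (flagSum_of_sdim_le_one hP.2 (by omega) x).1
  rcases Nat.lt_or_ge (sdim P) 3 with h2 | h2
  · exact (flagSum_of_sdim_eq_two hP (by omega) x).1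
  · exact (flagSum_of_sdim_eq_three hP (by omega) x).1

lemma supp_eq_zero_of_sdim_eq_zero {P : Set (Euc 3)} (h0 : (0 : Euc 3) ∈ P) (h : sdim P = 0)
    (x : Euc 3) : supp P x = 0 := by
  refine supp_eq_zero_of_forall_inner ⟨0, h0⟩ fun y hy => ?_
  by_contra hne
  have := one_le_sdim h0 hy (by rintro rfl; simp at hne)
  omega

lemma hD_eq (a₁ a₂ b₁ b₂ : ℝ) (hP : IsPolytope0 P) (x : Euc 3) :
    hD a₁ a₂ b₁ b₂ P x = a₁ * supp P x + (a₂ - a₁) / 2 * flagSum x P +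
      (b₁ * supp P (-x) + (b₂ - b₁) / 2 * flagSum (-x) P) := by
  have h := sdim_le P
  rw [hD]
  split_ifs with h3 h2 h1
  · rw [(flagSum_of_sdim_eq_three hP h3 x).2, (flagSum_of_sdim_eq_three hP h3 (-x)).2]
    ring
  · rw [(flagSum_of_sdim_eq_two hP h2 x).2, (flagSum_of_sdim_eq_two hP h2 (-x)).2]
    ring
  · rw [(flagSum_of_sdim_le_one hP.2 h1.le x).2, (flagSum_of_sdim_le_one hP.2 h1.le (-x)).2]
    ring
  · rw [(flagSum_of_sdim_le_one hP.2 (by omega) x).2,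
      (flagSum_of_sdim_le_one hP.2 (by omega) (-x)).2,
      supp_eq_zero_of_sdim_eq_zero hP.2 (by omega), supp_eq_zero_of_sdim_eq_zero hP.2 (by omega)]
    ring

lemma isVal_hD (a₁ a₂ b₁ b₂ : ℝ) (x : Euc 3) : IsVal fun P => hD a₁ a₂ b₁ b₂ P x := by
  refine IsVal.congr ?_ fun P hP => (hD_eq a₁ a₂ b₁ b₂ hP x).symm
  exact (((isVal_supp x).const_mul a₁).add ((isVal_flagSum x).const_mul _)).add
    (((isVal_supp (-x)).const_mul b₁).add ((isVal_flagSum (-x)).const_mul _))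

end Diamond

section LinearAction

variable {n : ℕ} {P : Set (Euc n)} {x y : Euc n}

lemma inner_matVec (A : Matrix (Fin n) (Fin n) ℝ) (x y : Euc n) :
    ⟪x, matVec A y⟫ = ⟪matVec Aᵀ x, y⟫ := by
  have h := LinearMap.adjoint_inner_left (Matrix.toEuclideanLin A) y x
  rw [← Matrix.toEuclideanLin_conjTranspose_eq_adjoint, conjTranspose_eq_transpose_of_trivial] at h
  exact h.symm

lemma matAct_convexHull (A : Matrix (Fin n) (Fin n) ℝ) (S : Set (Euc n)) :
    matAct A (convexHull ℝ S) = convexHull ℝ (matVec A '' S) :=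
  (Matrix.toEuclideanLin A).image_convexHull S

lemma IsPolytope0.matAct (hP : IsPolytope0 P) (A : Matrix (Fin n) (Fin n) ℝ) :
    IsPolytope0 (matAct A P) := by
  classical
  obtain ⟨⟨S, rfl⟩, h0⟩ := hP
  refine ⟨⟨S.image (matVec A), ?_⟩, ⟨0, h0, map_zero _⟩⟩
  rw [matAct_convexHull, Finset.coe_image]

lemma matAct_spx {ι : Type*} (A : Matrix (Fin n) (Fin n) ℝ) (I : Finset ι) (v : ι → Euc n) :
    matAct A (spx I v) = spx I fun i => matVec A (v i) := by
  rw [spx, matAct_convexHull, Set.image_insert_eq, Set.image_image, spx]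
  simp [matVec]

lemma supp_matAct (A : Matrix (Fin n) (Fin n) ℝ) (P : Set (Euc n)) (x : Euc n) :
    supp (matAct A P) x = supp P (matVec Aᵀ x) := by
  rw [supp, supp, matAct, Set.image_image]
  congr 2
  ext y
  exact inner_matVec A x y

/-- Covariance of a family of functions under the special linear group. -/
def IsCov {n : ℕ} (z : Set (Euc n) → Euc n → ℝ) : Prop :=
  ∀ (φ : Matrix.SpecialLinearGroup (Fin n) ℝ) (P : Set (Euc n)), IsPolytope0 P → ∀ x,
    z (matAct (φ : Matrix (Fin n) (Fin n) ℝ) P) x =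
      z P (matVec (φ : Matrix (Fin n) (Fin n) ℝ)ᵀ x)

/-- The matrix with given columns. -/
def colMat {n : ℕ} (v : Fin n → Euc n) : Matrix (Fin n) (Fin n) ℝ := Matrix.of fun i j => v j i

lemma matVec_colMat (v : Fin n → Euc n) (x : Euc n) : matVec (colMat v) x = ∑ i, x i • v i := by
  ext j
  simp [matVec, colMat, Matrix.toEuclideanLin, Matrix.toLpLin_apply, Matrix.mulVec, dotProduct,
    mul_comm]

/-- The standard basis vectors. -/
def stdVec {n : ℕ} (i : Fin n) : Euc n := EuclideanSpace.single i 1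

lemma matVec_colMat_stdVec (v : Fin n → Euc n) (i : Fin n) :
    matVec (colMat v) (stdVec i) = v i := by
  rw [matVec_colMat, Finset.sum_eq_single i] <;> simp +contextual [stdVec]

lemma matVec_colMat_transpose (v : Fin n → Euc n) (x : Euc n) (i : Fin n) :
    matVec (colMat v)ᵀ x i = ⟪x, v i⟫ := by
  rw [← matVec_colMat_stdVec v i, inner_matVec]
  simp [stdVec, EuclideanSpace.inner_single_right]

lemma linearIndependent_of_det_ne_zero {v : Fin n → Euc n} (h : (colMat v).det ≠ 0) :
    LinearIndependent ℝ v := by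
  rw [Fintype.linearIndependent_iff]
  intro g hg
  by_contra! hne
  have : ∃ w ≠ 0, colMat v *ᵥ w = 0 := by
    refine ⟨g, fun h => by obtain ⟨i, hi⟩ := hne; exact hi (congrFun h i), ?_⟩
    ext j
    have := congrArg (fun y : Euc n => y j) hg
    simpa [colMat, Matrix.mulVec, dotProduct, mul_comm] using this
  exact h (Matrix.exists_mulVec_eq_zero_iff.1 this)

lemma det_colMat_ne_zero {v : Fin n → Euc n} (h : LinearIndependent ℝ v) :
    (colMat v).det ≠ 0 := by
  intro hd
  obtain ⟨w, hw, hw0⟩ := Matrix.exists_mulVec_eq_zero_iff.2 hd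
  refine hw (funext fun i => Fintype.linearIndependent_iff.1 h w ?_ i)
  ext j
  have := congrFun hw0 j
  simpa [colMat, Matrix.mulVec, dotProduct, mul_comm] using this

end LinearAction

lemma colMat_det (a b c : Euc 3) : (colMat ![a, b, c]).det =
    a 0 * b 1 * c 2 - a 0 * c 1 * b 2 - b 0 * a 1 * c 2 + b 0 * c 1 * a 2 + c 0 * a 1 * b 2
      - c 0 * b 1 * a 2 := by
  simp [colMat, Matrix.det_fin_three]

lemma colMat_det_smul_third (a b c : Euc 3) (t : ℝ) :
    (colMat ![a, b, t • c]).det = t * (colMat ![a, b, c]).det := by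
  simp only [colMat_det, PiLp.smul_apply, smul_eq_mul]
  ring

lemma exists_third_column {a b x : Euc 3} (h : LinearIndependent ℝ ![a, b])
    (hx : ⟪x, a⟫ ≠ 0 ∨ ⟪x, b⟫ ≠ 0) : ∃ c, ⟪x, c⟫ = 0 ∧ (colMat ![a, b, c]).det = 1 := by
  obtain ⟨m, hm, hma, hmb, -⟩ := h.exists_unit_orthogonal
  obtain ⟨d, hd, hmd⟩ : ∃ d, ⟪x, d⟫ ≠ 0 ∧ ⟪m, d⟫ = 0 := by
    rcases hx with hx | hx
    exacts [⟨a, hx, hma⟩, ⟨b, hx, hmb⟩]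
  set c := m - (⟪x, m⟫ / ⟪x, d⟫) • d with hc
  have hxc : ⟪x, c⟫ = 0 := by
    rw [hc, inner_sub_right, inner_smul_right, div_mul_cancel₀ _ hd, sub_self]
  have hmc : ⟪m, c⟫ = 1 := by
    rw [hc, inner_sub_right, inner_smul_right, hmd, real_inner_self_eq_norm_sq, hm]
    ring
  have hdet : (colMat ![a, b, c]).det ≠ 0 := by
    refine det_colMat_ne_zero (Fintype.linearIndependent_iff.2 fun g hg => ?_)
    simp only [Fin.sum_univ_three, Matrix.cons_val_zero, Matrix.cons_val_one,
      Matrix.cons_val_two, Matrix.tail_cons, Matrix.head_cons] at hg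
    have h2 : g 2 = 0 := by
      have := congrArg (fun y => ⟪m, y⟫) hg
      simpa [inner_add_right, inner_smul_right, hma, hmb, hmc] using this
    rw [h2, zero_smul, add_zero] at hg
    have h01 := LinearIndependent.pair_iff.1 h _ _ hg
    intro i
    fin_cases i
    exacts [h01.1, h01.2, h2]
  refine ⟨(colMat ![a, b, c]).det⁻¹ • c, by rw [inner_smul_right, hxc, mul_zero], ?_⟩
  rw [colMat_det_smul_third, inv_mul_cancel₀ hdet]

lemma exists_ne_zero_inner_eq_zero (x : Euc 3) : ∃ b : Euc 3, b ≠ 0 ∧ ⟪x, b⟫ = 0 := by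
  by_cases h : x 0 = 0
  · refine ⟨stdVec 0, ?_, ?_⟩
    · simp [stdVec]
    · simpa [stdVec, EuclideanSpace.inner_single_right] using h
  · refine ⟨!₂[x 1, -x 0, 0], fun hb => h ?_, ?_⟩
    · simpa using congrArg (fun y : Euc 3 => y 1) hb
    · simp [PiLp.inner_apply, Fin.sum_univ_three]
      ring

lemma exists_two_columns {a x : Euc 3} (h : ⟪x, a⟫ ≠ 0) :
    ∃ b c, ⟪x, b⟫ = 0 ∧ ⟪x, c⟫ = 0 ∧ (colMat ![a, b, c]).det = 1 := by
  obtain ⟨b, hb0, hb⟩ := exists_ne_zero_inner_eq_zero x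
  have hab : LinearIndependent ℝ ![b, a] := by
    refine (LinearIndependent.pair_iff' hb0).2 fun t ht => h ?_
    rw [← ht, inner_smul_right, hb, mul_zero]
  obtain ⟨c, hc, hdet⟩ := exists_third_column hab (.inr h)
  refine ⟨-b, c, by rw [inner_neg_right, hb, neg_zero], hc, ?_⟩
  rw [colMat_det] at hdet ⊢
  rw [← hdet]
  simp only [PiLp.neg_apply]
  ring

section Equivariance

variable {n : ℕ} {P : Set (Euc n)}

lemma isNormal0_matAct {A : Matrix (Fin n) (Fin n) ℝ} {u : Euc n} :
    IsNormal0 (matAct A P) u ↔ IsNormal0 P (matVec Aᵀ u) := by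
  simp only [IsNormal0, matAct, Set.forall_mem_image, ← inner_matVec]
  rfl

lemma sec_matAct (A : Matrix (Fin n) (Fin n) ℝ) (u : Euc n) (P : Set (Euc n)) :
    sec u (matAct A P) = matAct A (sec (matVec Aᵀ u) P) := by
  ext y
  constructor
  · rintro ⟨⟨p, hp, rfl⟩, h⟩
    exact ⟨p, ⟨hp, (inner_matVec A u p).symm.trans h⟩, rfl⟩
  · rintro ⟨p, ⟨hp, h⟩, rfl⟩
    exact ⟨⟨p, hp, rfl⟩, (inner_matVec A u p).trans h⟩

lemma matVec_matVec (A B : Matrix (Fin n) (Fin n) ℝ) (x : Euc n) :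
    matVec A (matVec B x) = matVec (A * B) x := by
  simp [matVec, Matrix.toEuclideanLin]

lemma matVec_one (x : Euc n) : matVec 1 x = x := by
  simp [matVec, Matrix.toEuclideanLin]

lemma matVec_injective {A : Matrix (Fin n) (Fin n) ℝ} (hA : A.det ≠ 0) :
    Function.Injective (matVec A) := by
  intro x y h
  have := congrArg (matVec A⁻¹) h
  simpa only [matVec_matVec, Matrix.nonsing_inv_mul A hA.isUnit, matVec_one] using this

lemma sdim_matAct {A : Matrix (Fin n) (Fin n) ℝ} (hA : A.det ≠ 0) (h0 : (0 : Euc n) ∈ P) :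
    sdim (matAct A P) = sdim P := by
  rw [sdim_eq_finrank_span h0, sdim_eq_finrank_span (P := matAct A P) ⟨0, h0, map_zero _⟩, matAct,
    Submodule.span_image]
  exact (LinearEquiv.finrank_eq (Submodule.equivMapOfInjective (Matrix.toEuclideanLin A)
    (matVec_injective hA) _)).symm

lemma facesO_matAct {A : Matrix (Fin n) (Fin n) ℝ} (hA : A.det ≠ 0) (h0 : (0 : Euc n) ∈ P)
    (j : ℕ) : facesO j (matAct A P) = matAct A '' facesO j P := by
  ext F
  rw [mem_facesO (P := matAct A P) ⟨0, h0, map_zero _⟩]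
  constructor
  · rintro ⟨u, hu, rfl, hj⟩
    rw [sec_matAct, sdim_matAct hA (zero_mem_sec h0 _)] at hj
    exact ⟨_, (mem_facesO h0).2 ⟨_, isNormal0_matAct.1 hu, rfl, hj⟩, (sec_matAct A u P).symm⟩
  · rintro ⟨G, hG, rfl⟩
    obtain ⟨u, hu, rfl, hj⟩ := (mem_facesO h0).1 hG
    have hAu : matVec Aᵀ (matVec (A⁻¹)ᵀ u) = u := by
      rw [matVec_matVec, ← Matrix.transpose_mul, Matrix.nonsing_inv_mul A hA.isUnit,
        Matrix.transpose_one, matVec_one]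
    refine ⟨matVec (A⁻¹)ᵀ u, isNormal0_matAct.2 (by rwa [hAu]), ?_, ?_⟩
    · rw [sec_matAct, hAu]
    · rw [sdim_matAct hA (zero_mem_sec h0 _), hj]

lemma finsum_facesO_matAct {A : Matrix (Fin n) (Fin n) ℝ} (hA : A.det ≠ 0) (h0 : (0 : Euc n) ∈ P)
    (j : ℕ) (x : Euc n) :
    ∑ᶠ F ∈ facesO j (matAct A P), supp F x = ∑ᶠ F ∈ facesO j P, supp F (matVec Aᵀ x) := by
  rw [facesO_matAct hA h0, finsum_mem_image]
  · simp only [supp_matAct]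
  · exact (Set.image_injective.2 (matVec_injective hA)).injOn

lemma matVec_neg (A : Matrix (Fin n) (Fin n) ℝ) (x : Euc n) : matVec A (-x) = -matVec A x :=
  map_neg _ x

lemma isCov_hD (a₁ a₂ b₁ b₂ : ℝ) : IsCov (hD a₁ a₂ b₁ b₂) := by
  intro φ P hP x
  have hφ : (φ : Matrix (Fin 3) (Fin 3) ℝ).det ≠ 0 := by simp
  simp only [hD, sdim_matAct hφ hP.2, finsum_facesO_matAct hφ hP.2, supp_matAct, matVec_neg]

end Equivariance

section SimplexValues

variable {ι : Type*} {n : ℕ} {I : Finset ι} {v : ι → Euc n}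

lemma sdim_spx (hv : LinearIndepOn ℝ v (I : Set ι)) : sdim (spx I v) = I.card := by
  rw [sdim_eq_finrank_span (zero_mem_spx I v)]
  have h : Submodule.span ℝ (spx I v) = Submodule.span ℝ (v '' I) := by
    refine le_antisymm (Submodule.span_le.2 (convexHull_min ?_ (Submodule.convex _)))
      (Submodule.span_mono ?_)
    · rintro y (rfl | hy)
      exacts [zero_mem _, Submodule.subset_span hy]
    · rintro _ ⟨i, hi, rfl⟩
      exact mem_spx_self hi
  rw [h, Set.image_eq_range]
  exact (finrank_span_eq_card (b := fun i : (I : Set ι) => v i) hv).trans (by simp)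

lemma supp_spx_empty (x : Euc n) : supp (spx (∅ : Finset ι) v) x = 0 := by
  simp [spx, supp_singleton_zero]

lemma supp_spx_insert [DecidableEq ι] (i : ι) (x : Euc n) :
    supp (spx (insert i I) v) x = max ⟪x, v i⟫ (supp (spx I v) x) := by
  have hc := (isPolytope0_spx (insert i I) v).isCompact
  have hI := (isPolytope0_spx I v).isCompact
  refine le_antisymm (supp_le ⟨0, zero_mem_spx _ _⟩ fun y hy => ?_) (max_le ?_ ?_)
  · refine le_of_mem_convexHull (innerSL ℝ x).toLinearMap (fun s hs => ?_) hy
    have : s = v i ∨ s ∈ spx I v := by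
      simp only [Finset.coe_insert, Set.image_insert_eq, Set.mem_insert_iff] at hs
      rcases hs with rfl | rfl | hs
      exacts [.inr (zero_mem_spx _ _), .inl rfl, .inr (subset_convexHull ℝ _ (.inr hs))]
    rcases this with rfl | h
    exacts [le_max_left _ _, (inner_le_supp hI h x).trans (le_max_right _ _)]
  · exact inner_le_supp hc (mem_spx_self (by simp)) x
  · exact supp_mono hc ⟨0, zero_mem_spx _ _⟩
      (spx_subset (convex_spx _ _) (zero_mem_spx _ _) fun j hj => mem_spx_self (by simp [hj])) x

lemma sec_spx {u : Euc n} (hu : IsNormal0 (spx I v) u) :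
    sec u (spx I v) = spx (I.filter fun i => ⟪u, v i⟫ = 0) v := by
  have h := spx_inter_halfspace_of_nonneg (I := I) (v := v) (innerSL ℝ (-u)) fun i hi => by
    simpa using hu _ (mem_spx_self hi)
  simp only [innerSL_apply_apply, inner_neg_left, neg_eq_zero, neg_nonpos] at h
  rw [← h]
  ext p
  simp only [sec, Set.mem_ofPred_eq, Set.mem_inter_iff]
  refine and_congr_right fun hp => ?_
  exact ⟨fun h => h.ge, fun h => le_antisymm (hu p hp) h⟩

lemma exists_inner_eq_of_linearIndepOn (hv : LinearIndepOn ℝ v (I : Set ι)) (c : ι → ℝ) :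
    ∃ u : Euc n, ∀ i ∈ I, ⟪u, v i⟫ = c i := by
  obtain ⟨f, hf⟩ := LinearMap.exists_extend
    (p := Submodule.span ℝ (Set.range fun i : (I : Set ι) => v i))
    ((Module.Basis.span hv).constr ℝ fun i => c i)
  refine ⟨(InnerProductSpace.toDual ℝ (Euc n)).symm (LinearMap.toContinuousLinearMap f),
    fun i hi => ?_⟩
  rw [InnerProductSpace.toDual_symm_apply]
  have h1 := LinearMap.congr_fun hf (Module.Basis.span hv ⟨i, hi⟩)
  rw [Module.Basis.constr_basis] at h1
  have h2 := Module.Basis.coe_span_apply hv ⟨i, hi⟩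
  rw [LinearMap.comp_apply, Submodule.subtype_apply, h2] at h1
  exact h1

lemma linearIndepOn_subset {J : Finset ι} (hv : LinearIndepOn ℝ v (I : Set ι)) (hJ : J ⊆ I) :
    LinearIndepOn ℝ v (J : Set ι) := hv.mono (Finset.coe_subset.2 hJ)

lemma facesO_spx (hv : LinearIndepOn ℝ v (I : Set ι)) (j : ℕ) :
    facesO j (spx I v) = (fun J => spx J v) '' (I.powersetCard j : Set (Finset ι)) := by
  classical
  ext F
  rw [mem_facesO (zero_mem_spx I v)]
  constructor
  · rintro ⟨u, hu, rfl, hj⟩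
    rw [sec_spx hu, sdim_spx (linearIndepOn_subset hv (Finset.filter_subset _ _))] at hj
    exact ⟨_, Finset.mem_coe.2 (Finset.mem_powersetCard.2 ⟨Finset.filter_subset _ _, hj⟩),
      (sec_spx hu).symm⟩
  · rintro ⟨J, hJ, rfl⟩
    obtain ⟨hJI, hJ⟩ := Finset.mem_powersetCard.1 (Finset.mem_coe.1 hJ)
    obtain ⟨u, hu⟩ := exists_inner_eq_of_linearIndepOn hv fun i => if i ∈ J then 0 else -1
    have hn : IsNormal0 (spx I v) u := fun p hp => by
      refine le_of_mem_convexHull (innerSL ℝ u).toLinearMap (fun s hs => ?_) hp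
      rcases hs with rfl | ⟨i, hi, rfl⟩
      · simp
      · have := hu i hi
        simp only [ContinuousLinearMap.coe_coe, innerSL_apply_apply, this]
        split_ifs <;> norm_num
    refine ⟨u, hn, ?_, by rw [sdim_spx (linearIndepOn_subset hv hJI), hJ]⟩
    rw [sec_spx hn]
    congr 1
    ext i
    simp only [Finset.mem_filter]
    constructor
    · exact fun hi => ⟨hJI hi, by rw [hu i (hJI hi), if_pos hi]⟩
    · rintro ⟨hi, h⟩
      by_contra hiJ
      rw [hu i hi, if_neg hiJ] at h
      norm_num at h

lemma spx_injOn (hv : LinearIndepOn ℝ v (I : Set ι)) :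
    Set.InjOn (fun J => spx J v) (I.powerset : Set (Finset ι)) := by
  classical
  have key : ∀ J ⊆ I, ∀ J' ⊆ I, spx J v ⊆ spx J' v → J ⊆ J' := by
    intro J hJ J' hJ' h i hi
    by_contra hiJ
    obtain ⟨u, hu⟩ := exists_inner_eq_of_linearIndepOn hv fun k => if k ∈ J' then 0 else 1
    have h1 : ⟪u, v i⟫ ≤ 0 := by
      refine le_of_mem_convexHull (innerSL ℝ u).toLinearMap (fun s hs => ?_)
        (h (mem_spx_self hi))
      rcases hs with rfl | ⟨k, hk, rfl⟩
      · simp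
      · simp [hu k (hJ' hk), Finset.mem_coe.1 hk]
    rw [hu i (hJ hi), if_neg hiJ] at h1
    norm_num at h1
  intro J hJ J' hJ' h
  simp only [Finset.coe_powerset, Set.mem_preimage, Set.mem_powerset_iff, Finset.coe_subset]
    at hJ hJ'
  exact (key J hJ J' hJ' (Eq.subset h)).antisymm (key J' hJ' J hJ (Eq.subset h.symm))

lemma finsum_facesO_spx (hv : LinearIndepOn ℝ v (I : Set ι)) (j : ℕ) (x : Euc n) :
    ∑ᶠ F ∈ facesO j (spx I v), supp F x = ∑ J ∈ I.powersetCard j, supp (spx J v) x := by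
  rw [facesO_spx hv, finsum_mem_image, finsum_mem_coe_finset]
  refine (spx_injOn hv).mono ?_
  intro J hJ
  exact Finset.mem_coe.2 (Finset.mem_powerset.2 (Finset.mem_powersetCard.1 hJ).1)

end SimplexValues

/-- The segment with endpoints `0` and `a`. -/
def seg {n : ℕ} (a : Euc n) : Set (Euc n) := spx Finset.univ ![a]

/-- The triangle with vertices `0`, `a` and `b`. -/
def tri {n : ℕ} (a b : Euc n) : Set (Euc n) := spx Finset.univ ![a, b]

/-- The tetrahedron with vertices `0`, `a`, `b` and `c`. -/
def tet {n : ℕ} (a b c : Euc n) : Set (Euc n) := spx Finset.univ ![a, b, c]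

section Simplices

variable {n : ℕ} {a b c : Euc n}

lemma isPolytope0_seg (a : Euc n) : IsPolytope0 (seg a) := isPolytope0_spx _ _

lemma isPolytope0_tri (a b : Euc n) : IsPolytope0 (tri a b) := isPolytope0_spx _ _

lemma isPolytope0_tet (a b c : Euc n) : IsPolytope0 (tet a b c) := isPolytope0_spx _ _

lemma isPolytope0_zero : IsPolytope0 ({0} : Set (Euc n)) := by
  simpa [spx] using isPolytope0_spx (∅ : Finset (Fin 1)) (fun _ => (0 : Euc n))

lemma spx_eq_of_image_eq {ι κ : Type*} {I : Finset ι} {J : Finset κ} {v : ι → Euc n}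
    {w : κ → Euc n} (h : v '' I = w '' J) : spx I v = spx J w := by
  rw [spx, h, spx]

lemma tri_comm (a b : Euc n) : tri a b = tri b a :=
  spx_eq_of_image_eq (by simp [Matrix.range_cons, Set.pair_comm])

lemma tet_rotate (a b c : Euc n) : tet a b c = tet b c a :=
  spx_eq_of_image_eq (by
    simp only [Finset.coe_univ, Set.image_univ, Matrix.range_cons, Matrix.range_empty]
    grind)

lemma tet_swap (a b c : Euc n) : tet a b c = tet b a c :=
  spx_eq_of_image_eq (by
    simp only [Finset.coe_univ, Set.image_univ, Matrix.range_cons, Matrix.range_empty]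
    grind)

lemma matAct_seg (A : Matrix (Fin n) (Fin n) ℝ) (a : Euc n) :
    matAct A (seg a) = seg (matVec A a) := by
  rw [seg, matAct_spx]
  exact spx_congr fun i _ => by fin_cases i; rfl

lemma matAct_tri (A : Matrix (Fin n) (Fin n) ℝ) (a b : Euc n) :
    matAct A (tri a b) = tri (matVec A a) (matVec A b) := by
  rw [tri, matAct_spx]
  exact spx_congr fun i _ => by fin_cases i <;> rfl

lemma matAct_tet (A : Matrix (Fin n) (Fin n) ℝ) (a b c : Euc n) :
    matAct A (tet a b c) = tet (matVec A a) (matVec A b) (matVec A c) := by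
  rw [tet, matAct_spx]
  exact spx_congr fun i _ => by fin_cases i <;> rfl

lemma LinearIndependent.linearIndepOn_coe_univ {ι : Type*} [Fintype ι] {v : ι → Euc n}
    (h : LinearIndependent ℝ v) : LinearIndepOn ℝ v ((Finset.univ : Finset ι) : Set ι) := by
  rwa [Finset.coe_univ, linearIndepOn_univ_iff]

lemma IsVal.tri_cut {y : Set (Euc n) → ℝ} (hy : IsVal y) (h : LinearIndependent ℝ ![a, b])
    {l : ℝ} (hl0 : 0 < l) (hl1 : l < 1) :
    y (tri a b) + y (seg (l • a + (1 - l) • b)) =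
      y (tri (l • a + (1 - l) • b) b) + y (tri a (l • a + (1 - l) • b)) := by
  have := hy.spx_cut (Finset.mem_univ 0) (Finset.mem_univ 1) (by decide)
    hl0 hl1 h.linearIndepOn_coe_univ
  convert this using 3
  · rfl
  · refine spx_eq_of_image_eq ?_
    rw [show Finset.univ.erase (1 : Fin 2) = {0} by decide]
    simp
  · refine spx_congr fun i _ => by fin_cases i <;> simp
  · refine spx_congr fun i _ => by fin_cases i <;> simp

lemma IsVal.tet_cut {y : Set (Euc n) → ℝ} (hy : IsVal y) (h : LinearIndependent ℝ ![a, b, c])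
    {l : ℝ} (hl0 : 0 < l) (hl1 : l < 1) :
    y (tet a b c) + y (tri (l • a + (1 - l) • b) c) =
      y (tet (l • a + (1 - l) • b) b c) + y (tet a (l • a + (1 - l) • b) c) := by
  have := hy.spx_cut (Finset.mem_univ 0) (Finset.mem_univ 1) (by decide)
    hl0 hl1 h.linearIndepOn_coe_univ
  convert this using 3
  · rfl
  · refine spx_eq_of_image_eq ?_
    rw [show Finset.univ.erase (1 : Fin 3) = {0, 2} by decide]
    simp [Matrix.range_cons, Set.image_insert_eq, Set.pair_comm]
  · refine spx_congr fun i _ => by fin_cases i <;> simp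
  · refine spx_congr fun i _ => by fin_cases i <;> simp

lemma supp_seg (a x : Euc n) : supp (seg a) x = max ⟪x, a⟫ 0 := by
  rw [seg, show (Finset.univ : Finset (Fin 1)) = insert 0 ∅ by decide, supp_spx_insert,
    supp_spx_empty]
  rfl

lemma supp_tri (a b x : Euc n) : supp (tri a b) x = max ⟪x, a⟫ (max ⟪x, b⟫ 0) := by
  rw [tri, show (Finset.univ : Finset (Fin 2)) = insert 0 (insert 1 ∅) by decide, supp_spx_insert,
    supp_spx_insert, supp_spx_empty]
  rfl

lemma supp_tet (a b c x : Euc n) :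
    supp (tet a b c) x = max ⟪x, a⟫ (max ⟪x, b⟫ (max ⟪x, c⟫ 0)) := by
  rw [tet, show (Finset.univ : Finset (Fin 3)) = insert 0 (insert 1 (insert 2 ∅)) by decide,
    supp_spx_insert, supp_spx_insert, supp_spx_insert, supp_spx_empty]
  rfl

lemma sdim_seg (ha : a ≠ 0) : sdim (seg a) = 1 := by
  have h : LinearIndependent ℝ ![a] := by simpa using ha
  simpa [seg] using sdim_spx h.linearIndepOn_coe_univ

lemma sdim_tri (h : LinearIndependent ℝ ![a, b]) : sdim (tri a b) = 2 := by
  simpa [tri] using sdim_spx h.linearIndepOn_coe_univ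

lemma sdim_tet (h : LinearIndependent ℝ ![a, b, c]) : sdim (tet a b c) = 3 := by
  simpa [tet] using sdim_spx h.linearIndepOn_coe_univ

lemma sum_edges_tri (h : LinearIndependent ℝ ![a, b]) (x : Euc n) :
    ∑ᶠ E ∈ facesO 1 (tri a b), supp E x = max ⟪x, a⟫ 0 + max ⟪x, b⟫ 0 := by
  rw [tri, finsum_facesO_spx h.linearIndepOn_coe_univ,
    show Finset.powersetCard 1 (Finset.univ : Finset (Fin 2)) = {insert 0 ∅, insert 1 ∅} by decide,
    Finset.sum_pair (by decide)]
  simp only [supp_spx_insert, supp_spx_empty]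
  rfl

lemma sum_edges_tet (h : LinearIndependent ℝ ![a, b, c]) (x : Euc n) :
    ∑ᶠ E ∈ facesO 1 (tet a b c), supp E x = max ⟪x, a⟫ 0 + (max ⟪x, b⟫ 0 + max ⟪x, c⟫ 0) := by
  rw [tet, finsum_facesO_spx h.linearIndepOn_coe_univ,
    show Finset.powersetCard 1 (Finset.univ : Finset (Fin 3)) =
      {insert 0 ∅, insert 1 ∅, insert 2 ∅} by decide,
    Finset.sum_insert (by decide), Finset.sum_pair (by decide)]
  simp only [supp_spx_insert, supp_spx_empty]
  rfl

lemma sum_facets_tet (h : LinearIndependent ℝ ![a, b, c]) (x : Euc n) :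
    ∑ᶠ F ∈ facesO 2 (tet a b c), supp F x = max ⟪x, a⟫ (max ⟪x, b⟫ 0) +
      (max ⟪x, b⟫ (max ⟪x, c⟫ 0) + max ⟪x, c⟫ (max ⟪x, a⟫ 0)) := by
  rw [tet, finsum_facesO_spx h.linearIndepOn_coe_univ,
    show Finset.powersetCard 2 (Finset.univ : Finset (Fin 3)) =
      {insert 0 (insert 1 ∅), insert 1 (insert 2 ∅), insert 2 (insert 0 ∅)} by decide,
    Finset.sum_insert (by decide), Finset.sum_pair (by decide)]
  simp only [supp_spx_insert, supp_spx_empty]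
  rfl

lemma spx_cases (I : Finset (Fin 3)) (v : Fin 3 → Euc 3)
    (hv : LinearIndepOn ℝ v (I : Set (Fin 3))) :
    spx I v = {0} ∨ (∃ a, a ≠ 0 ∧ spx I v = seg a) ∨
      (∃ a b, LinearIndependent ℝ ![a, b] ∧ spx I v = tri a b) ∨
      ∃ a b c, 0 < (colMat ![a, b, c]).det ∧ spx I v = tet a b c := by
  have h3 : I.card ≤ 3 := I.card_le_univ
  rcases Nat.lt_or_ge I.card 3 with h | h
  · rcases Nat.lt_or_ge I.card 2 with h | h
    · rcases Nat.lt_or_ge I.card 1 with h | h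
      · left
        rw [Finset.card_eq_zero.1 (by omega : I.card = 0)]
        simp [spx]
      · right; left
        obtain ⟨i, rfl⟩ := Finset.card_eq_one.1 (by omega : I.card = 1)
        exact ⟨v i, hv.ne_zero (by simp), spx_eq_of_image_eq (by simp)⟩
    · right; right; left
      obtain ⟨i, j, hij, rfl⟩ := Finset.card_eq_two.1 (by omega : I.card = 2)
      refine ⟨v i, v j, ?_, spx_eq_of_image_eq (by
        simp [Matrix.range_cons, Set.image_insert_eq, Set.pair_comm])⟩
      rw [Finset.coe_pair] at hv
      exact LinearIndependent.pair_iff.2 ((LinearIndepOn.pair_iff v hij).1 hv)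
  · right; right; right
    obtain rfl := (Finset.card_eq_iff_eq_univ I).1 (by simp; omega)
    have hv' : LinearIndependent ℝ v := by
      rwa [Finset.coe_univ, linearIndepOn_univ_iff] at hv
    have hd := det_colMat_ne_zero hv'
    have hvv : v = ![v 0, v 1, v 2] := by
      ext i; fin_cases i <;> rfl
    rcases lt_or_gt_of_ne hd with hd | hd
    · refine ⟨v 1, v 0, v 2, ?_, ?_⟩
      · rw [hvv, colMat_det] at hd
        rw [colMat_det]
        linarith
      · rw [← tet_swap, tet, ← hvv]
    · exact ⟨v 0, v 1, v 2, by rwa [← hvv], by rw [tet, ← hvv]⟩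

end Simplices

section DiamondValues

variable {a b c : Euc 3} (a₁ a₂ b₁ b₂ : ℝ) (x : Euc 3)

lemma hD_seg (ha : a ≠ 0) :
    hD a₁ a₂ b₁ b₂ (seg a) x = a₁ * max ⟪x, a⟫ 0 + b₁ * max (-⟪x, a⟫) 0 := by
  simp [hD, sdim_seg ha, supp_seg]

lemma hD_tri (h : LinearIndependent ℝ ![a, b]) :
    hD a₁ a₂ b₁ b₂ (tri a b) x =
      (2 * a₂ - a₁) * max ⟪x, a⟫ (max ⟪x, b⟫ 0) - (a₂ - a₁) * (max ⟪x, a⟫ 0 + max ⟪x, b⟫ 0) +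
      ((2 * b₂ - b₁) * max (-⟪x, a⟫) (max (-⟪x, b⟫) 0) -
        (b₂ - b₁) * (max (-⟪x, a⟫) 0 + max (-⟪x, b⟫) 0)) := by
  simp only [hD, sdim_tri h, supp_tri, sum_edges_tri h, inner_neg_left]
  norm_num
  ring

lemma hD_tet (h : LinearIndependent ℝ ![a, b, c]) :
    hD a₁ a₂ b₁ b₂ (tet a b c) x =
      a₁ * max ⟪x, a⟫ (max ⟪x, b⟫ (max ⟪x, c⟫ 0)) +
        (a₂ - a₁) * (max ⟪x, a⟫ (max ⟪x, b⟫ 0) + max ⟪x, b⟫ (max ⟪x, c⟫ 0) +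
          max ⟪x, c⟫ (max ⟪x, a⟫ 0) - max ⟪x, a⟫ 0 - max ⟪x, b⟫ 0 - max ⟪x, c⟫ 0) +
      (b₁ * max (-⟪x, a⟫) (max (-⟪x, b⟫) (max (-⟪x, c⟫) 0)) +
        (b₂ - b₁) * (max (-⟪x, a⟫) (max (-⟪x, b⟫) 0) + max (-⟪x, b⟫) (max (-⟪x, c⟫) 0) +
          max (-⟪x, c⟫) (max (-⟪x, a⟫) 0) - max (-⟪x, a⟫) 0 - max (-⟪x, b⟫) 0 -
          max (-⟪x, c⟫) 0)) := by
  simp only [hD, sdim_tet h, supp_tet, sum_edges_tet h, sum_facets_tet h, inner_neg_left]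
  norm_num
  ring

end DiamondValues

section MomentBody

variable {n : ℕ} {P : Set (Euc n)} {x : Euc n}

lemma mMinus1_eq (P : Set (Euc n)) (x : Euc n) : mMinus1 P x = mPlus1 P (-x) := by
  simp only [mMinus1, mPlus1, inner_neg_left]

lemma continuous_max_inner (x : Euc n) : Continuous fun y : Euc n => max ⟪x, y⟫ 0 := by
  fun_prop

lemma integrableOn_max_inner (hP : IsCompact P) (x : Euc n) :
    IntegrableOn (fun y : Euc n => max ⟪x, y⟫ 0) P :=
  (continuous_max_inner x).continuousOn.integrableOn_compact hP

lemma isVal_mPlus1 (x : Euc n) : IsVal fun P => mPlus1 P x := by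
  intro K L hK hL hU hI
  have h := Measure.restrict_union_add_inter (μ := (volume : Measure (Euc n))) K
    hL.isCompact.isClosed.measurableSet
  have h2 := congrArg (fun μ => ∫ y, max ⟪x, y⟫ 0 ∂μ) h
  rwa [integral_add_measure (integrableOn_max_inner hU.isCompact x)
      (integrableOn_max_inner hI.isCompact x),
    integral_add_measure (integrableOn_max_inner hK.isCompact x)
      (integrableOn_max_inner hL.isCompact x)] at h2

lemma mPlus1_nonneg (P : Set (Euc n)) (x : Euc n) : 0 ≤ mPlus1 P x :=
  integral_nonneg fun _ => le_max_right _ _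

lemma mPlus1_smul (P : Set (Euc n)) {c : ℝ} (hc : 0 ≤ c) (x : Euc n) :
    mPlus1 P (c • x) = c * mPlus1 P x := by
  rw [mPlus1, mPlus1, ← integral_const_mul]
  congr 1
  ext y
  rw [inner_smul_left, RCLike.conj_to_real, mul_max_of_nonneg _ _ hc, mul_zero]

lemma continuous_mPlus1 (hP : IsCompact P) : Continuous (mPlus1 P) :=
  continuous_parametric_integral_of_continuous
    (f := fun x y : Euc n => max ⟪x, y⟫ 0) (by fun_prop) hP

lemma mPlus1_eq_zero_of_sdim_lt (h0 : (0 : Euc n) ∈ P) (h : sdim P < n) (x : Euc n) :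
    mPlus1 P x = 0 := by
  have hne : Submodule.span ℝ P ≠ ⊤ := by
    intro ht
    rw [sdim_eq_finrank_span h0, ht, finrank_top] at h
    simp at h
  exact setIntegral_measure_zero _
    (measure_mono_null Submodule.subset_span (Measure.addHaar_submodule volume _ hne))

lemma isCov_mPlus1 : IsCov (mPlus1 (n := n)) := by
  intro φ P hP x
  obtain ⟨A, hdet⟩ := φ
  change mPlus1 (matAct A P) x = mPlus1 P (matVec Aᵀ x)
  have hinj : Function.Injective (matVec A) := matVec_injective (by rw [hdet]; exact one_ne_zero)
  set f : Euc n →L[ℝ] Euc n := LinearMap.toContinuousLinearMap (Matrix.toEuclideanLin A)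
  have hf : f.det = 1 := by
    rw [← hdet]
    exact (LinearMap.det_toContinuousLinearMap _).trans (by simp [Matrix.toEuclideanLin])
  have h := integral_image_eq_integral_abs_det_fderiv_smul (volume : Measure (Euc n))
    hP.isCompact.isClosed.measurableSet (f := f) (f' := fun _ => f)
    (fun y _ => f.hasFDerivWithinAt) hinj.injOn fun y => max ⟪x, y⟫ 0
  rw [hf, abs_one] at h
  simp only [one_smul] at h
  refine h.trans ?_
  rw [mPlus1]
  congr 1
  ext y
  rw [← inner_matVec]
  rfl

lemma mem_tet_stdVec {y : Euc 3} (h0 : ∀ i, 0 ≤ y i) (h1 : y 0 + y 1 + y 2 ≤ 1) :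
    y ∈ tet (stdVec 0) (stdVec 1) (stdVec 2) := by
  refine mem_spx.2 ⟨y, fun i _ => h0 i, by rwa [Fin.sum_univ_three], ?_⟩
  ext j
  fin_cases j <;> simp [Fin.sum_univ_three, stdVec]

lemma nonneg_of_mem_tet_stdVec {y : Euc 3} (hy : y ∈ tet (stdVec 0) (stdVec 1) (stdVec 2)) :
    0 ≤ y 2 := by
  obtain ⟨t, ht, -, rfl⟩ := mem_spx.1 hy
  simpa [Fin.sum_univ_three, stdVec] using ht 2 (Finset.mem_univ _)

lemma inner_stdVec (x : Euc n) (i : Fin n) : ⟪x, stdVec i⟫ = x i := by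
  simp [stdVec, EuclideanSpace.inner_single_right]

lemma mPlus1_tet_pos :
    0 < mPlus1 (tet (stdVec 0) (stdVec 1) (stdVec 2)) (stdVec 2 : Euc 3) := by
  set T := tet (stdVec 0) (stdVec 1) (stdVec 2 : Euc 3) with hT
  have hc : IsCompact T := (isPolytope0_tet _ _ _).isCompact
  refine (setIntegral_pos_iff_support_of_nonneg_ae (ae_of_all _ fun _ => le_max_right _ _)
    (integrableOn_max_inner hc _)).2 ?_
  set U : Set (Euc 3) := {y | 0 < y 0 ∧ 0 < y 1 ∧ 0 < y 2 ∧ y 0 + y 1 + y 2 < 1} with hU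
  have hUo : IsOpen U := by
    have hcont : ∀ i : Fin 3, Continuous fun y : Euc 3 => y i := fun i => by fun_prop
    simp only [hU, Set.ofPred_and]
    exact (isOpen_lt continuous_const (hcont 0)).inter ((isOpen_lt continuous_const (hcont 1)).inter
      ((isOpen_lt continuous_const (hcont 2)).inter
        (isOpen_lt (((hcont 0).add (hcont 1)).add (hcont 2)) continuous_const)))
  have hUne : U.Nonempty := ⟨!₂[1 / 4, 1 / 4, 1 / 4], by
    simp only [hU, Set.mem_ofPred_eq, Matrix.cons_val]
    norm_num⟩
  refine (hUo.measure_pos volume hUne).trans_le (measure_mono ?_)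
  rintro y ⟨h0, h1, h2, h3⟩
  refine ⟨?_, mem_tet_stdVec (fun i => by fin_cases i <;> exact le_of_lt ‹_›) h3.le⟩
  refine Function.mem_support.2 (ne_of_gt (lt_max_of_lt_left ?_))
  rwa [real_inner_comm, inner_stdVec]

lemma mPlus1_tet_neg :
    mPlus1 (tet (stdVec 0) (stdVec 1) (stdVec 2)) (-stdVec 2 : Euc 3) = 0 := by
  refine setIntegral_eq_zero_of_forall_eq_zero fun y hy => max_eq_right ?_
  rw [inner_neg_left, real_inner_comm, inner_stdVec, neg_nonpos]
  exact nonneg_of_mem_tet_stdVec hy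

end MomentBody

section SupportFunction

variable {n : ℕ} {K L : Set (Euc n)}

lemma supp_add (hK : IsConvexBody0 K) (hL : IsConvexBody0 L) (x : Euc n) :
    supp (K + L) x = supp K x + supp L x := by
  refine le_antisymm (supp_le ⟨0 + 0, Set.add_mem_add hK.2.2 hL.2.2⟩ ?_) ?_
  · rintro _ ⟨y, hy, z, hz, rfl⟩
    rw [inner_add_right]
    exact add_le_add (inner_le_supp hK.1 hy x) (inner_le_supp hL.1 hz x)
  · obtain ⟨y, hy, hyx⟩ := exists_inner_eq_supp hK.1 ⟨0, hK.2.2⟩ x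
    obtain ⟨z, hz, hzx⟩ := exists_inner_eq_supp hL.1 ⟨0, hL.2.2⟩ x
    rw [← hyx, ← hzx, ← inner_add_right]
    exact inner_le_supp (hK.1.add hL.1) (Set.add_mem_add hy hz) x

lemma subset_of_supp_le (hK : IsCompact K) (hL : IsConvexBody0 L)
    (h : ∀ x, supp K x ≤ supp L x) : K ⊆ L := by
  intro y hy
  by_contra hyL
  obtain ⟨f, u, hf, hu⟩ := geometric_hahn_banach_closed_point hL.2.1 hL.1.isClosed hyL
  set x := (InnerProductSpace.toDual ℝ (Euc n)).symm f
  have hx : ∀ z, ⟪x, z⟫ = f z := fun z => InnerProductSpace.toDual_symm_apply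
  have h1 : supp L x ≤ u := supp_le ⟨0, hL.2.2⟩ fun z hz => by
    rw [hx]
    exact (hf z hz).le
  have h2 := inner_le_supp hK hy x
  rw [hx] at h2
  linarith [h x]

lemma IsConvexBody0.eq_of_supp_eq (hK : IsConvexBody0 K) (hL : IsConvexBody0 L)
    (h : ∀ x, supp K x = supp L x) : K = L :=
  (subset_of_supp_le hK.1 hL fun x => (h x).le).antisymm
    (subset_of_supp_le hL.1 hK fun x => (h x).ge)

lemma IsConvexBody0.add (hK : IsConvexBody0 K) (hL : IsConvexBody0 L) : IsConvexBody0 (K + L) :=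
  ⟨hK.1.add hL.1, hK.2.1.add hL.2.1, 0, hK.2.2, 0, hL.2.2, add_zero 0⟩

lemma IsConvexBody0.matAct (hK : IsConvexBody0 K) (A : Matrix (Fin n) (Fin n) ℝ) :
    IsConvexBody0 (matAct A K) :=
  ⟨hK.1.image (LinearMap.continuous_of_finiteDimensional _), hK.2.1.linear_image _,
    0, hK.2.2, map_zero _⟩

end SupportFunction

section Correspondence

variable {Z : Set (Euc 3) → Set (Euc 3)}

lemma valuationMink_iff (hbody : ∀ P, IsPolytope0 P → IsConvexBody0 (Z P)) :
    ValuationMink Z ↔ ∀ x, IsVal fun P => supp (Z P) x := by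
  constructor
  · intro h x K L hK hL hU hI
    have := congrArg (fun S => supp S x) (h K L hK hL hU hI)
    simpa only [supp_add (hbody _ hU) (hbody _ hI), supp_add (hbody _ hK) (hbody _ hL)] using this
  · intro h K L hK hL hU hI
    refine ((hbody _ hU).add (hbody _ hI)).eq_of_supp_eq ((hbody _ hK).add (hbody _ hL)) fun x => ?_
    rw [supp_add (hbody _ hU) (hbody _ hI), supp_add (hbody _ hK) (hbody _ hL)]
    exact h x K L hK hL hU hI

lemma sLCovariant_iff (hbody : ∀ P, IsPolytope0 P → IsConvexBody0 (Z P)) :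
    SLCovariant Z ↔ IsCov fun P => supp (Z P) := by
  constructor
  · intro h φ P hP x
    dsimp only
    rw [h φ P hP, supp_matAct]
  · intro h φ P hP
    refine (hbody _ (hP.matAct _)).eq_of_supp_eq ((hbody _ hP).matAct _) fun x => ?_
    rw [supp_matAct]
    exact h φ P hP x

end Correspondence

section SuppRegularity

variable {n : ℕ} {K : Set (Euc n)}

lemma supp_smul (K : Set (Euc n)) {c : ℝ} (hc : 0 ≤ c) (x : Euc n) :
    supp K (c • x) = c * supp K x := by
  rw [supp, supp, ← smul_eq_mul, ← Real.sSup_smul_of_nonneg hc, ← Set.image_smul, Set.image_image]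
  simp only [inner_smul_left, RCLike.conj_to_real, smul_eq_mul]

lemma supp_add_le (hK : IsCompact K) (hne : K.Nonempty) (x y : Euc n) :
    supp K (x + y) ≤ supp K x + supp K y :=
  supp_le hne fun p hp => by
    rw [inner_add_left]
    exact add_le_add (inner_le_supp hK hp x) (inner_le_supp hK hp y)

lemma continuous_supp (hK : IsCompact K) (hne : K.Nonempty) : Continuous (supp K) := by
  have h : ConvexOn ℝ Set.univ (supp K) := by
    refine ⟨convex_univ, fun x _ y _ a b ha hb _ => ?_⟩
    refine (supp_add_le hK hne _ _).trans ?_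
    rw [supp_smul K ha, supp_smul K hb, smul_eq_mul, smul_eq_mul]
  exact continuousOn_univ.1 (h.continuousOn isOpen_univ)

end SuppRegularity

/-- The properties of `P ↦ h_{Z P}` used in the classification of covariant Minkowski valuations:
they are stable under linear combinations. -/
structure IsCovVal (z : Set (Euc 3) → Euc 3 → ℝ) : Prop where
  isVal : ∀ x, IsVal fun P => z P x
  isCov : IsCov z
  continuous : ∀ P, IsPolytope0 P → Continuous (z P)
  smul : ∀ P, IsPolytope0 P → ∀ c : ℝ, 0 ≤ c → ∀ x, z P (c • x) = c * z P x

section CovVal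

variable {z z' : Set (Euc 3) → Euc 3 → ℝ}

lemma IsCovVal.sub (hz : IsCovVal z) (hz' : IsCovVal z') :
    IsCovVal fun P x => z P x - z' P x where
  isVal x := (hz.isVal x).sub (hz'.isVal x)
  isCov φ P hP x := by
    dsimp only
    rw [hz.isCov φ P hP, hz'.isCov φ P hP]
  continuous P hP := (hz.continuous P hP).sub (hz'.continuous P hP)
  smul P hP c hc x := by
    rw [hz.smul P hP c hc, hz'.smul P hP c hc, mul_sub]

lemma IsCovVal.const_mul (hz : IsCovVal z) (k : ℝ) : IsCovVal fun P x => k * z P x where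
  isVal x := (hz.isVal x).const_mul k
  isCov φ P hP x := by
    dsimp only
    rw [hz.isCov φ P hP]
  continuous P hP := (hz.continuous P hP).const_mul k
  smul P hP c hc x := by
    rw [hz.smul P hP c hc]
    ring

lemma isCovVal_mPlus1 : IsCovVal mPlus1 where
  isVal := isVal_mPlus1
  isCov := isCov_mPlus1
  continuous _ hP := continuous_mPlus1 hP.isCompact
  smul P _ _ hc x := mPlus1_smul P hc x

lemma isCovVal_mMinus1 : IsCovVal mMinus1 where
  isVal x := by simpa only [mMinus1_eq] using isVal_mPlus1 (-x)
  isCov φ P hP x := by simp only [mMinus1_eq, isCov_mPlus1 φ P hP, matVec_neg]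
  continuous P hP := by
    rw [funext (mMinus1_eq P)]
    exact (continuous_mPlus1 hP.isCompact).comp continuous_neg
  smul P _ c hc x := by rw [mMinus1_eq, mMinus1_eq, ← smul_neg, mPlus1_smul P hc]

lemma continuous_finsum_facesO {P : Set (Euc 3)} (hP : IsPolytope0 P) (j : ℕ) :
    Continuous fun x => ∑ᶠ F ∈ facesO j P, supp F x := by
  simp only [finsum_mem_eq_finite_toFinset_sum _ (hP.finite_facesO j)]
  refine continuous_finsetSum _ fun F hF => ?_
  have h := hP.of_mem_facesO ((Set.Finite.mem_toFinset _).1 hF)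
  exact continuous_supp h.isCompact ⟨0, h.2⟩

lemma finsum_facesO_smul {P : Set (Euc 3)} (hP : IsPolytope0 P) (j : ℕ) {c : ℝ} (hc : 0 ≤ c)
    (x : Euc 3) :
    ∑ᶠ F ∈ facesO j P, supp F (c • x) = c * ∑ᶠ F ∈ facesO j P, supp F x := by
  simp only [finsum_mem_eq_finite_toFinset_sum _ (hP.finite_facesO j), supp_smul _ hc,
    Finset.mul_sum]

lemma isCovVal_hD (a₁ a₂ b₁ b₂ : ℝ) : IsCovVal (hD a₁ a₂ b₁ b₂) where
  isVal := isVal_hD a₁ a₂ b₁ b₂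
  isCov := isCov_hD a₁ a₂ b₁ b₂
  continuous P hP := by
    have h := continuous_supp hP.isCompact ⟨0, hP.2⟩
    have h1 := continuous_finsum_facesO hP 1
    have h2 := continuous_finsum_facesO hP 2
    have h' := h.comp continuous_neg
    have h1' := h1.comp continuous_neg
    have h2' := h2.comp continuous_neg
    simp only [Function.comp_def] at h' h1' h2'
    unfold hD
    split_ifs <;> fun_prop
  smul P hP c hc x := by
    simp only [hD, ← smul_neg, finsum_facesO_smul hP _ hc]
    simp only [supp_smul _ hc]
    split_ifs <;> ring

end CovVal

section FunctionalEquations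

/-- A continuous solution of a weighted bisection equation that vanishes on the coordinate axes
vanishes identically. -/
lemma eq_zero_of_bisection {Q : ℝ → ℝ → ℝ} {α β : ℝ → ℝ}
    (hα : ∀ l, 0 < l → l < 1 → α l ≠ 0) (hβ : ∀ l, 0 < l → l < 1 → β l ≠ 0)
    (hcont : Continuous fun p : ℝ × ℝ => Q p.1 p.2) (hl : ∀ t, Q 0 t = 0) (hr : ∀ t, Q t 0 = 0)
    (hcut : ∀ s t l, 0 < l → l < 1 →
      Q s t = α l * Q (l * s + (1 - l) * t) t + β l * Q s (l * s + (1 - l) * t)) (s t : ℝ) :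
    Q s t = 0 := by
  have hleft : ∀ l t, 0 < l → l < 1 → Q (l * t) t = 0 := by
    intro l t h0 h1
    have h := hcut 0 t (1 - l) (by linarith) (by linarith)
    simp only [mul_zero, sub_sub_cancel, zero_add, hl] at h
    rw [add_zero, eq_comm, mul_eq_zero] at h
    exact h.resolve_left (hα _ (by linarith) (by linarith))
  have hright : ∀ l t, 0 < l → l < 1 → Q t (l * t) = 0 := by
    intro l t h0 h1
    have h := hcut t 0 l h0 h1
    simp only [mul_zero, add_zero, hr] at h
    rw [zero_add, eq_comm, mul_eq_zero] at h
    exact h.resolve_left (hβ _ h0 h1)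
  have hne : ∀ s t, s ≠ t → Q s t = 0 := by
    intro s t hst
    rcases eq_or_ne s 0 with rfl | hs
    · exact hl t
    rcases eq_or_ne t 0 with rfl | ht
    · exact hr s
    by_cases hst' : 0 < s * t
    · have hsq : s ^ 2 ≠ t ^ 2 := fun h => by
        rcases sq_eq_sq_iff_eq_or_eq_neg.1 h with h | h
        · exact hst h
        · rw [h] at hst'
          nlinarith [sq_nonneg t]
      rcases lt_or_gt_of_ne hsq with h | h
      · have := hleft (s / t) t (div_pos_iff.2 (mul_pos_iff.1 hst')) ?_
        · rwa [div_mul_cancel₀ _ ht] at this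
        · rw [← abs_of_pos (div_pos_iff.2 (mul_pos_iff.1 hst')), abs_div,
            div_lt_one (abs_pos.2 ht)]
          exact sq_lt_sq.1 h
      · have := hright (t / s) s (div_pos_iff.2 ((mul_pos_iff.1 hst').imp And.symm And.symm)) ?_
        · rwa [div_mul_cancel₀ _ hs] at this
        · rw [← abs_of_pos (div_pos_iff.2 ((mul_pos_iff.1 hst').imp And.symm And.symm)), abs_div,
            div_lt_one (abs_pos.2 hs)]
          exact sq_lt_sq.1 h
    · have hneg : s * t < 0 := lt_of_le_of_ne (not_lt.1 hst') (mul_ne_zero hs ht)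
      have hts : t - s ≠ 0 := sub_ne_zero.2 hst.symm
      have hl0 : 0 < t / (t - s) := by
        rw [div_pos_iff]
        rcases mul_neg_iff.1 hneg with h | h
        · exact .inr ⟨h.2, by linarith⟩
        · exact .inl ⟨h.2, by linarith⟩
      have hl1 : t / (t - s) < 1 := by
        have : 0 < -s / (t - s) := by
          rw [div_pos_iff]
          rcases mul_neg_iff.1 hneg with h | h
          · exact .inr ⟨by linarith, by linarith⟩
          · exact .inl ⟨by linarith, by linarith⟩
        have h2 : t / (t - s) + -s / (t - s) = 1 := by
          field_simp
          ring
        linarith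
      have h := hcut s t _ hl0 hl1
      have hm : t / (t - s) * s + (1 - t / (t - s)) * t = 0 := by
        field_simp
        ring
      rw [h, hm, hl, hr, mul_zero, mul_zero, add_zero]
  have h := Continuous.ext_on (dense_compl_singleton t) (f := fun s => Q s t)
    (g := fun _ => 0) (hcont.comp (by fun_prop : Continuous fun s : ℝ => (s, t))) continuous_const
    fun s hs => hne s t hs
  exact congrFun h s

lemma eq_zero_of_cyclic_bisection {P : ℝ → ℝ → ℝ → ℝ} (hcyc : ∀ s t r, P s t r = P t r s)
    (hcont : Continuous fun p : ℝ × ℝ × ℝ => P p.1 p.2.1 p.2.2)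
    (hsmul : ∀ c s t r, 0 ≤ c → P (c * s) (c * t) (c * r) = c * P s t r)
    (hcut : ∀ s t r l, 0 < l → l < 1 →
      P s t r = l * P (l * s + (1 - l) * t) t r + (1 - l) * P s (l * s + (1 - l) * t) r)
    (hpos : P 0 0 1 = 0) (hneg : P 0 0 (-1) = 0) (s t r : ℝ) : P s t r = 0 := by
  have h3 : ∀ r, P 0 0 r = 0 := by
    intro r
    rcases le_total 0 r with h | h
    · have := hsmul r 0 0 1 h
      rwa [mul_zero, mul_one, hpos, mul_zero] at this
    · have := hsmul (-r) 0 0 (-1) (by linarith)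
      rwa [mul_zero, neg_mul_neg, mul_one, hneg, mul_zero] at this
  have hQ : ∀ r, Continuous fun p : ℝ × ℝ => P p.1 p.2 r := fun r =>
    hcont.comp (by fun_prop : Continuous fun p : ℝ × ℝ => (p.1, p.2, r))
  have h2 : ∀ s t, P s t 0 = 0 :=
    eq_zero_of_bisection (α := fun l => l) (β := fun l => 1 - l) (fun l h _ => h.ne')
      (fun l _ h => by linarith) (hQ 0) (fun t => by rw [← hcyc, h3]) (fun t => by rw [hcyc, h3])
      fun s t l h0 h1 => hcut s t 0 l h0 h1
  exact eq_zero_of_bisection (Q := fun s t => P s t r) (α := fun l => l) (β := fun l => 1 - l)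
    (fun l h _ => h.ne') (fun l _ h => by linarith) (hQ r) (fun t => by rw [hcyc, h2])
    (fun t => by rw [← hcyc, h2]) (fun s t l h0 h1 => hcut s t r l h0 h1) s t

lemma eq_mul_of_additive_of_bddBelow {G : ℝ → ℝ} {C : ℝ}
    (hadd : ∀ x y, 0 < x → 0 < y → G (x + y) = G x + G y) (hC : ∀ x, 0 < x → C ≤ G x) {x : ℝ}
    (hx : 0 < x) : G x = x * G 1 := by
  have hmul : ∀ (k : ℕ) (x : ℝ), 0 < x → G ((k + 1) * x) = (k + 1) * G x := by
    intro k x hx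
    induction k with
    | zero => simp
    | succ k ih =>
      rw [Nat.cast_succ, add_mul _ _ x, one_mul, hadd _ _ (by positivity) hx, ih]
      ring
  have hnonneg : ∀ x, 0 < x → 0 ≤ G x := by
    intro x hx
    by_contra! h
    obtain ⟨k, hk⟩ := exists_nat_gt (C / G x)
    rw [div_lt_iff_of_neg h] at hk
    have := hC ((k + 1) * x) (by positivity)
    rw [hmul k x hx] at this
    linarith
  have hmono : ∀ x y, 0 < x → x ≤ y → G x ≤ G y := by
    intro x y hx hxy
    rcases hxy.eq_or_lt with rfl | hxy
    · rfl
    · have := hadd x (y - x) hx (by linarith)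
      rw [add_sub_cancel] at this
      linarith [hnonneg (y - x) (by linarith)]
  have h1 := hnonneg 1 one_pos
  have hclose : ∀ k : ℕ, |(k + 1) * (G x - x * G 1)| ≤ G 1 := by
    intro k
    have hpos : 0 < (k + 1) * x := by positivity
    have hx1 := hmul k x hx
    obtain ⟨hf1, hf2⟩ : (⌊(k + 1) * x⌋₊ : ℝ) ≤ (k + 1) * x ∧
        (k + 1) * x < (⌊(k + 1) * x⌋₊ : ℝ) + 1 :=
      ⟨Nat.floor_le hpos.le, Nat.lt_floor_add_one _⟩
    generalize ⌊(k + 1) * x⌋₊ = j at hf1 hf2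
    have hup : G ((k + 1) * x) ≤ (j + 1) * G 1 := by
      have h := hmono _ _ hpos hf2.le
      rwa [← mul_one ((j : ℝ) + 1), hmul j 1 one_pos] at h
    have hlow : j * G 1 ≤ G ((k + 1) * x) := by
      cases j with
      | zero => simpa using hnonneg _ hpos
      | succ j =>
        rw [Nat.cast_succ] at hf1 ⊢
        rw [← hmul j 1 one_pos]
        exact hmono _ _ (by positivity) (by rwa [mul_one])
    have h3 := mul_le_mul_of_nonneg_right hf1 h1
    have h4 := mul_le_mul_of_nonneg_right hf2.le h1
    rw [abs_le]
    constructor <;> nlinarith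
  by_contra hne
  have hd : 0 < |G x - x * G 1| := abs_pos.2 (sub_ne_zero.2 hne)
  obtain ⟨k, hk⟩ := exists_nat_gt (G 1 / |G x - x * G 1|)
  rw [div_lt_iff₀ hd] at hk
  have := hclose k
  rw [abs_mul, abs_of_pos (by positivity : (0 : ℝ) < k + 1)] at this
  linarith

end FunctionalEquations

section LowDimensionalSimplices

variable {z y : Set (Euc 3) → Euc 3 → ℝ}

lemma IsCovVal.matAct_colMat (hz : IsCovVal z) {a b c : Euc 3} (h : (colMat ![a, b, c]).det = 1)
    {P : Set (Euc 3)} (hP : IsPolytope0 P) (x : Euc 3) :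
    z (matAct (colMat ![a, b, c]) P) x = z P !₂[⟪x, a⟫, ⟪x, b⟫, ⟪x, c⟫] := by
  rw [hz.isCov ⟨colMat ![a, b, c], h⟩ P hP x]
  congr 1
  ext i
  rw [matVec_colMat_transpose]
  fin_cases i <;> rfl

lemma IsCovVal.apply_seg (hz : IsCovVal z) {a b c : Euc 3} (h : (colMat ![a, b, c]).det = 1)
    (x : Euc 3) : z (seg a) x = z (seg (stdVec 0)) !₂[⟪x, a⟫, ⟪x, b⟫, ⟪x, c⟫] := by
  rw [← hz.matAct_colMat h (isPolytope0_seg _), matAct_seg, matVec_colMat_stdVec]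
  rfl

lemma IsCovVal.apply_tri_of_det (hz : IsCovVal z) {a b c : Euc 3}
    (h : (colMat ![a, b, c]).det = 1) (x : Euc 3) :
    z (tri a b) x = z (tri (stdVec 0) (stdVec 1)) !₂[⟪x, a⟫, ⟪x, b⟫, ⟪x, c⟫] := by
  rw [← hz.matAct_colMat h (isPolytope0_tri _ _), matAct_tri, matVec_colMat_stdVec,
    matVec_colMat_stdVec]
  rfl

lemma exists_inner_ne_zero {x : Euc 3} (hx : x ≠ 0) : ∃ a, ⟪x, a⟫ = 1 :=
  ⟨(‖x‖ ^ 2)⁻¹ • x, by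
    rw [inner_smul_right, real_inner_self_eq_norm_sq, inv_mul_cancel₀]
    exact pow_ne_zero _ (norm_ne_zero_iff.2 hx)⟩

lemma IsCovVal.apply_zero (hz : IsCovVal z) (x : Euc 3) : z {0} x = 0 := by
  have h1 : ∀ x, x ≠ 0 → z {0} x = z {0} !₂[1, 0, 0] := by
    intro x hx
    obtain ⟨a, ha⟩ := exists_inner_ne_zero hx
    obtain ⟨b, c, hb, hc, hdet⟩ := exists_two_columns (ha.trans_ne one_ne_zero)
    have h := hz.matAct_colMat hdet isPolytope0_zero x
    rw [ha, hb, hc] at h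
    rw [← h, matAct, Set.image_singleton, map_zero]
  have he : (!₂[1, 0, 0] : Euc 3) ≠ 0 := fun h => by
    simpa using congrArg (fun v : Euc 3 => v 0) h
  have h2 := hz.smul {0} isPolytope0_zero 2 two_pos.le !₂[1, 0, 0]
  rw [h1 _ (smul_ne_zero two_ne_zero he)] at h2
  rcases eq_or_ne x 0 with rfl | hx
  · simpa using hz.smul {0} isPolytope0_zero 0 le_rfl 0
  · rw [h1 x hx]
    linarith

/-- A continuous function vanishing off the hyperplane orthogonal to `a` vanishes. -/
lemma eq_of_eq_of_inner_ne_zero {f g : Euc 3 → ℝ} (hf : Continuous f) (hg : Continuous g)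
    {a : Euc 3} (ha : a ≠ 0) (h : ∀ x, ⟪x, a⟫ ≠ 0 → f x = g x) (x : Euc 3) : f x = g x := by
  by_cases hx : ⟪x, a⟫ = 0
  · have hl : Continuous fun t : ℝ => x + t • a := by fun_prop
    have := congrFun (Continuous.ext_on (dense_compl_singleton (0 : ℝ)) (hf.comp hl) (hg.comp hl)
      fun t ht => h _ ?_) 0
    · simpa using this
    · rw [inner_add_left, hx, zero_add, inner_smul_left, real_inner_self_eq_norm_sq]
      exact mul_ne_zero ht (pow_ne_zero _ (norm_ne_zero_iff.2 ha))
  · exact h x hx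

lemma IsCovVal.seg_eq_zero (hy : IsCovVal y) (hpos : y (seg (stdVec 0)) (stdVec 0) = 0)
    (hneg : y (seg (stdVec 0)) (-stdVec 0) = 0) {a : Euc 3} (ha : a ≠ 0) (x : Euc 3) :
    y (seg a) x = 0 := by
  refine eq_of_eq_of_inner_ne_zero (hy.continuous _ (isPolytope0_seg a)) continuous_const ha
    (fun x hx => ?_) x
  obtain ⟨b, c, hb, hc, hdet⟩ := exists_two_columns hx
  rw [hy.apply_seg hdet x, hb, hc]
  generalize ⟪x, a⟫ = t
  rcases le_total 0 t with ht | ht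
  · have h : (!₂[t, 0, 0] : Euc 3) = t • stdVec 0 := by
      ext i
      fin_cases i <;> simp [stdVec]
    rw [h, hy.smul _ (isPolytope0_seg _) t ht, hpos, mul_zero]
  · have h : (!₂[t, 0, 0] : Euc 3) = (-t) • -stdVec 0 := by
      ext i
      fin_cases i <;> simp [stdVec]
    rw [h, hy.smul _ (isPolytope0_seg _) (-t) (by linarith), hneg, mul_zero]

lemma linearIndependent_stdVec_zero_one :
    LinearIndependent ℝ ![(stdVec 0 : Euc 3), stdVec 1] := by
  refine LinearIndependent.pair_iff.2 fun s t h => ⟨?_, ?_⟩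
  · simpa [stdVec] using congrArg (fun v : Euc 3 => v 0) h
  · simpa [stdVec] using congrArg (fun v : Euc 3 => v 1) h

lemma LinearIndependent.cut_left {a b : Euc 3} (h : LinearIndependent ℝ ![a, b]) {l : ℝ}
    (hl : l ≠ 0) (m : ℝ) : LinearIndependent ℝ ![l • a + m • b, b] := by
  refine LinearIndependent.pair_iff.2 fun s t hst => ?_
  have h2 : (s * l) • a + (s * m + t) • b = 0 := by
    rw [← hst]
    module
  obtain ⟨h3, h4⟩ := LinearIndependent.pair_iff.1 h _ _ h2
  have hs : s = 0 := (mul_eq_zero.1 h3).resolve_right hl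
  exact ⟨hs, by simpa [hs] using h4⟩

lemma LinearIndependent.cut_right {a b : Euc 3} (h : LinearIndependent ℝ ![a, b]) (l : ℝ) {m : ℝ}
    (hm : m ≠ 0) : LinearIndependent ℝ ![a, l • a + m • b] := by
  rw [LinearIndependent.pair_symm_iff] at h ⊢
  rw [add_comm]
  exact h.cut_left hm l

lemma IsCovVal.apply_tri (hz : IsCovVal z) {a b : Euc 3} (h : LinearIndependent ℝ ![a, b])
    (x : Euc 3) :
    z (tri a b) x = z (tri (stdVec 0) (stdVec 1)) !₂[⟪x, a⟫, ⟪x, b⟫, 0] := by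
  have hc := hz.continuous _ (isPolytope0_tri (stdVec 0) (stdVec 1))
  refine eq_of_eq_of_inner_ne_zero (a := a) (hz.continuous _ (isPolytope0_tri a b))
    (g := fun x => z (tri (stdVec 0) (stdVec 1)) !₂[⟪x, a⟫, ⟪x, b⟫, 0])
    (hc.comp ?_) (h.ne_zero 0) (fun x hx => ?_) x
  · refine (PiLp.continuous_toLp 2 _).comp (continuous_pi fun i => ?_)
    fin_cases i <;> simp <;> fun_prop
  · obtain ⟨c, hc, hdet⟩ := exists_third_column h (.inl hx)
    rw [hz.apply_tri_of_det hdet, hc]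

lemma IsCovVal.tri_eq_zero (hy : IsCovVal y) (hseg : ∀ a, a ≠ 0 → ∀ x, y (seg a) x = 0)
    (hpos : y (tri (stdVec 0) (stdVec 1)) (stdVec 1) = 0)
    (hneg : y (tri (stdVec 0) (stdVec 1)) (-stdVec 1) = 0) {a b : Euc 3}
    (h : LinearIndependent ℝ ![a, b]) (x : Euc 3) : y (tri a b) x = 0 := by
  set f : ℝ → ℝ → ℝ := fun s t => y (tri (stdVec 0) (stdVec 1)) !₂[s, t, 0] with hf
  have hval : ∀ {a b : Euc 3}, LinearIndependent ℝ ![a, b] → ∀ x,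
      y (tri a b) x = f ⟪x, a⟫ ⟪x, b⟫ := fun h x => hy.apply_tri h x
  have h01 := linearIndependent_stdVec_zero_one
  have hzero : ∀ t, f 0 t = 0 := by
    intro t
    rcases le_total 0 t with ht | ht
    · have h : (!₂[0, t, 0] : Euc 3) = t • stdVec 1 := by
        ext i
        fin_cases i <;> simp [stdVec]
      simp only [hf]
      rw [h, hy.smul _ (isPolytope0_tri _ _) t ht, hpos, mul_zero]
    · have h : (!₂[0, t, 0] : Euc 3) = (-t) • -stdVec 1 := by
        ext i
        fin_cases i <;> simp [stdVec]
      simp only [hf]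
      rw [h, hy.smul _ (isPolytope0_tri _ _) (-t) (by linarith), hneg, mul_zero]
  have hsymm : ∀ s t, f s t = f t s := by
    intro s t
    have h1 := hval (LinearIndependent.pair_symm_iff.1 h01) !₂[s, t, 0]
    rw [tri_comm] at h1
    simpa [inner_stdVec] using h1
  rw [hval h]
  refine eq_zero_of_bisection (α := fun _ => 1) (β := fun _ => 1) (fun _ _ _ => one_ne_zero)
    (fun _ _ _ => one_ne_zero) ?_ hzero (fun t => by rw [hsymm, hzero]) (fun s t l h0 h1 => ?_) _ _
  · refine (hy.continuous _ (isPolytope0_tri _ _)).comp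
      ((PiLp.continuous_toLp 2 _).comp (continuous_pi fun i => ?_))
    fin_cases i <;> simp <;> fun_prop
  · have hcut := (hy.isVal !₂[s, t, 0]).tri_cut h01 h0 h1
    have hl := h01.cut_left h0.ne' (1 - l)
    have hr := h01.cut_right l (sub_pos.2 h1).ne'
    rw [hseg (l • stdVec 0 + (1 - l) • stdVec 1) (hl.ne_zero 0), hval hl, hval hr, hval h01] at hcut
    simpa [inner_stdVec, inner_add_right, inner_smul_right] using hcut

end LowDimensionalSimplices

section Tetrahedra

variable {z y : Set (Euc 3) → Euc 3 → ℝ}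

/-- The value of `y` at a tetrahedron `[0, a, b, c]` of determinant `V` and at a vector whose
inner products with `a, b, c` are `s, t, r`. -/
def tetVal (y : Set (Euc 3) → Euc 3 → ℝ) (V s t r : ℝ) : ℝ :=
  y (tet (V • stdVec 0) (stdVec 1) (stdVec 2)) !₂[s / V, t, r]

lemma det_colMat_smul_stdVec (V : ℝ) :
    (colMat ![V • stdVec 0, stdVec 1, (stdVec 2 : Euc 3)]).det = V := by
  simp [colMat_det, stdVec]

lemma colMat_det_smul_first (a b c : Euc 3) (k : ℝ) :
    (colMat ![k • a, b, c]).det = k * (colMat ![a, b, c]).det := by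
  rw [colMat_det, colMat_det]
  simp only [PiLp.smul_apply, smul_eq_mul]
  ring

lemma IsCovVal.apply_tet (hz : IsCovVal z) {a b c : Euc 3} (h : 0 < (colMat ![a, b, c]).det)
    (x : Euc 3) :
    z (tet a b c) x = tetVal z (colMat ![a, b, c]).det ⟪x, a⟫ ⟪x, b⟫ ⟪x, c⟫ := by
  set V := (colMat ![a, b, c]).det with hV
  have h1 : (colMat ![V⁻¹ • a, b, c]).det = 1 := by
    rw [colMat_det_smul_first, ← hV, inv_mul_cancel₀ h.ne']
  have h3 := hz.matAct_colMat h1 (isPolytope0_tet (V • stdVec 0) (stdVec 1) (stdVec 2)) x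
  have h4 : matVec (colMat ![V⁻¹ • a, b, c]) (V • stdVec 0) = a := by
    rw [matVec, map_smul]
    change V • matVec _ _ = a
    rw [matVec_colMat_stdVec]
    exact smul_inv_smul₀ h.ne' a
  rw [matAct_tet, h4, matVec_colMat_stdVec, matVec_colMat_stdVec, inner_smul_right,
    inv_mul_eq_div] at h3
  exact h3

lemma IsCovVal.tetVal_rotate (hy : IsCovVal y) {V : ℝ} (hV : 0 < V) (s t r : ℝ) :
    tetVal y V s t r = tetVal y V t r s := by
  have h : (colMat ![stdVec 1, (stdVec 2 : Euc 3), V • stdVec 0]).det = V := by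
    simp [colMat_det, stdVec]
  rw [tetVal, tet_rotate, hy.apply_tet (h.symm ▸ hV), h]
  simp [inner_stdVec, inner_smul_right, mul_div_cancel₀ _ hV.ne']

lemma IsCovVal.tetVal_cut (hy : IsCovVal y)
    (htri : ∀ a b, LinearIndependent ℝ ![a, b] → ∀ x, y (tri a b) x = 0) {V : ℝ} (hV : 0 < V)
    (s t r : ℝ) {l : ℝ} (h0 : 0 < l) (h1 : l < 1) :
    tetVal y V s t r = tetVal y (l * V) (l * s + (1 - l) * t) t r +
      tetVal y ((1 - l) * V) s (l * s + (1 - l) * t) r := by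
  have hLI : LinearIndependent ℝ ![V • (stdVec 0 : Euc 3), stdVec 1, stdVec 2] :=
    linearIndependent_of_det_ne_zero (by rw [det_colMat_smul_stdVec]; exact hV.ne')
  have h := (hy.isVal !₂[s / V, t, r]).tet_cut hLI h0 h1
  set w : Euc 3 := l • V • stdVec 0 + (1 - l) • stdVec 1 with hw
  have hd1 : (colMat ![w, stdVec 1, stdVec 2]).det = l * V := by
    simp [hw, colMat_det, stdVec]
  have hd2 : (colMat ![V • stdVec 0, w, stdVec 2]).det = (1 - l) * V := by
    simp [hw, colMat_det, stdVec, mul_comm]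
  have hwLI : LinearIndependent ℝ ![w, stdVec 2] := by
    refine LinearIndependent.pair_iff.2 fun p q hpq => ?_
    have e1 := congrArg (fun v : Euc 3 => v 1) hpq
    have e2 := congrArg (fun v : Euc 3 => v 2) hpq
    simp [hw, stdVec] at e1 e2
    exact ⟨e1.resolve_right (by linarith), e2⟩
  have hsV : V * (s / V) = s := mul_div_cancel₀ _ hV.ne'
  rw [htri _ _ hwLI, hy.apply_tet (a := w) (hd1.symm ▸ mul_pos h0 hV),
    hy.apply_tet (b := w) (hd2.symm ▸ mul_pos (sub_pos.2 h1) hV), hd1, hd2, add_zero] at h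
  simpa [hw, tetVal, inner_stdVec, inner_add_right, inner_smul_right, hsV] using h

lemma IsCovVal.tetVal_eq_mul (hy : IsCovVal y)
    (htri : ∀ a b, LinearIndependent ℝ ![a, b] → ∀ x, y (tri a b) x = 0)
    (hbdd : ∀ s t r, ∃ C, ∀ V, 0 < V → C ≤ tetVal y V s t r) {V : ℝ} (hV : 0 < V) (s t r : ℝ) :
    tetVal y V s t r = V * tetVal y 1 s t r := by
  have heq : ∀ {V : ℝ}, 0 < V → ∀ s r, tetVal y V s s r = V * tetVal y 1 s s r := by
    intro V hV s r
    obtain ⟨C, hC⟩ := hbdd s s r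
    refine eq_mul_of_additive_of_bddBelow (G := fun V => tetVal y V s s r) (fun u v hu hv => ?_)
      hC hV
    have huv : 0 < u + v := add_pos hu hv
    have h := hy.tetVal_cut htri huv s s r (l := u / (u + v)) (by positivity)
      ((div_lt_one huv).2 (by linarith))
    have e1 : u / (u + v) * s + (1 - u / (u + v)) * s = s := by ring
    have e2 : u / (u + v) * (u + v) = u := div_mul_cancel₀ _ huv.ne'
    have e3 : (1 - u / (u + v)) * (u + v) = v := by rw [sub_mul, e2]; ring
    rwa [e1, e2, e3] at h
  have hmid : ∀ {V : ℝ}, 0 < V → ∀ s r l, 0 < l → l < 1 →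
      tetVal y V (l * s + (1 - l) * r) r s =
        V * (tetVal y 1 s s r - (1 - l) * tetVal y 1 s s (l * s + (1 - l) * r)) / l := by
    intro V hV s r l h0 h1
    have h := hy.tetVal_cut htri (div_pos hV h0) s r s h0 h1
    have hl : 0 < (1 - l) * (V / l) := mul_pos (sub_pos.2 h1) (div_pos hV h0)
    rw [mul_div_cancel₀ _ h0.ne', hy.tetVal_rotate (div_pos hV h0),
      hy.tetVal_rotate (div_pos hV h0), heq (div_pos hV h0), hy.tetVal_rotate hl,
      hy.tetVal_rotate hl, heq hl] at h
    rw [eq_div_iff h0.ne']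
    field_simp at h
    linarith
  have hbetween : ∀ s t r, (r < s ∧ s < t ∨ t < s ∧ s < r) →
      tetVal y V s t r = V * tetVal y 1 s t r := by
    intro s t r h
    have hne : r - t ≠ 0 := by rcases h with h | h <;> intro h' <;> linarith
    have h0 : 0 < (s - t) / (r - t) := by
      rw [div_pos_iff]
      rcases h with h | h
      · exact .inr ⟨by linarith, by linarith⟩
      · exact .inl ⟨by linarith, by linarith⟩
    have h1 : 0 < (r - s) / (r - t) := by
      rw [div_pos_iff]
      rcases h with h | h
      · exact .inr ⟨by linarith, by linarith⟩
      · exact .inl ⟨by linarith, by linarith⟩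
    have h2 : (s - t) / (r - t) + (r - s) / (r - t) = 1 := by
      field_simp
      ring
    have hs : (s - t) / (r - t) * r + (1 - (s - t) / (r - t)) * t = s := by
      field_simp
      ring
    have e1 := hmid hV r t _ h0 (by linarith)
    have e2 := hmid one_pos r t _ h0 (by linarith)
    rw [hs] at e1 e2
    rw [e1, e2]
    ring
  have hrot := hy.tetVal_rotate hV
  have hrot1 := hy.tetVal_rotate one_pos
  by_cases h1 : s = t
  · rw [h1, heq hV]
  by_cases h2 : t = r
  · rw [hrot, hrot1, h2, heq hV]
  by_cases h3 : r = s
  · rw [← hrot, ← hrot1, h3, heq hV]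
  by_cases hs : r < s ∧ s < t ∨ t < s ∧ s < r
  · exact hbetween s t r hs
  by_cases ht : s < t ∧ t < r ∨ r < t ∧ t < s
  · rw [hrot, hrot1, hbetween t r s ht]
  · rw [← hrot, ← hrot1]
    refine hbetween r s t ?_
    rcases lt_or_gt_of_ne h1 with h1 | h1 <;> rcases lt_or_gt_of_ne h2 with h2 | h2 <;>
      rcases lt_or_gt_of_ne h3 with h3 | h3 <;> grind

lemma nonneg_of_bddBelow_mul {k C : ℝ} (h : ∀ V, 0 < V → C ≤ V * k) : 0 ≤ k := by
  by_contra! hk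
  have h1 := h ((|C| + 1) / -k) (div_pos (by positivity) (neg_pos.2 hk))
  have h2 : (|C| + 1) / -k * k = -(|C| + 1) := by
    rw [div_neg, neg_mul, div_mul_cancel₀ _ hk.ne]
  rw [h2] at h1
  linarith [neg_abs_le C]

/-- A valuation that vanishes on triangles, is bounded below on tetrahedra and vanishes at two
values is zero on all tetrahedra. -/
lemma IsCovVal.tet_eq_zero (hy : IsCovVal y)
    (htri : ∀ a b, LinearIndependent ℝ ![a, b] → ∀ x, y (tri a b) x = 0)
    (hlin : ∀ V, 0 < V → ∀ s t r, tetVal y V s t r = V * tetVal y 1 s t r)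
    (hpos : tetVal y 1 0 0 1 = 0) (hneg : tetVal y 1 0 0 (-1) = 0) {a b c : Euc 3}
    (h : 0 < (colMat ![a, b, c]).det) (x : Euc 3) : y (tet a b c) x = 0 := by
  rw [hy.apply_tet h, hlin _ h, eq_zero_of_cyclic_bisection (P := tetVal y 1)
    (hy.tetVal_rotate one_pos) ?_ (fun k s t r hk => ?_) (fun s t r l h0 h1 => ?_) hpos hneg,
    mul_zero]
  · refine (hy.continuous _ (isPolytope0_tet _ _ _)).comp
      ((PiLp.continuous_toLp 2 _).comp (continuous_pi fun i => ?_))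
    fin_cases i <;> simp <;> fun_prop
  · rw [tetVal, tetVal, ← hy.smul _ (isPolytope0_tet _ _ _) k hk]
    congr 1
    ext i
    fin_cases i <;> simp
  · rw [hy.tetVal_cut htri one_pos s t r h0 h1, mul_one, mul_one, hlin l h0,
      hlin (1 - l) (sub_pos.2 h1)]

end Tetrahedra

section Classification

variable {z : Set (Euc 3) → Euc 3 → ℝ}

lemma tetVal_hD (a₁ a₂ b₁ b₂ : ℝ) {V : ℝ} (hV : 0 < V) (s t r : ℝ) :
    tetVal (hD a₁ a₂ b₁ b₂) V s t r =
      a₁ * max s (max t (max r 0)) + (a₂ - a₁) * (max s (max t 0) + max t (max r 0) +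
        max r (max s 0) - max s 0 - max t 0 - max r 0) +
      (b₁ * max (-s) (max (-t) (max (-r) 0)) + (b₂ - b₁) * (max (-s) (max (-t) 0) +
        max (-t) (max (-r) 0) + max (-r) (max (-s) 0) - max (-s) 0 - max (-t) 0 - max (-r) 0)) := by
  have h : LinearIndependent ℝ ![V • (stdVec 0 : Euc 3), stdVec 1, stdVec 2] :=
    linearIndependent_of_det_ne_zero (by rw [det_colMat_smul_stdVec]; exact hV.ne')
  rw [tetVal, hD_tet _ _ _ _ _ h]
  simp [inner_stdVec, inner_smul_right, mul_div_cancel₀ _ hV.ne']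

lemma stdVec_ne_zero (i : Fin 3) : (stdVec i : Euc 3) ≠ 0 := fun h => by
  simpa [stdVec] using congrArg (fun v : Euc 3 => v i) h

/-- Off tetrahedra, a covariant valuation agrees with a generalized difference body. -/
lemma IsCovVal.sub_hD_eq_zero (hz : IsCovVal z) :
    ∃ a₁ a₂ b₁ b₂ : ℝ, a₁ = z (seg (stdVec 0)) (stdVec 0) ∧
      a₂ = z (tri (stdVec 0) (stdVec 1)) (stdVec 1) ∧ b₁ = z (seg (stdVec 0)) (-stdVec 0) ∧
      b₂ = z (tri (stdVec 0) (stdVec 1)) (-stdVec 1) ∧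
      (∀ a, a ≠ 0 → ∀ x, z (seg a) x - hD a₁ a₂ b₁ b₂ (seg a) x = 0) ∧
      ∀ a b, LinearIndependent ℝ ![a, b] → ∀ x,
        z (tri a b) x - hD a₁ a₂ b₁ b₂ (tri a b) x = 0 := by
  refine ⟨_, _, _, _, rfl, rfl, rfl, rfl, ?_⟩
  set a₁ := z (seg (stdVec 0)) (stdVec 0)
  set a₂ := z (tri (stdVec 0) (stdVec 1)) (stdVec 1)
  set b₁ := z (seg (stdVec 0)) (-stdVec 0)
  set b₂ := z (tri (stdVec 0) (stdVec 1)) (-stdVec 1)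
  have hy := hz.sub (isCovVal_hD a₁ a₂ b₁ b₂)
  have hseg : ∀ a, a ≠ 0 → ∀ x, z (seg a) x - hD a₁ a₂ b₁ b₂ (seg a) x = 0 := by
    refine fun a ha x => hy.seg_eq_zero ?_ ?_ ha x
    · rw [hD_seg _ _ _ _ _ (stdVec_ne_zero 0)]
      simp [stdVec, a₁]
    · rw [hD_seg _ _ _ _ _ (stdVec_ne_zero 0)]
      simp [stdVec, b₁]
  have h10 : (stdVec 1 : Euc 3) 0 = 0 := by simp [stdVec]
  have h11 : (stdVec 1 : Euc 3) 1 = 1 := by simp [stdVec]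
  refine ⟨hseg, fun a b h x => hy.tri_eq_zero hseg ?_ ?_ h x⟩
  · change a₂ - _ = 0
    rw [hD_tri _ _ _ _ _ linearIndependent_stdVec_zero_one]
    simp only [inner_stdVec, h10, h11]
    norm_num
    ring
  · change b₂ - _ = 0
    rw [hD_tri _ _ _ _ _ linearIndependent_stdVec_zero_one]
    simp only [inner_neg_left, inner_stdVec, h10, h11]
    norm_num
    ring

lemma nonneg_of_forall_add_mul_nonneg {d k : ℝ} (h : ∀ V, 0 < V → 0 ≤ d + V * k) : 0 ≤ d := by
  by_contra! hd
  have hk : 0 < |k| + 1 := by positivity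
  have hV : 0 < -d / (|k| + 1) := div_pos (neg_pos.2 hd) hk
  have h1 := h _ hV
  have h2 : -d / (|k| + 1) * (|k| + 1) = -d := div_mul_cancel₀ _ hk.ne'
  nlinarith [mul_le_mul_of_nonneg_left (le_abs_self k) hV.le]

/-- Evaluating a valuation on small tetrahedra isolates its generalized difference body part, and
subadditivity forces the coefficients to be ordered. -/
lemma le_of_tetVal_subadditive {a₁ a₂ b₁ b₂ : ℝ}
    (hlin : ∀ V, 0 < V → ∀ s t r, tetVal (fun P x => z P x - hD a₁ a₂ b₁ b₂ P x) V s t r =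
      V * tetVal (fun P x => z P x - hD a₁ a₂ b₁ b₂ P x) 1 s t r)
    (hadd : ∀ V, 0 < V → ∀ s t r s' t' r',
      tetVal z V (s + s') (t + t') (r + r') ≤ tetVal z V s t r + tetVal z V s' t' r') :
    a₁ ≤ a₂ ∧ b₁ ≤ b₂ := by
  set y := fun P x => z P x - hD a₁ a₂ b₁ b₂ P x
  have hval : ∀ V, 0 < V → ∀ s t r, tetVal z V s t r =
      tetVal (hD a₁ a₂ b₁ b₂) V s t r + V * tetVal y 1 s t r := by
    intro V hV s t r
    rw [← hlin V hV]
    simp [tetVal, y]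
  have key : ∀ s t r s' t' r',
      tetVal (hD a₁ a₂ b₁ b₂) 1 (s + s') (t + t') (r + r') ≤
        tetVal (hD a₁ a₂ b₁ b₂) 1 s t r + tetVal (hD a₁ a₂ b₁ b₂) 1 s' t' r' := by
    intro s t r s' t' r'
    refine sub_nonneg.1 (nonneg_of_forall_add_mul_nonneg
      (k := tetVal y 1 s t r + tetVal y 1 s' t' r' - tetVal y 1 (s + s') (t + t') (r + r'))
      fun V hV => ?_)
    have h := hadd V hV s t r s' t' r'
    simp only [hval V hV, tetVal_hD _ _ _ _ hV] at h
    simp only [tetVal_hD _ _ _ _ one_pos]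
    linarith
  constructor
  · have h := key 1 2 3 2 1 3
    simp only [tetVal_hD _ _ _ _ one_pos] at h
    norm_num [max_def] at h
    linarith
  · have h := key (-1) (-2) (-3) (-2) (-1) (-3)
    simp only [tetVal_hD _ _ _ _ one_pos] at h
    norm_num [max_def] at h
    linarith

lemma sub_le_of_tri_subadditive
    (hadd : ∀ P, IsPolytope0 P → ∀ x y, z P (x + y) ≤ z P x + z P y)
    {a₁ a₂ b₁ b₂ : ℝ}
    (htri : ∀ a b, LinearIndependent ℝ ![a, b] → ∀ x,
      z (tri a b) x - hD a₁ a₂ b₁ b₂ (tri a b) x = 0) :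
    a₂ - a₁ ≤ b₂ ∧ b₂ - b₁ ≤ a₂ := by
  have key : ∀ s t s' t' : ℝ, hD a₁ a₂ b₁ b₂ (tri (stdVec 0) (stdVec 1)) !₂[s + s', t + t', 0] ≤
      hD a₁ a₂ b₁ b₂ (tri (stdVec 0) (stdVec 1)) !₂[s, t, 0] +
        hD a₁ a₂ b₁ b₂ (tri (stdVec 0) (stdVec 1)) !₂[s', t', 0] := by
    intro s t s' t'
    have h := htri _ _ linearIndependent_stdVec_zero_one
    simp only [← sub_eq_zero.1 (h _)]
    refine le_trans (le_of_eq ?_) (hadd _ (isPolytope0_tri _ _) _ _)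
    congr 1
    ext i
    fin_cases i <;> simp
  simp only [hD_tri _ _ _ _ _ linearIndependent_stdVec_zero_one, inner_stdVec] at key
  constructor
  · have h := key 1 2 (-1) 2
    norm_num at h
    linarith
  · have h := key 1 (-2) (-1) (-2)
    norm_num at h
    linarith

lemma mPlus1_tri {a b : Euc 3} (h : LinearIndependent ℝ ![a, b]) (x : Euc 3) :
    mPlus1 (tri a b) x = 0 :=
  mPlus1_eq_zero_of_sdim_lt (isPolytope0_tri a b).2 (by rw [sdim_tri h]; norm_num) x

lemma mPlus1_seg {a : Euc 3} (h : a ≠ 0) (x : Euc 3) : mPlus1 (seg a) x = 0 :=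
  mPlus1_eq_zero_of_sdim_lt (isPolytope0_seg a).2 (by rw [sdim_seg h]; norm_num) x

lemma tetVal_mPlus1_pos : 0 < tetVal mPlus1 1 0 0 1 := by
  have h : (!₂[0 / 1, 0, 1] : Euc 3) = stdVec 2 := by
    ext i
    fin_cases i <;> simp [stdVec]
  rw [tetVal, one_smul, h]
  exact mPlus1_tet_pos

lemma tetVal_mPlus1_neg : tetVal mPlus1 1 0 0 (-1) = 0 := by
  have h : (!₂[0 / 1, 0, -1] : Euc 3) = -stdVec 2 := by
    ext i
    fin_cases i <;> simp [stdVec]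
  rw [tetVal, one_smul, h]
  exact mPlus1_tet_neg

lemma tetVal_mMinus1 (V s t r : ℝ) : tetVal mMinus1 V s t r = tetVal mPlus1 V (-s) (-t) (-r) := by
  rw [tetVal, mMinus1_eq, tetVal]
  congr 1
  ext i
  fin_cases i <;> simp [neg_div]

theorem IsCovVal.exists_eq (hz : IsCovVal z) (h0 : ∀ P, IsPolytope0 P → ∀ x, 0 ≤ z P x)
    (hadd : ∀ P, IsPolytope0 P → ∀ x y, z P (x + y) ≤ z P x + z P y) :
    ∃ a₁ a₂ b₁ b₂ c₁ c₂ : ℝ,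
      0 ≤ a₁ ∧ 0 ≤ a₂ ∧ 0 ≤ b₁ ∧ 0 ≤ b₂ ∧ 0 ≤ c₁ ∧ 0 ≤ c₂ ∧
      a₁ ≤ a₂ ∧ b₁ ≤ b₂ ∧ a₂ - a₁ ≤ b₂ ∧ b₂ - b₁ ≤ a₂ ∧
      ∀ P, IsPolytope0 P → ∀ x,
        z P x = c₁ * mPlus1 P x + c₂ * mMinus1 P x + hD a₁ a₂ b₁ b₂ P x := by
  obtain ⟨a₁, a₂, b₁, b₂, ha₁, ha₂, hb₁, hb₂, hseg, htri⟩ := hz.sub_hD_eq_zero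
  have hy := hz.sub (isCovVal_hD a₁ a₂ b₁ b₂)
  set y := fun P x => z P x - hD a₁ a₂ b₁ b₂ P x with hydef
  have hbdd : ∀ s t r, ∃ C, ∀ V, 0 < V → C ≤ tetVal y V s t r := by
    intro s t r
    refine ⟨-tetVal (hD a₁ a₂ b₁ b₂) 1 s t r, fun V hV => ?_⟩
    have h1 : tetVal y V s t r = tetVal z V s t r - tetVal (hD a₁ a₂ b₁ b₂) V s t r := rfl
    have h2 : 0 ≤ tetVal z V s t r := h0 _ (isPolytope0_tet _ _ _) _
    rw [h1, tetVal_hD _ _ _ _ hV, tetVal_hD _ _ _ _ one_pos]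
    linarith
  have hlin : ∀ V, 0 < V → ∀ s t r, tetVal y V s t r = V * tetVal y 1 s t r :=
    fun V hV => hy.tetVal_eq_mul htri hbdd hV
  have hnonneg : ∀ s t r, 0 ≤ tetVal y 1 s t r := by
    intro s t r
    obtain ⟨C, hC⟩ := hbdd s t r
    exact nonneg_of_bddBelow_mul fun V hV => hlin V hV s t r ▸ hC V hV
  obtain ⟨hle₁, hle₂⟩ := le_of_tetVal_subadditive hlin fun V _ s t r s' t' r' => by
    refine le_trans (le_of_eq ?_) (hadd _ (isPolytope0_tet _ _ _) _ _)
    rw [tetVal]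
    congr 1
    ext i
    fin_cases i <;> simp [add_div]
  obtain ⟨hle₃, hle₄⟩ := sub_le_of_tri_subadditive hadd htri
  have hm := tetVal_mPlus1_pos
  set c₁ := tetVal y 1 0 0 1 / tetVal mPlus1 1 0 0 1 with hc₁
  set c₂ := tetVal y 1 0 0 (-1) / tetVal mPlus1 1 0 0 1 with hc₂
  have hM := isCovVal_mPlus1.const_mul c₁
  have hM' := isCovVal_mMinus1.const_mul c₂
  have hw := (hy.sub hM).sub hM'
  set w := fun P x => y P x - c₁ * mPlus1 P x - c₂ * mMinus1 P x with hwdef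
  have hwval : ∀ V s t r, tetVal w V s t r =
      tetVal y V s t r - c₁ * tetVal mPlus1 V s t r - c₂ * tetVal mMinus1 V s t r :=
    fun _ _ _ _ => rfl
  have hmlin : ∀ V, 0 < V → ∀ s t r, tetVal mPlus1 V s t r = V * tetVal mPlus1 1 s t r :=
    fun V hV => isCovVal_mPlus1.tetVal_eq_mul (fun _ _ h => mPlus1_tri h)
      (fun _ _ _ => ⟨0, fun _ _ => mPlus1_nonneg _ _⟩) hV
  have hwseg : ∀ a, a ≠ 0 → ∀ x, w (seg a) x = 0 := fun a ha x => by
    simp only [hwdef, mMinus1_eq, mPlus1_seg ha, mul_zero, sub_zero]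
    exact hseg a ha x
  have hwtri : ∀ a b, LinearIndependent ℝ ![a, b] → ∀ x, w (tri a b) x = 0 := fun a b h x => by
    simp only [hwdef, mMinus1_eq, mPlus1_tri h, mul_zero, sub_zero]
    exact htri a b h x
  have hwlin : ∀ V, 0 < V → ∀ s t r, tetVal w V s t r = V * tetVal w 1 s t r := by
    intro V hV s t r
    simp only [hwval, tetVal_mMinus1]
    rw [hlin V hV, hmlin V hV, hmlin V hV]
    ring
  have hwpos : tetVal w 1 0 0 1 = 0 := by
    rw [hwval, tetVal_mMinus1, neg_zero, tetVal_mPlus1_neg, hc₁, div_mul_cancel₀ _ hm.ne']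
    ring
  have hwneg : tetVal w 1 0 0 (-1) = 0 := by
    rw [hwval, tetVal_mMinus1, neg_zero, neg_neg, tetVal_mPlus1_neg, hc₂,
      div_mul_cancel₀ _ hm.ne']
    ring
  refine ⟨a₁, a₂, b₁, b₂, c₁, c₂, ha₁ ▸ h0 _ (isPolytope0_seg _) _,
    ha₂ ▸ h0 _ (isPolytope0_tri _ _) _, hb₁ ▸ h0 _ (isPolytope0_seg _) _,
    hb₂ ▸ h0 _ (isPolytope0_tri _ _) _, div_nonneg (hnonneg _ _ _) hm.le,
    div_nonneg (hnonneg _ _ _) hm.le, hle₁, hle₂, hle₃, hle₄, fun P hP x => ?_⟩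
  have h : w P x = 0 := (hw.isVal x).eq_zero (fun I v hv => ?_) hP
  · simp only [hwdef, hydef] at h
    linarith
  · rcases spx_cases I v hv with h | ⟨a, ha, h⟩ | ⟨a, b, hab, h⟩ | ⟨a, b, c, habc, h⟩
    · rw [h]
      exact hw.apply_zero x
    · rw [h]
      exact hwseg a ha x
    · rw [h]
      exact hwtri a b hab x
    · rw [h]
      exact hw.tet_eq_zero hwtri hwlin hwpos hwneg habc x

end Classification

/-- Theorem 1.7: `Z : P_o^3 → K_o^3` is an `SL(3)` covariant Minkowski valuation iff there
are constants `a₁,a₂,b₁,b₂,c₁,c₂ ≥ 0` with `a₁ ≤ a₂`, `b₁ ≤ b₂`, `a₂ - a₁ ≤ b₂`,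
`b₂ - b₁ ≤ a₂` such that `Z P = c₁ M⁺P + c₂ M⁻P + D_{a₁,a₂,b₁,b₂} P` for every
`P ∈ P_o^3` (stated via support functions). -/
theorem sl3_covariant_Minkowski_classification
    (Z : Set (Euc 3) → Set (Euc 3))
    (hbody : ∀ P : Set (Euc 3), IsPolytope0 P → IsConvexBody0 (Z P)) :
    (ValuationMink Z ∧ SLCovariant Z) ↔
      ∃ a₁ a₂ b₁ b₂ c₁ c₂ : ℝ,
        0 ≤ a₁ ∧ 0 ≤ a₂ ∧ 0 ≤ b₁ ∧ 0 ≤ b₂ ∧ 0 ≤ c₁ ∧ 0 ≤ c₂ ∧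
        a₁ ≤ a₂ ∧ b₁ ≤ b₂ ∧ a₂ - a₁ ≤ b₂ ∧ b₂ - b₁ ≤ a₂ ∧
        ∀ P : Set (Euc 3), IsPolytope0 P → ∀ x : Euc 3,
          supp (Z P) x = c₁ * mPlus1 P x + c₂ * mMinus1 P x + hD a₁ a₂ b₁ b₂ P x := by
  rw [valuationMink_iff hbody, sLCovariant_iff hbody]
  constructor
  · rintro ⟨hval, hcov⟩
    have hne : ∀ P, IsPolytope0 P → (Z P).Nonempty := fun P hP => ⟨0, (hbody P hP).2.2⟩
    have hz : IsCovVal fun P => supp (Z P) :=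
      { isVal := hval
        isCov := hcov
        continuous := fun P hP => continuous_supp (hbody P hP).1 (hne P hP)
        smul := fun P _ c hc x => supp_smul (Z P) hc x }
    exact hz.exists_eq (fun P hP x => supp_nonneg (hbody P hP).1 (hbody P hP).2.2 x)
      fun P hP x y => supp_add_le (hbody P hP).1 (hne P hP) x y
  · rintro ⟨a₁, a₂, b₁, b₂, c₁, c₂, -, -, -, -, -, -, -, -, -, -, h⟩
    refine ⟨fun x => ?_, fun φ P hP x => ?_⟩
    · exact ((((isVal_mPlus1 x).const_mul c₁).add
        ((isCovVal_mMinus1.isVal x).const_mul c₂)).add (isVal_hD a₁ a₂ b₁ b₂ x)).congr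
        fun P hP => (h P hP x).symm
    · dsimp only
      rw [h _ (hP.matAct φ), h P hP, isCov_mPlus1 φ P hP, isCovVal_mMinus1.isCov φ P hP,
        isCov_hD a₁ a₂ b₁ b₂ φ P hP]
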